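/- Let Φ = (φ_e)_{e∈E} be an irreducible finite similarity IFS on ℝ^d, and let μ be a probability measure on the finite set E with μ({e}) > 0 for all e ∈ E. Then π_*β(BA) = 0, where β = μ^{⊗ℕ} is the Bernoulli measure on E^ℕ and π is the coding map of Φ. -/

import Mathlib

open MeasureTheory Filter Topology

noncomputable section

def ContractingSimilarity {d : ℕ} (φ : EuclideanSpace ℝ (Fin d) → EuclideanSpace ℝ (Fin d)) :
    Prop :=
  ∃ c : ℝ, 0 < c ∧ c < 1 ∧ ∀ x y, dist (φ x) (φ y) = c * dist x y

def IrreducibleIFS {E : Type*} {d : ℕ}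
    (φ : E → EuclideanSpace ℝ (Fin d) → EuclideanSpace ℝ (Fin d)) : Prop :=
  ¬ ∃ L : AffineSubspace ℝ (EuclideanSpace ℝ (Fin d)),
      (L : Set (EuclideanSpace ℝ (Fin d))).Nonempty ∧ L ≠ ⊤ ∧
        ∀ e, φ e '' (L : Set (EuclideanSpace ℝ (Fin d))) = (L : Set (EuclideanSpace ℝ (Fin d)))

def seqApply {E X : Type*} (φ : E → X → X) (b : ℕ → E) : ℕ → X → X
  | 0 => id
  | n + 1 => fun x => seqApply φ b n (φ (b n) x)

/-- `β` is the Bernoulli measure `μ^{⊗ℕ}` on `E^ℕ`. -/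
def IsBernoulli {E : Type*} [MeasurableSpace E] (μ : Measure E) (β : Measure (ℕ → E)) : Prop :=
  IsProbabilityMeasure β ∧
    ∀ (F : Finset ℕ) (s : ℕ → Set E), (∀ i ∈ F, MeasurableSet (s i)) →
      β {b | ∀ i ∈ F, b i ∈ s i} = ∏ i ∈ F, μ (s i)

def badlyApproximable (d : ℕ) : Set (EuclideanSpace ℝ (Fin d)) :=
  {α | ∃ c : ℝ, 0 < c ∧ ∀ q : ℕ, 0 < q → ∀ p : Fin d → ℤ,
    c * (q : ℝ) ^ (-(1 : ℝ) / d) ≤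
      ‖(q : ℝ) • α - (EuclideanSpace.equiv (Fin d) ℝ).symm (fun i => (p i : ℝ))‖}


namespace BA

section Mahler

variable {E : Type*} [NormedAddCommGroup E] [NormedSpace ℝ E] [FiniteDimensional ℝ E]
variable {ι : Type*} [Fintype ι] [DecidableEq ι]

/-- the lattice spanned by a basis -/
def Lat (b : Module.Basis ι ℝ E) : Submodule ℤ E := Submodule.span ℤ (Set.range b)

/-- automorphisms of the lattice -/
def Gam (b : Module.Basis ι ℝ E) : Set (E →L[ℝ] E) :=
  {γ | |γ.det| = 1 ∧ ∃ γi : E →L[ℝ] E, |γi.det| = 1 ∧ γ * γi = 1 ∧ γi * γ = 1 ∧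
    (∀ ζ ∈ Lat b, γ ζ ∈ Lat b) ∧ (∀ ζ ∈ Lat b, γi ζ ∈ Lat b)}

lemma mahler_span (b : Module.Basis ι ℝ E) (δ : ℝ) (hδ : 0 < δ) :
    ∃ R : ℝ, ∀ z : E →L[ℝ] E, |z.det| = 1 → (∀ ζ ∈ Lat b, ζ ≠ 0 → δ ≤ ‖z ζ‖) →
      Submodule.span ℝ {ζ : E | ζ ∈ Lat b ∧ ‖z ζ‖ ≤ R} = ⊤ := by
  let _ : MeasurableSpace E := borel E
  have : BorelSpace E := ⟨rfl⟩
  set μ : Measure E := Measure.addHaar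
  set r := δ / 4 with hr
  have hr0 : 0 < r := by positivity
  have hball : 0 < μ (Metric.ball (0:E) r) := Metric.measure_ball_pos _ _ hr0
  have hF : μ (ZSpan.fundamentalDomain b) ≠ ⊤ :=
    ((ZSpan.fundamentalDomain_isBounded b).measure_lt_top).ne
  obtain ⟨J, hJ⟩ : ∃ J : ℕ, μ (ZSpan.fundamentalDomain b) * 2 ^ (Module.finrank ℝ E) <
      J * μ (Metric.ball (0:E) r) := by
    apply ENNReal.exists_nat_mul_gt hball.ne'
    exact ENNReal.mul_ne_top hF (by simp)
  set τ : ℝ := 4 * r * J + 2 * r with hτ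
  refine ⟨δ + τ, fun z hz hsh => ?_⟩
  by_contra hne
  obtain ⟨f0, hf0, hker⟩ := Submodule.exists_le_ker_of_lt_top _ (lt_top_iff_ne_top.2 hne)
  set f : E →L[ℝ] ℝ := f0.toContinuousLinearMap with hf
  -- transfer f to the image side
  have hzdet : z.det ≠ 0 := by intro h; rw [h] at hz; simp at hz
  set ze : E ≃L[ℝ] E := z.toContinuousLinearEquivOfDetNeZero hzdet with hze
  have hzea : ∀ x, ze x = z x := fun x => rfl
  set g : E →L[ℝ] ℝ := f.comp (ze.symm : E →L[ℝ] E) with hg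
  have hgz : ∀ x, g (z x) = f0 x := by
    intro x
    have : ze.symm (z x) = x := by rw [← hzea]; simp
    simp [hg, this, hf]
  have hg0 : g ≠ 0 := by
    intro h
    apply hf0
    ext x
    rw [← hgz x, h]; simp
  have hgn : 0 < ‖g‖ := norm_pos_iff.2 hg0
  obtain ⟨e, he1, hge⟩ : ∃ e : E, ‖e‖ ≤ 1 ∧ ‖g‖ / 2 < g e := by
    obtain ⟨x, hx1, hx2⟩ := ContinuousLinearMap.exists_lt_apply_of_lt_opNorm g (half_lt_self hgn)
    rcases le_total 0 (g x) with h | h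
    · exact ⟨x, hx1.le, by rwa [Real.norm_of_nonneg h] at hx2⟩
    · exact ⟨-x, by simpa using hx1.le, by rw [Real.norm_of_nonpos h] at hx2; simpa using hx2⟩
  have hge0 : 0 < g e := lt_trans (by positivity) hge
  have hq : ∀ w : E, |g w / g e| ≤ 2 * ‖w‖ := by
    intro w
    rw [abs_div, abs_of_pos hge0, div_le_iff₀ hge0]
    have := g.le_opNorm w
    rw [Real.norm_eq_abs] at this
    nlinarith [norm_nonneg w]
  set B : Set E := {x | ‖x - (g x / g e) • e‖ < δ ∧ |g x / g e| < τ} with hB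
  have hsub : (⋃ j ∈ Finset.range J, Metric.ball ((4 * r * (j:ℝ)) • e) r) ⊆ B := by
    intro y hy
    simp only [Set.mem_iUnion, Finset.mem_range, Metric.mem_ball, dist_eq_norm] at hy
    obtain ⟨j, hj, hy⟩ := hy
    set w := y - (4 * r * (j:ℝ)) • e with hw
    have hyw : y = (4 * r * (j:ℝ)) • e + w := by rw [hw]; abel
    have hgy : g y / g e = 4 * r * j + g w / g e := by
      rw [hyw]; simp only [map_add, map_smul, smul_eq_mul]; field_simp
    have hqw := hq w
    constructor
    · have : y - (g y / g e) • e = w - (g w / g e) • e := by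
        rw [hgy, hyw, add_smul]; abel
      rw [this]
      calc _ ≤ ‖w‖ + ‖(g w / g e) • e‖ := norm_sub_le _ _
        _ ≤ ‖w‖ + 2 * ‖w‖ * 1 := by
            rw [norm_smul, Real.norm_eq_abs]; gcongr
        _ < δ := by rw [hr] at hy; linarith
    · rw [hgy]
      have hjJ : (j:ℝ) ≤ J := by exact_mod_cast hj.le
      have h1 : 4 * r * (j:ℝ) ≤ 4 * r * J := by gcongr
      have h2 : 0 ≤ 4 * r * (j:ℝ) := by positivity
      rw [abs_lt]; rw [abs_le] at hqw
      constructor <;> linarith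
  have hvol : J * μ (Metric.ball (0:E) r) ≤ μ B := by
    calc _ = μ (⋃ j ∈ Finset.range J, Metric.ball ((4 * r * (j:ℝ)) • e) r) := by
          rw [measure_biUnion_finset]
          · simp [Measure.addHaar_ball_center]
          · intro i _ j _ hij
            apply Metric.ball_disjoint_ball
            rw [dist_eq_norm, ← sub_smul, norm_smul, ← mul_sub, norm_mul]
            have h1 : (1:ℝ) ≤ ‖(i:ℝ) - j‖ := by
              rw [Real.norm_eq_abs]
              have : (1:ℤ) ≤ |(i:ℤ) - j| := Int.one_le_abs (by omega)
              exact_mod_cast this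
            have h2 : 1/2 ≤ ‖e‖ := by
              have := g.le_opNorm e
              rw [Real.norm_of_nonneg hge0.le] at this
              nlinarith
            rw [Real.norm_of_nonneg (by positivity : 0 ≤ 4 * r)]
            nlinarith [mul_le_mul h1 h2 (by norm_num) (by positivity)]
          · intro j _; exact Metric.isOpen_ball.measurableSet
      _ ≤ μ B := measure_mono hsub
  have hsymm : ∀ x ∈ z ⁻¹' B, -x ∈ z ⁻¹' B := by
    intro x hx
    simp only [Set.mem_preimage, hB, Set.mem_ofPred_eq, map_neg] at hx ⊢
    have h1 : -z x - (-g (z x) / g e) • e = -(z x - (g (z x) / g e) • e) := by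
      rw [neg_div, neg_smul]; abel
    rw [h1, norm_neg, neg_div, abs_neg]; exact hx
  have hconv : Convex ℝ (z ⁻¹' B) := by
    have h1 : B = (((ContinuousLinearMap.id ℝ E - (g.smulRight ((g e)⁻¹ • e))) ⁻¹' Metric.ball 0 δ) ∩
        (g ⁻¹' (Metric.ball 0 (τ * g e)))) := by
      ext x
      simp only [hB, Set.mem_ofPred_eq, Set.mem_inter_iff, Set.mem_preimage, mem_ball_zero_iff,
        sub_apply, ContinuousLinearMap.smulRight_apply,
        ContinuousLinearMap.id_apply, smul_smul, Real.norm_eq_abs, div_eq_mul_inv]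
      rw [abs_mul, abs_inv, abs_of_pos hge0, ← div_eq_mul_inv |g x|, div_lt_iff₀ hge0]
    rw [h1]
    refine Convex.is_linear_preimage (Convex.inter ?_ ?_) z.toLinearMap.isLinear
    · exact (convex_ball _ _).is_linear_preimage (ContinuousLinearMap.toLinearMap _).isLinear
    · exact (convex_ball _ _).is_linear_preimage (ContinuousLinearMap.toLinearMap _).isLinear
  have hvolz : μ (z ⁻¹' B) = μ B := by
    rw [Measure.addHaar_preimage_continuousLinearMap μ hzdet]
    rw [abs_inv, hz]; simp
  have : Countable (Lat b).toAddSubgroup :=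
    inferInstanceAs (Countable (Submodule.span ℤ (Set.range b)))
  obtain ⟨x, hx0, hxB⟩ := exists_ne_zero_mem_lattice_of_measure_mul_two_pow_lt_measure
    (L := (Lat b).toAddSubgroup) (μ := μ) (ZSpan.isAddFundamentalDomain' b μ) hsymm hconv
    (by rw [hvolz]; exact hJ.trans_le hvol)
  have hxL : (x : E) ∈ Lat b := x.2
  have hx0' : (x : E) ≠ 0 := by simpa using hx0
  obtain ⟨h1, h2⟩ : ‖z x - (g (z x) / g e) • e‖ < δ ∧ |g (z x) / g e| < τ := hxB
  have hn : ‖z x‖ ≤ δ + τ := by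
    calc ‖z x‖ = ‖(z x - (g (z x) / g e) • e) + (g (z x) / g e) • e‖ := by simp
      _ ≤ ‖z x - (g (z x) / g e) • e‖ + ‖(g (z x) / g e) • e‖ := norm_add_le _ _
      _ ≤ δ + τ * 1 := by
          rw [norm_smul, Real.norm_eq_abs]; gcongr
      _ = δ + τ := by ring
  have hgx : g (z x) = 0 := by
    rw [hgz]
    exact hker (Submodule.subset_span ⟨hxL, hn⟩)
  rw [hgx] at h1
  simp only [zero_div, zero_smul, sub_zero] at h1
  exact absurd (hsh _ hxL hx0') (not_le.2 h1)

end Mahler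
end BA

namespace BA
set_option linter.unusedSectionVars false

section Mahler2

variable {E : Type*} [NormedAddCommGroup E] [NormedSpace ℝ E] [FiniteDimensional ℝ E]
variable {ι : Type*} [Fintype ι] [DecidableEq ι]

lemma mat_congr (M M' : Matrix ι ι ℤ) (D : ℤ) (hD : D ≠ 0) (h1 : M.det = D) (h2 : M'.det = D)
    (h : ∀ i j, D ∣ M i j - M' i j) : ∃ γ : Matrix ι ι ℤ, γ.det = 1 ∧ M = γ * M' := by
  choose K hK using h
  have h3 : M = (1 + Matrix.of K * M'.adjugate) * M' := by
    rw [add_mul, one_mul, mul_assoc, Matrix.adjugate_mul, h2, Matrix.mul_smul, mul_one]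
    ext i j
    simp only [Matrix.add_apply, Matrix.smul_apply, Matrix.of_apply, smul_eq_mul]
    linarith [hK i j]
  refine ⟨1 + Matrix.of K * M'.adjugate, ?_, h3⟩
  · have h4 := congrArg Matrix.det h3
    rw [Matrix.det_mul, h1, h2] at h4
    exact (mul_left_injective₀ hD (by simpa using h4)).symm

/-- the continuous linear map attached to an integer matrix -/
def ofMat (b : Module.Basis ι ℝ E) (M : Matrix ι ι ℤ) : E →L[ℝ] E :=
  (Matrix.toLin b b (M.map (Int.castRingHom ℝ))).toContinuousLinearMap

lemma ofMat_mul (b : Module.Basis ι ℝ E) (M N : Matrix ι ι ℤ) :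
    ofMat b (M * N) = ofMat b M * ofMat b N := by
  ext x
  simp only [ofMat, Matrix.map_mul]
  rw [Matrix.toLin_mul b b b]
  rfl

lemma ofMat_one (b : Module.Basis ι ℝ E) : ofMat b (1 : Matrix ι ι ℤ) = 1 := by
  ext x
  simp [ofMat]

lemma ofMat_det (b : Module.Basis ι ℝ E) (M : Matrix ι ι ℤ) : (ofMat b M).det = (M.det : ℝ) := by
  have : (ofMat b M).det = LinearMap.det (Matrix.toLin b b (M.map (Int.castRingHom ℝ))) := rfl
  rw [this, LinearMap.det_toLin]
  exact (RingHom.map_det (Int.castRingHom ℝ) M).symm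

lemma ofMat_basis (b : Module.Basis ι ℝ E) (M : Matrix ι ι ℤ) (j : ι) :
    ofMat b M (b j) = ∑ i, (M i j : ℝ) • b i := by
  have : ofMat b M (b j) = Matrix.toLin b b (M.map (Int.castRingHom ℝ)) (b j) := rfl
  rw [this, Matrix.toLin_self]
  simp

lemma lat_sub {b : Module.Basis ι ℝ E} (f : E →L[ℝ] E) (h : ∀ j, f (b j) ∈ Lat b) :
    ∀ ζ ∈ Lat b, f ζ ∈ Lat b := by
  intro ζ hζ
  induction hζ using Submodule.span_induction with
  | mem x hx => obtain ⟨j, rfl⟩ := hx; exact h j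
  | zero => simp
  | add x y _ _ hx hy => rw [map_add]; exact add_mem hx hy
  | smul n x _ hx => rw [map_zsmul]; exact (Lat b).smul_mem n hx

lemma basis_mem_lat (b : Module.Basis ι ℝ E) (j : ι) : b j ∈ Lat b :=
  Submodule.subset_span ⟨j, rfl⟩

lemma ofMat_lat (b : Module.Basis ι ℝ E) (M : Matrix ι ι ℤ) : ∀ ζ ∈ Lat b, ofMat b M ζ ∈ Lat b := by
  apply lat_sub
  intro j
  rw [ofMat_basis]
  refine Submodule.sum_mem _ fun i _ => ?_
  rw [Int.cast_smul_eq_zsmul]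
  exact (Lat b).smul_mem _ (basis_mem_lat b i)

lemma ofMat_gam (b : Module.Basis ι ℝ E) (M : Matrix ι ι ℤ) (h : M.det = 1) : ofMat b M ∈ Gam b := by
  refine ⟨by rw [ofMat_det, h]; simp, ofMat b M.adjugate, ?_, ?_, ?_, ofMat_lat b _, ofMat_lat b _⟩
  · rw [ofMat_det, Matrix.det_adjugate, h]; simp
  · rw [← ofMat_mul, Matrix.mul_adjugate, h, one_smul, ofMat_one]
  · rw [← ofMat_mul, Matrix.adjugate_mul, h, one_smul, ofMat_one]

lemma norm_le_basis (b : Module.Basis ι ℝ E) : ∃ K : ℝ, 0 ≤ K ∧ ∀ (f : E →L[ℝ] E) (R : ℝ), 0 ≤ R →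
    (∀ j, ‖f (b j)‖ ≤ R) → ‖f‖ ≤ K * R := by
  refine ⟨Fintype.card ι * ‖b.equivFunL.toContinuousLinearMap‖, by positivity, fun f R hR h => ?_⟩
  exact (Module.Basis.opNorm_le b hR h).trans (by simp [nsmul_eq_mul])

/-- integer basis vectors -/
lemma mahler_mat (b : Module.Basis ι ℝ E) (δ : ℝ) (hδ : 0 < δ) :
    ∃ C : ℝ, ∀ z : E →L[ℝ] E, |z.det| = 1 → (∀ ζ ∈ Lat b, ζ ≠ 0 → δ ≤ ‖z ζ‖) →
      ∃ M : Matrix ι ι ℤ, M.det ≠ 0 ∧ ‖z * ofMat b M‖ ≤ C := by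
  obtain ⟨R, hR⟩ := mahler_span b δ hδ
  obtain ⟨K, hK, hKb⟩ := norm_le_basis b
  refine ⟨K * |R|, fun z hz hsh => ?_⟩
  set s := {ζ : E | ζ ∈ Lat b ∧ ‖z ζ‖ ≤ R}
  obtain ⟨t, hts, htspan, hli⟩ := exists_linearIndependent ℝ s
  rw [hR z hz hsh] at htspan
  set bt := Module.Basis.mk hli (by rw [Subtype.range_coe]; exact htspan.ge)
  set e := b.indexEquiv bt
  set c := bt.reindex e.symm with hc
  have hcs : ∀ j, c j ∈ s := by
    intro j
    have : c j = (e j : E) := by simp [hc, bt]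
    rw [this]; exact hts (e j).2
  have hintg : ∀ j i, ∃ k : ℤ, (k:ℝ) = b.repr (c j) i := by
    intro j i
    have := (Module.Basis.mem_span_iff_repr_mem ℤ b (c j)).1 (hcs j).1 i
    simpa using this
  choose k hk using hintg
  set M : Matrix ι ι ℤ := Matrix.of (fun i j => k j i)
  have hMb : ∀ j, ofMat b M (b j) = c j := by
    intro j
    rw [ofMat_basis]
    simp only [M, Matrix.of_apply, hk]
    exact b.sum_repr (c j)
  refine ⟨M, ?_, ?_⟩
  · intro h0
    have h1 : (ofMat b M).det = 0 := by rw [ofMat_det, h0]; simp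
    have h2 : (ofMat b M : E →ₗ[ℝ] E) = (b.equiv c (Equiv.refl ι) : E →ₗ[ℝ] E) := by
      apply b.ext; intro j; simpa using hMb j
    have h3 : LinearMap.det (b.equiv c (Equiv.refl ι) : E →ₗ[ℝ] E) = 0 := by rw [← h2]; exact h1
    exact (LinearEquiv.isUnit_det' (b.equiv c (Equiv.refl ι))).ne_zero h3
  · apply hKb _ _ (abs_nonneg R)
    intro j
    have : (z * ofMat b M) (b j) = z (c j) := by rw [← hMb j]; rfl
    rw [this]
    exact (hcs j).2.trans (le_abs_self R)

lemma det_bound (C : ℝ) : ∃ B : ℕ, 0 < B ∧ ∀ f : E →L[ℝ] E, ‖f‖ ≤ C → |f.det| ≤ B := by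
  have hc : IsCompact (Metric.closedBall (0 : E →L[ℝ] E) C) := by
    have : ProperSpace (E →L[ℝ] E) := FiniteDimensional.proper ℝ _
    exact isCompact_closedBall _ _
  obtain ⟨B, hB⟩ := hc.exists_bound_of_continuousOn
    (f := fun f : E →L[ℝ] E => f.det) ContinuousLinearMap.continuous_det.continuousOn
  obtain ⟨n, hn⟩ := exists_nat_ge B
  refine ⟨n + 1, by omega, fun f hf => ?_⟩
  have := hB f (by simpa using hf)
  rw [Real.norm_eq_abs] at this
  push_cast; linarith

/-- Mahler compactness. -/
theorem mahler (b : Module.Basis ι ℝ E) (δ : ℝ) (hδ : 0 < δ) :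
    ∃ C : ℝ, ∀ z : E →L[ℝ] E, |z.det| = 1 → (∀ ζ ∈ Lat b, ζ ≠ 0 → δ ≤ ‖z ζ‖) →
      ∃ γ ∈ Gam b, ‖z * γ‖ ≤ C := by
  obtain ⟨C1, hC1⟩ := mahler_mat b δ hδ
  obtain ⟨B, hB0, hB⟩ := det_bound (E := E) C1
  have hBf : (B.factorial) ≠ 0 := Nat.factorial_ne_zero B
  have : NeZero B.factorial := ⟨hBf⟩
  -- key : determinant and reduction
  let P : (E →L[ℝ] E) → Matrix ι ι ℤ → Prop := fun z M =>
    |z.det| = 1 ∧ M.det ≠ 0 ∧ ‖z * ofMat b M‖ ≤ C1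
  have hdetle : ∀ z M, P z M → |M.det| ≤ B := by
    rintro z M ⟨h1, h2, h3⟩
    have h4 := hB _ h3
    have h5 : (z * ofMat b M).det = z.det * (ofMat b M).det := by
      exact LinearMap.det_comp _ _
    rw [h5, abs_mul, h1, one_mul, ofMat_det] at h4
    exact_mod_cast h4
  have key : ∀ (k : (Finset.Icc (-(B:ℤ)) B) × Matrix ι ι (ZMod B.factorial)), ∃ C : ℝ, ∀ z M, P z M →
      M.det = k.1 → M.map (Int.castRingHom (ZMod B.factorial)) = k.2 → ∃ γ ∈ Gam b, ‖z * γ‖ ≤ C := by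
    intro k
    by_cases hex : ∃ M0 : Matrix ι ι ℤ, M0.det ≠ 0 ∧ M0.det = k.1 ∧
        M0.map (Int.castRingHom (ZMod B.factorial)) = k.2
    · obtain ⟨M0, h0, hd0, hm0⟩ := hex
      have hu : (ofMat b M0).det ≠ 0 := by rw [ofMat_det]; exact_mod_cast h0
      set e := (ofMat b M0).toContinuousLinearEquivOfDetNeZero hu
      refine ⟨C1 * ‖(e.symm : E →L[ℝ] E)‖, fun z M hP hd hm => ?_⟩
      have hle := hdetle z M hP
      obtain ⟨γ, hγ, hMγ⟩ := mat_congr M M0 M.det hP.2.1 rfl (by rw [hd0, hd]) (by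
        intro i j
        have h1 : (M.det) ∣ (B.factorial : ℤ) := by
          rw [← Int.natAbs_dvd_natAbs, Int.natAbs_natCast]
          apply Nat.dvd_factorial
          · exact Int.natAbs_pos.2 hP.2.1
          · have : |M.det| = (M.det.natAbs : ℤ) := by simp
            omega
        refine h1.trans ?_
        rw [← ZMod.intCast_zmod_eq_zero_iff_dvd]
        have := congrFun (congrFun (hm.trans hm0.symm) i) j
        simp only [Matrix.map_apply, eq_intCast] at this
        push_cast; rw [this]; simp)
      refine ⟨ofMat b γ, ofMat_gam b γ hγ, ?_⟩
      have h1 : z * ofMat b γ = (z * ofMat b M) * (e.symm : E →L[ℝ] E) := by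
        rw [hMγ, ofMat_mul]
        ext x
        simp only [mul_apply_eq_comp]
        have : (ofMat b M0) ((e.symm : E →L[ℝ] E) x) = x := by
          exact e.apply_symm_apply x
        rw [this]
      rw [h1]
      exact (norm_mul_le _ _).trans (by gcongr; exact hP.2.2)
    · refine ⟨0, fun z M hP hd hm => ?_⟩
      exact absurd ⟨M, hP.2.1, hd, hm⟩ hex
  choose Ck hCk using key
  obtain ⟨C, hC⟩ := (Set.finite_range Ck).bddAbove
  refine ⟨C, fun z hz hsh => ?_⟩
  obtain ⟨M, hM, hn⟩ := hC1 z hz hsh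
  have hP : P z M := ⟨hz, hM, hn⟩
  have hle := hdetle z M hP
  rw [abs_le] at hle
  obtain ⟨γ, hγ, hb⟩ := hCk (⟨M.det, by simpa using hle⟩,
    M.map (Int.castRingHom (ZMod B.factorial))) z M hP rfl rfl
  exact ⟨γ, hγ, hb.trans (hC ⟨_, rfl⟩)⟩

lemma gam_mul {b : Module.Basis ι ℝ E} {γ γ' : E →L[ℝ] E} (h : γ ∈ Gam b) (h' : γ' ∈ Gam b) :
    γ * γ' ∈ Gam b := by
  obtain ⟨hd, γi, hdi, h1, h2, h3, h4⟩ := h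
  obtain ⟨hd', γi', hdi', h1', h2', h3', h4'⟩ := h'
  refine ⟨?_, γi' * γi, ?_, ?_, ?_, fun ζ hζ => h3 _ (h3' _ hζ), fun ζ hζ => h4' _ (h4 _ hζ)⟩
  · have : (γ * γ').det = γ.det * γ'.det := LinearMap.det_comp _ _
    rw [this, abs_mul, hd, hd', one_mul]
  · have : (γi' * γi).det = γi'.det * γi.det := LinearMap.det_comp _ _
    rw [this, abs_mul, hdi, hdi', one_mul]
  · rw [mul_assoc, ← mul_assoc γ', h1', one_mul, h1]
  · rw [mul_assoc, ← mul_assoc γi, h2, one_mul, h2']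

lemma gam_inv {b : Module.Basis ι ℝ E} {γ : E →L[ℝ] E} (h : γ ∈ Gam b) :
    ∃ γi ∈ Gam b, γ * γi = 1 ∧ γi * γ = 1 := by
  obtain ⟨hd, γi, hdi, h1, h2, h3, h4⟩ := h
  exact ⟨γi, ⟨hdi, γ, hd, h2, h1, h4, h3⟩, h1, h2⟩

/-- discreteness -/
lemma gam_discrete (b : Module.Basis ι ℝ E) : ∃ ε > 0, ∀ γ ∈ Gam b, ‖γ - 1‖ ≤ ε → γ = 1 := by
  set K := ‖b.equivFunL.toContinuousLinearMap‖
  set S := ∑ j, ‖b j‖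
  refine ⟨1 / (2 * (K + 1) * (S + 1)), by positivity, fun γ hγ hn => ?_⟩
  obtain ⟨hd, γi, hdi, h1, h2, h3, h4⟩ := hγ
  have : (γ : E →ₗ[ℝ] E) = (1 : E →L[ℝ] E) := by
    apply b.ext
    intro j
    have hmem : γ (b j) - b j ∈ Lat b := sub_mem (h3 _ (basis_mem_lat b j)) (basis_mem_lat b j)
    have hbj : ‖b j‖ ≤ S := Finset.single_le_sum (f := fun j => ‖b j‖) (fun i _ => norm_nonneg _)
      (Finset.mem_univ j)
    have hnorm : ‖γ (b j) - b j‖ ≤ 1 / (2 * (K + 1) * (S + 1)) * S := by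
      have := (γ - 1).le_opNorm (b j)
      simp only [sub_apply, one_apply_eq_self] at this
      refine this.trans ?_
      gcongr
    have hz : γ (b j) - b j = 0 := by
      apply b.repr.injective
      ext i
      obtain ⟨k, hk⟩ : ∃ k : ℤ, (k:ℝ) = b.repr (γ (b j) - b j) i := by
        simpa using (Module.Basis.mem_span_iff_repr_mem ℤ b _).1 hmem i
      have h5 : |b.repr (γ (b j) - b j) i| < 1 := by
        have h6 : ‖b.equivFunL (γ (b j) - b j)‖ ≤ K * ‖γ (b j) - b j‖ :=
          b.equivFunL.toContinuousLinearMap.le_opNorm _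
        have h7 : ‖b.equivFunL (γ (b j) - b j) i‖ ≤ ‖b.equivFunL (γ (b j) - b j)‖ :=
          norm_le_pi_norm _ i
        have h8 : b.equivFunL (γ (b j) - b j) i = b.repr (γ (b j) - b j) i := rfl
        rw [h8, Real.norm_eq_abs] at h7
        have hK : 0 ≤ K := norm_nonneg _
        have hS : 0 ≤ S := Finset.sum_nonneg fun i _ => norm_nonneg _
        have h9 : K * (1 / (2 * (K + 1) * (S + 1)) * S) < 1 := by
          rw [div_mul_eq_mul_div, one_mul, ← mul_div_assoc, div_lt_one (by positivity)]
          nlinarith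
        calc _ ≤ _ := h7
          _ ≤ _ := h6
          _ ≤ K * (1 / (2 * (K + 1) * (S + 1)) * S) := by gcongr
          _ < 1 := h9
      rw [← hk] at h5 ⊢
      have : |k| < 1 := by exact_mod_cast h5
      have : k = 0 := Int.abs_lt_one_iff.1 this
      simp [this]
    simpa using sub_eq_zero.1 hz
  ext x
  exact congrArg (fun f : E →ₗ[ℝ] E => f x) this

end Mahler2
end BA

namespace BA
set_option linter.unusedSectionVars false
set_option linter.unusedSimpArgs false

abbrev VV (d : ℕ) := EuclideanSpace ℝ (Fin d)
abbrev WW (d : ℕ) := VV d × ℝ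
abbrev UU (d : ℕ) := unitary (VV d →L[ℝ] VV d)

variable {d : ℕ}

lemma U_mul (A B : UU d) (x : VV d) : (A * B).1 x = A.1 (B.1 x) := rfl
lemma U_one (x : VV d) : (1 : UU d).1 x = x := rfl
@[simp] lemma U_inv_apply (A : UU d) (x : VV d) : (A⁻¹).1 (A.1 x) = x := by
  rw [← U_mul, inv_mul_cancel]; rfl
@[simp] lemma U_apply_inv (A : UU d) (x : VV d) : A.1 ((A⁻¹).1 x) = x := by
  rw [← U_mul, mul_inv_cancel]; rfl
@[simp] lemma U_norm (A : UU d) (x : VV d) : ‖A.1 x‖ = ‖x‖ :=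
  (Unitary.linearIsometryEquiv A).norm_map x

lemma U_norm_le (A : UU d) : ‖A.1‖ ≤ 1 :=
  ContinuousLinearMap.opNorm_le_bound _ zero_le_one (fun x => by simp)

lemma U_compact : CompactSpace (UU d) := by
  refine isCompact_iff_compactSpace.1 (?_ : IsCompact (unitary (VV d →L[ℝ] VV d) : Set (VV d →L[ℝ] VV d)))
  have : ProperSpace (VV d →L[ℝ] VV d) := FiniteDimensional.proper ℝ _
  apply Metric.isCompact_of_isClosed_isBounded
  · have : (↑(unitary (VV d →L[ℝ] VV d)) : Set (VV d →L[ℝ] VV d)) =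
        {x | star x * x = 1} ∩ {x | x * star x = 1} := by
      ext x; exact Unitary.mem_iff
    rw [this]
    have hst : Continuous (fun x : VV d →L[ℝ] VV d => star x) :=
      (ContinuousLinearMap.adjoint (𝕜 := ℝ) (E := VV d) (F := VV d)).continuous
    apply IsClosed.inter
    · exact isClosed_eq (hst.mul continuous_id') continuous_const
    · exact isClosed_eq (continuous_id'.mul hst) continuous_const
  · rw [isBounded_iff_forall_norm_le]
    exact ⟨1, fun x hx => U_norm_le ⟨x, hx⟩⟩

lemma U_det (A : UU d) : |A.1.det| = 1 := by
  set μ : Measure (VV d) := volume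
  have h0 : A.1.det ≠ 0 := by
    intro h
    have h1 : (A⁻¹.1 * A.1).det = 1 := by
      have : A⁻¹.1 * A.1 = 1 := congrArg Subtype.val (inv_mul_cancel A)
      rw [this]; exact LinearMap.det_id
    have h2 : (A⁻¹.1 * A.1).det = A⁻¹.1.det * A.1.det := LinearMap.det_comp _ _
    rw [h2, h, mul_zero] at h1
    exact zero_ne_one h1
  have h3 := Measure.addHaar_preimage_continuousLinearMap μ h0 (Metric.ball 0 1)
  have h4 : A.1 ⁻¹' (Metric.ball 0 1) = Metric.ball 0 1 := by
    ext x; simp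
  rw [h4] at h3
  have h5 : μ (Metric.ball 0 1) ≠ 0 := (Metric.measure_ball_pos _ _ one_pos).ne'
  have h6 : μ (Metric.ball 0 1) ≠ ⊤ := measure_ball_lt_top.ne
  have h7 := congrArg ENNReal.toReal h3
  rw [ENNReal.toReal_mul, ENNReal.toReal_ofReal (abs_nonneg _), abs_inv] at h7
  have h8 : (μ (Metric.ball 0 1)).toReal ≠ 0 := (ENNReal.toReal_pos h5 h6).ne'
  have h9 : |A.1.det| ≠ 0 := abs_ne_zero.2 h0
  field_simp at h7
  exact h7

/-- similarities of Euclidean space -/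
@[ext] structure Sim (d : ℕ) where
  c : ℝ
  hc : 0 < c
  O : UU d
  a : VV d

namespace Sim

/-- action on points -/
def act (g : Sim d) (x : VV d) : VV d := g.c • g.O.1 x + g.a

instance : Mul (Sim d) := ⟨fun g h => ⟨g.c * h.c, mul_pos g.hc h.hc, g.O * h.O, g.act h.a⟩⟩
instance : One (Sim d) := ⟨⟨1, one_pos, 1, 0⟩⟩
instance : Inv (Sim d) := ⟨fun g => ⟨g.c⁻¹, inv_pos.2 g.hc, g.O⁻¹, -(g.c⁻¹ • (g.O⁻¹).1 g.a)⟩⟩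

@[simp] lemma mul_c (g h : Sim d) : (g * h).c = g.c * h.c := rfl
@[simp] lemma mul_O (g h : Sim d) : (g * h).O = g.O * h.O := rfl
lemma mul_a (g h : Sim d) : (g * h).a = g.act h.a := rfl
@[simp] lemma one_c : (1 : Sim d).c = 1 := rfl
@[simp] lemma one_O : (1 : Sim d).O = 1 := rfl
@[simp] lemma one_a : (1 : Sim d).a = 0 := rfl
@[simp] lemma inv_c (g : Sim d) : (g⁻¹).c = g.c⁻¹ := rfl
@[simp] lemma inv_O (g : Sim d) : (g⁻¹).O = g.O⁻¹ := rfl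
lemma inv_a (g : Sim d) : (g⁻¹).a = -(g.c⁻¹ • (g.O⁻¹).1 g.a) := rfl

lemma mul_act (g h : Sim d) (x : VV d) : (g * h).act x = g.act (h.act x) := by
  simp only [act, mul_c, mul_O, mul_a, U_mul, map_add, map_smul, smul_add, mul_smul, add_assoc]

instance : Group (Sim d) := Group.ofLeftAxioms
  (fun g h k => by
    ext1
    · simp [mul_assoc]
    · simp [mul_assoc]
    · rw [mul_a, mul_a, mul_a, mul_act])
  (fun g => by
    ext1
    · simp
    · simp
    · rw [mul_a]; simp [act, U_one])
  (fun g => by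
    ext1
    · simp [g.hc.ne']
    · simp
    · rw [mul_a]; simp [act, inv_a])

@[simp] lemma one_act (x : VV d) : (1 : Sim d).act x = x := by simp [act, U_one]
@[simp] lemma inv_act_act (g : Sim d) (x : VV d) : (g⁻¹).act (g.act x) = x := by
  rw [← mul_act, inv_mul_cancel, one_act]
@[simp] lemma act_inv_act (g : Sim d) (x : VV d) : g.act ((g⁻¹).act x) = x := by
  rw [← mul_act, mul_inv_cancel, one_act]
lemma act_zero (g : Sim d) : g.act 0 = g.a := by simp [act]
lemma act_sub (g : Sim d) (x y : VV d) : g.act x - g.act y = g.c • g.O.1 (x - y) := by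
  simp [act, smul_sub]
lemma norm_act_sub (g : Sim d) (x y : VV d) : ‖g.act x - g.act y‖ = g.c * ‖x - y‖ := by
  rw [act_sub, norm_smul, U_norm, Real.norm_of_nonneg g.hc.le]

/-- translations -/
def trans (t : VV d) : Sim d := ⟨1, one_pos, 1, t⟩
@[simp] lemma trans_c (t : VV d) : (trans t).c = 1 := rfl
@[simp] lemma trans_O (t : VV d) : (trans t).O = 1 := rfl
@[simp] lemma trans_a (t : VV d) : (trans t).a = t := rfl
lemma trans_add (s t : VV d) : trans (s + t) = trans s * trans t := by
  ext1
  · simp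
  · simp
  · rw [mul_a]; simp [act, U_one, add_comm]
lemma trans_zero : trans (0 : VV d) = 1 := rfl
lemma mul_trans (g : Sim d) (s : VV d) : g * trans s = trans (g.c • g.O.1 s) * g := by
  ext1
  · simp
  · simp
  · rw [mul_a, mul_a]; simp [act, U_one, add_comm]

/-- matrices -/
def hmat (g : Sim d) : WW d →L[ℝ] WW d :=
  ((g.c • g.O.1).comp (ContinuousLinearMap.fst ℝ (VV d) ℝ) +
    (ContinuousLinearMap.snd ℝ (VV d) ℝ).smulRight g.a).prod (ContinuousLinearMap.snd ℝ (VV d) ℝ)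

lemma hmat_apply (g : Sim d) (w : WW d) : hmat g w = (g.c • g.O.1 w.1 + w.2 • g.a, w.2) := rfl

lemma hmat_mul (g h : Sim d) : hmat (g * h) = hmat g * hmat h := by
  apply ContinuousLinearMap.ext
  intro w
  rw [mul_apply_eq_comp]
  simp only [Function.comp_apply, hmat_apply, mul_c, mul_O, mul_a, U_mul, act, map_add, map_smul, smul_add, mul_smul, add_assoc]
  rw [smul_comm w.2 g.c]

lemma hmat_one : hmat (1 : Sim d) = 1 := by
  apply ContinuousLinearMap.ext
  intro w
  simp [hmat_apply, U_one]

lemma hmat_inv_mul (g : Sim d) : hmat g⁻¹ * hmat g = 1 := by rw [← hmat_mul, inv_mul_cancel, hmat_one]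
lemma hmat_mul_inv (g : Sim d) : hmat g * hmat g⁻¹ = 1 := by rw [← hmat_mul, mul_inv_cancel, hmat_one]

lemma det_mul' {E : Type*} [NormedAddCommGroup E] [NormedSpace ℝ E] (f g : E →L[ℝ] E) :
    (f * g).det = f.det * g.det := LinearMap.det_comp _ _

/-- homotheties -/
def lin (c : ℝ) (hc : 0 < c) (O : UU d) : Sim d := ⟨c, hc, O, 0⟩

lemma det_trans (t : VV d) : (hmat (trans t)).det = 1 := by
  have h2 : (2:ℝ) > 0 := by norm_num
  have h1 : lin 2 h2 1 * trans t = trans (t + t) * lin 2 h2 1 := by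
    rw [mul_trans]; simp [lin, U_one, two_smul]
  have h := congrArg (fun g => (hmat g).det) h1
  simp only [hmat_mul, trans_add, det_mul'] at h
  have hne : ∀ g : Sim d, (hmat g).det ≠ 0 := by
    intro g h0
    have := congrArg ContinuousLinearMap.det (hmat_inv_mul g)
    rw [det_mul', h0, mul_zero] at this
    have h3 : (1 : WW d →L[ℝ] WW d).det = 1 := LinearMap.det_id
    rw [h3] at this
    exact zero_ne_one this
  have h4 := hne (lin 2 h2 1)
  have h5 := hne (trans t)
  field_simp at h
  exact h.symm

lemma det_hmat (g : Sim d) : |(hmat g).det| = g.c ^ d := by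
  have h1 : g = trans g.a * lin g.c g.hc g.O := by
    ext1
    · simp [lin]
    · simp [lin]
    · rw [mul_a]; simp [lin, act]
  rw [h1, hmat_mul, det_mul', det_trans, one_mul]
  have h2 : (hmat (lin g.c g.hc g.O)).det =
      LinearMap.det (LinearMap.prodMap (g.c • (g.O.1 : VV d →ₗ[ℝ] VV d)) (LinearMap.id : ℝ →ₗ[ℝ] ℝ)) := by
    have : (hmat (lin g.c g.hc g.O) : WW d →ₗ[ℝ] WW d) = LinearMap.prodMap (g.c • (g.O.1 : VV d →ₗ[ℝ] VV d)) (LinearMap.id : ℝ →ₗ[ℝ] ℝ) := by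
      apply LinearMap.ext; intro w; simp [hmat_apply, lin]
    rw [← this]
  rw [h2, LinearMap.det_prodMap, LinearMap.det_smul, LinearMap.det_id, mul_one, abs_mul]
  have h3 := U_det g.O
  have h4 : LinearMap.det (g.O.1 : VV d →ₗ[ℝ] VV d) = g.O.1.det := rfl
  rw [h4, h3]
  simp [abs_of_pos g.hc, lin]

/-- normalised matrices -/
def Hm (g : Sim d) : WW d →L[ℝ] WW d := (g.c ^ (-(d:ℝ) / (d + 1))) • hmat g

lemma Hm_apply (g : Sim d) (w : WW d) : Hm g w = (g.c ^ (-(d:ℝ) / (d + 1))) • hmat g w := rfl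

lemma Hm_mul (g h : Sim d) : Hm (g * h) = Hm g * Hm h := by
  simp only [Hm, hmat_mul, mul_c]
  rw [Real.mul_rpow g.hc.le h.hc.le]
  apply ContinuousLinearMap.ext
  intro w
  simp only [smul_apply, mul_apply_eq_comp, map_smul, mul_smul]
  rw [smul_comm]

lemma Hm_one : Hm (1 : Sim d) = 1 := by simp [Hm, hmat_one]

lemma Hm_inv_mul (g : Sim d) : Hm g⁻¹ * Hm g = 1 := by rw [← Hm_mul, inv_mul_cancel, Hm_one]
lemma Hm_mul_inv (g : Sim d) : Hm g * Hm g⁻¹ = 1 := by rw [← Hm_mul, mul_inv_cancel, Hm_one]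

lemma Hm_trans (t : VV d) : Hm (trans t) = hmat (trans t) := by simp [Hm]

lemma det_Hm (g : Sim d) : |(Hm g).det| = 1 := by
  have h1 : (Hm g).det = (g.c ^ (-(d:ℝ) / (d + 1))) ^ (d + 1) * (hmat g).det := by
    have : (Hm g).det = LinearMap.det ((g.c ^ (-(d:ℝ) / (d + 1))) • (hmat g : WW d →ₗ[ℝ] WW d)) := rfl
    rw [this, LinearMap.det_smul]
    simp
  rw [h1, abs_mul, det_hmat, abs_pow, abs_of_pos (Real.rpow_pos_of_pos g.hc _), ← Real.rpow_natCast,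
    ← Real.rpow_mul g.hc.le, ← Real.rpow_natCast, ← Real.rpow_add g.hc]
  have : -(d:ℝ) / (d + 1) * ((d + 1 : ℕ) : ℝ) + d = 0 := by push_cast; field_simp; ring
  rw [this, Real.rpow_zero]

end Sim
end BA

namespace BA
set_option linter.unusedSectionVars false
set_option linter.unusedSimpArgs false

open Sim

/-- standard basis of `ℝ^d × ℝ` -/
def bW (d : ℕ) : Module.Basis (Fin d ⊕ Unit) ℝ (WW d) :=
  (EuclideanSpace.basisFun (Fin d) ℝ).toBasis.prod (Module.Basis.singleton Unit ℝ)

/-- an equicontractive finite system with a norming property for quadratic polynomials -/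
structure Sys (d : ℕ) where
  m : ℕ
  f : Fin m → Sim d
  c : ℝ
  hc0 : 0 < c
  hc1 : c < 1
  hfc : ∀ i, (f i).c = c
  R : ℝ
  hR : 1 ≤ R
  hball : ∀ i x, ‖x‖ ≤ R → ‖(f i).act x‖ ≤ R
  C0 : ℝ
  hC0 : 0 < C0
  norming : ∀ (α : ℝ) (l : VV d →L[ℝ] ℝ) (B : VV d →L[ℝ] VV d →L[ℝ] ℝ) (y : Fin m → VV d),
    (∀ i, ‖y i‖ ≤ R) → ∀ M : ℝ, (∀ i, |α + l ((f i).act (y i)) +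
      B ((f i).act (y i)) ((f i).act (y i))| ≤ M) → ∀ x, ‖x‖ ≤ R → |α + l x + B x x| ≤ C0 * M
  i0 : Fin m
  x0 : VV d
  hx0 : (f i0).act x0 = x0
  hx0R : ‖x0‖ ≤ R
  δ : ℝ
  hδ : 0 < δ
  hd : 0 < d

variable {d : ℕ}

def Good (δ : ℝ) (z : WW d →L[ℝ] WW d) : Prop := ∀ ζ ∈ Lat (bW d), ζ ≠ 0 → δ ≤ ‖z ζ‖

/-- prepend a letter -/
def consb {I : Type*} (i : I) (b : ℕ → I) : ℕ → I
  | 0 => i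
  | n + 1 => b n

lemma Good_mul_gam {δ : ℝ} {z γ : WW d →L[ℝ] WW d} (h : Good δ z) (hγ : γ ∈ Gam (bW d)) :
    Good δ (z * γ) := by
  intro ζ hζ h0
  obtain ⟨hd, γi, hdi, h1, h2, h3, h4⟩ := hγ
  refine h (γ ζ) (h3 ζ hζ) ?_
  intro h5
  apply h0
  have : (γi * γ) ζ = ζ := by rw [h2]; rfl
  rw [← this, mul_apply_eq_comp, h5, map_zero]

lemma Good_closed (δ : ℝ) : IsClosed {z : WW d →L[ℝ] WW d | Good δ z} := by
  have : {z : WW d →L[ℝ] WW d | Good δ z} = ⋂ ζ ∈ Lat (bW d), ⋂ (_ : ζ ≠ 0), {z | δ ≤ ‖z ζ‖} := by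
    ext z; simp [Good]
  rw [this]
  refine isClosed_biInter fun ζ _ => isClosed_iInter fun _ => ?_
  exact isClosed_le continuous_const (ContinuousLinearMap.apply ℝ (WW d) ζ).continuous.norm

namespace Sys
variable (S : Sys d)

def prodw (w : List (Fin S.m)) : Sim d := (w.map S.f).prod

lemma prodw_nil : S.prodw [] = 1 := rfl
lemma prodw_cons (i : Fin S.m) (w : List (Fin S.m)) : S.prodw (i :: w) = S.f i * S.prodw w := by
  simp [prodw]
lemma prodw_append (v w : List (Fin S.m)) : S.prodw (v ++ w) = S.prodw v * S.prodw w := by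
  simp [prodw]

def Kset (z : WW d →L[ℝ] WW d) : Prop := ∀ w, Good S.δ (Hm (S.prodw w)⁻¹ * z)

def past (b : ℕ → Fin S.m) : ℕ → Sim d
  | 0 => 1
  | j + 1 => S.f (b j) * past b j

def Om (z : WW d →L[ℝ] WW d) (b : ℕ → Fin S.m) : Prop :=
  |z.det| = 1 ∧ ∀ j, S.Kset (Hm (S.past b j) * z)

lemma past_cons (i : Fin S.m) (b : ℕ → Fin S.m) (j : ℕ) :
    S.past (consb i b) (j + 1) = S.past b j * S.f i := by
  induction j with
  | zero => simp [past, consb]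
  | succ j ih => rw [past, ih]; simp [past, consb, mul_assoc]

lemma Kset_mul {z : WW d →L[ℝ] WW d} (h : S.Kset z) (i : Fin S.m) : S.Kset (Hm (S.f i)⁻¹ * z) := by
  intro w
  have := h (i :: w)
  rw [prodw_cons, mul_inv_rev, Hm_mul, mul_assoc] at this
  exact this

lemma Om_cons (z : WW d →L[ℝ] WW d) (b : ℕ → Fin S.m) (i : Fin S.m) :
    S.Om (Hm (S.f i)⁻¹ * z) (consb i b) ↔ S.Om z b := by
  have hdet : |(Hm (S.f i)⁻¹ * z).det| = |z.det| := by rw [det_mul', abs_mul, det_Hm, one_mul]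
  have hj : ∀ j, Hm (S.past (consb i b) (j + 1)) * (Hm (S.f i)⁻¹ * z) = Hm (S.past b j) * z := by
    intro j
    rw [past_cons, Hm_mul, mul_assoc, ← mul_assoc (Hm (S.f i)), Hm_mul_inv, one_mul]
  constructor
  · rintro ⟨h1, h2⟩
    refine ⟨by rw [← hdet]; exact h1, fun j => ?_⟩
    rw [← hj]; exact h2 (j + 1)
  · rintro ⟨h1, h2⟩
    refine ⟨by rw [hdet]; exact h1, fun j => ?_⟩
    cases j with
    | zero =>
      have := S.Kset_mul (h2 0) i
      simpa [past, Hm_one] using this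
    | succ j => rw [hj]; exact h2 j

lemma Om_gam {z γ : WW d →L[ℝ] WW d} {b : ℕ → Fin S.m} (h : S.Om z b) (hγ : γ ∈ Gam (bW d)) :
    S.Om (z * γ) b := by
  refine ⟨by rw [det_mul', abs_mul, h.1, hγ.1, one_mul], fun j w => ?_⟩
  rw [← mul_assoc, ← mul_assoc]
  have := Good_mul_gam (h.2 j w) hγ
  rwa [← mul_assoc] at this

lemma Om_gam_iff {z γ : WW d →L[ℝ] WW d} {b : ℕ → Fin S.m} (hγ : γ ∈ Gam (bW d)) :
    S.Om (z * γ) b ↔ S.Om z b := by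
  refine ⟨fun h => ?_, fun h => S.Om_gam h hγ⟩
  obtain ⟨γi, hγi, h1, h2⟩ := gam_inv hγ
  have := S.Om_gam h hγi
  rwa [mul_assoc, h1, mul_one] at this

lemma Om_good {z : WW d →L[ℝ] WW d} {b : ℕ → Fin S.m} (h : S.Om z b) : Good S.δ z := by
  have := h.2 0 []
  simpa [past, prodw, Hm_one] using this

lemma exists_Cm : ∃ C : ℝ, ∀ z b, S.Om z b → ∃ γ ∈ Gam (bW d), ‖z * γ‖ ≤ C := by
  obtain ⟨C, hC⟩ := mahler (bW d) S.δ S.hδ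
  exact ⟨C, fun z b h => hC z h.1 (S.Om_good h)⟩

lemma continuous_past (j : ℕ) : Continuous fun b : ℕ → Fin S.m => Hm (S.past b j) := by
  induction j with
  | zero => exact (continuous_const : Continuous fun _ : ℕ → Fin S.m => Hm (1 : Sim d))
  | succ j ih =>
    simp only [past, Hm_mul]
    have : Continuous fun i : Fin S.m => Hm (S.f i) := continuous_of_discreteTopology
    exact (this.comp (continuous_apply j)).mul ih

lemma Om_closed : IsClosed {p : (WW d →L[ℝ] WW d) × (ℕ → Fin S.m) | S.Om p.1 p.2} := by
  have : {p : (WW d →L[ℝ] WW d) × (ℕ → Fin S.m) | S.Om p.1 p.2} = {p | |p.1.det| = 1} ∩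
      ⋂ j, ⋂ w, {p | Good S.δ (Hm (S.prodw w)⁻¹ * (Hm (S.past p.2 j) * p.1))} := by
    ext p; simp [Om, Kset]
  rw [this]
  refine IsClosed.inter ?_ (isClosed_iInter fun j => isClosed_iInter fun w => ?_)
  · exact isClosed_eq ((ContinuousLinearMap.continuous_det.comp continuous_fst).abs) continuous_const
  · refine (Good_closed S.δ).preimage ?_
    exact continuous_const.mul (((S.continuous_past j).comp continuous_snd).mul continuous_fst)

/-- states -/
abbrev St := (WW d →L[ℝ] WW d) × (ℕ → Fin S.m) × UU d

def T (σ : S.St) : Set (VV d) := {t | S.Om (Hm (trans (σ.2.2.1 t)) * σ.1) σ.2.1}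

def app (i : Fin S.m) (σ : S.St) : S.St := (Hm (S.f i)⁻¹ * σ.1, consb i σ.2.1, (S.f i).O⁻¹ * σ.2.2)

def OmS (σ : S.St) : Prop := S.Om σ.1 σ.2.1

/-- right translation -/
def rg (σ : S.St) (γ : WW d →L[ℝ] WW d) : S.St := (σ.1 * γ, σ.2.1, σ.2.2)

lemma OmS_app (i : Fin S.m) (σ : S.St) : S.OmS (S.app i σ) ↔ S.OmS σ := S.Om_cons _ _ _

lemma T_app (i : Fin S.m) (σ : S.St) (t : VV d) : t ∈ S.T (S.app i σ) ↔ S.c • t ∈ S.T σ := by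
  unfold T app
  change S.Om _ _ ↔ S.Om _ _
  have : Hm (trans (((S.f i).O⁻¹ * σ.2.2).1 t)) * (Hm (S.f i)⁻¹ * σ.1) =
      Hm (S.f i)⁻¹ * (Hm (trans (σ.2.2.1 (S.c • t))) * σ.1) := by
    rw [← mul_assoc, ← mul_assoc, ← Hm_mul, ← Hm_mul]
    congr 2
    rw [mul_trans]
    simp [U_mul, S.hfc, S.hc0.ne']
  rw [this]
  exact S.Om_cons _ _ i

lemma T_rg {σ : S.St} {γ : WW d →L[ℝ] WW d} (hγ : γ ∈ Gam (bW d)) : S.T (S.rg σ γ) = S.T σ := by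
  ext t
  change S.Om (_ * (σ.1 * γ)) _ ↔ S.Om _ _
  rw [← mul_assoc]
  exact S.Om_gam_iff hγ

lemma OmS_rg {σ : S.St} {γ : WW d →L[ℝ] WW d} (hγ : γ ∈ Gam (bW d)) :
    S.OmS (S.rg σ γ) ↔ S.OmS σ := S.Om_gam_iff hγ

lemma hmat_trans (s : VV d) : hmat (trans s) = 1 + (ContinuousLinearMap.inl ℝ (VV d) ℝ).comp
    ((ContinuousLinearMap.snd ℝ (VV d) ℝ).smulRight s) := by
  apply ContinuousLinearMap.ext
  intro w
  ext1 <;> simp [hmat_apply, U_one]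

lemma continuous_trans : Continuous fun s : VV d => Hm (trans s) := by
  simp only [Hm_trans, hmat_trans]
  refine continuous_const.add ?_
  have h : Continuous fun s : VV d => (ContinuousLinearMap.snd ℝ (VV d) ℝ).smulRight s :=
    (ContinuousLinearMap.smulRightL ℝ (WW d) (VV d) (ContinuousLinearMap.snd ℝ (VV d) ℝ)).continuous
  exact (ContinuousLinearMap.compL ℝ (WW d) (VV d) (WW d)
    (ContinuousLinearMap.inl ℝ (VV d) ℝ)).continuous.comp h

lemma T_closed_joint : IsClosed {p : S.St × VV d | p.2 ∈ S.T p.1} := by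
  have : {p : S.St × VV d | p.2 ∈ S.T p.1} =
    (fun p : S.St × VV d => ((Hm (trans (p.1.2.2.1 p.2)) * p.1.1, p.1.2.1) :
      (WW d →L[ℝ] WW d) × (ℕ → Fin S.m))) ⁻¹' {p | S.Om p.1 p.2} := rfl
  rw [this]
  refine S.Om_closed.preimage ?_
  refine Continuous.prodMk (Continuous.mul (continuous_trans.comp ?_) (by fun_prop)) (by fun_prop)
  have h1 : Continuous fun p : S.St × VV d => (p.1.2.2.1 : VV d →L[ℝ] VV d) :=
    continuous_subtype_val.comp (by fun_prop)
  exact h1.clm_apply continuous_snd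

lemma T_closed_left (t : VV d) : IsClosed {σ : S.St | t ∈ S.T σ} :=
  S.T_closed_joint.preimage (f := fun σ : S.St => (σ, t)) (by fun_prop)

lemma T_closed (σ : S.St) : IsClosed (S.T σ) :=
  S.T_closed_joint.preimage (f := fun t : VV d => (σ, t)) (by fun_prop)

lemma zero_mem_T {σ : S.St} : 0 ∈ S.T σ ↔ S.OmS σ := by
  change S.Om _ _ ↔ S.Om _ _
  simp [trans_zero, Hm_one]

lemma OmS_closed : IsClosed {σ : S.St | S.OmS σ} := by
  simp only [← zero_mem_T]
  exact S.T_closed_left 0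

lemma compact_St (C : ℝ) : IsCompact {σ : S.St | ‖σ.1‖ ≤ C} := by
  have : ProperSpace (WW d →L[ℝ] WW d) := FiniteDimensional.proper ℝ _
  have := U_compact (d := d)
  have h : {σ : S.St | ‖σ.1‖ ≤ C} = Metric.closedBall 0 C ×ˢ Set.univ := by
    ext σ; simp
  rw [h]
  exact (isCompact_closedBall _ _).prod isCompact_univ

/-- maximal sets -/
def IsMx (Ts : Set (VV d)) : Prop :=
  (∃ σ, S.OmS σ ∧ S.T σ = Ts) ∧ ∀ σ, Ts ⊆ S.T σ → S.T σ = Ts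

theorem exists_max (h : ∃ σ, S.OmS σ) : ∃ Ts, S.IsMx Ts := by
  obtain ⟨C, hC⟩ := S.exists_Cm
  obtain ⟨σ0, h0⟩ := h
  set A : Set (Set (VV d)) := {X | ∃ σ, S.OmS σ ∧ S.T σ = X}
  obtain ⟨Ts, -, hTs⟩ := zorn_subset_nonempty A (by
    intro ch hch hchain hne
    let K : ch → Set S.St := fun X => {σ | ‖σ.1‖ ≤ C} ∩ ⋂ t ∈ X.1, {σ | t ∈ S.T σ}
    have hKc : ∀ X, IsClosed (⋂ t ∈ X, {σ | t ∈ S.T σ}) := fun X =>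
      isClosed_biInter fun t _ => S.T_closed_left t
    have : Nonempty ch := hne.to_subtype
    obtain ⟨σ, hσ⟩ := IsCompact.nonempty_iInter_of_directed_nonempty_isCompact_isClosed K
      (by
        intro X Y
        rcases hchain.total X.2 Y.2 with h | h
        · refine ⟨Y, ?_, subset_rfl⟩
          exact Set.inter_subset_inter_right _ (Set.biInter_subset_biInter_left h)
        · refine ⟨X, subset_rfl, ?_⟩
          exact Set.inter_subset_inter_right _ (Set.biInter_subset_biInter_left h))
      (by
        rintro ⟨X, hX⟩
        obtain ⟨σ, hσ, rfl⟩ := hch hX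
        obtain ⟨γ, hγ, hn⟩ := hC _ _ hσ
        refine ⟨S.rg σ γ, hn, ?_⟩
        simp only [Set.mem_iInter]
        intro t ht
        change t ∈ S.T (S.rg σ γ)
        rw [S.T_rg hγ]; exact ht)
      (fun X => (S.compact_St C).inter_right (hKc _))
      (fun X => (S.compact_St C).isClosed.inter (hKc _))
    simp only [Set.mem_iInter] at hσ
    have hsub : ∀ X ∈ ch, X ⊆ S.T σ := by
      intro X hX t ht
      have := (hσ ⟨X, hX⟩).2
      simp only [Set.mem_iInter] at this
      exact this t ht
    refine ⟨S.T σ, ⟨σ, ?_, rfl⟩, hsub⟩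
    obtain ⟨X, hX⟩ := hne
    rw [← zero_mem_T]
    apply hsub X hX
    obtain ⟨τ, hτ, rfl⟩ := hch hX
    exact S.zero_mem_T.2 hτ) (S.T σ0) ⟨σ0, h0, rfl⟩
  refine ⟨Ts, hTs.prop, fun σ hsub => ?_⟩
  obtain ⟨τ, hτ, rfl⟩ := hTs.prop
  have hσ : S.OmS σ := S.zero_mem_T.1 (hsub (S.zero_mem_T.2 hτ))
  exact (hTs.le_of_ge ⟨σ, hσ, rfl⟩ hsub).antisymm hsub

/-- level `n` states -/
def Tn (Ts : Set (VV d)) (n : ℕ) (σ : S.St) : Prop := ∀ t ∈ Ts, S.c ^ n • t ∈ S.T σ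

variable {Ts : Set (VV d)}

lemma zero_mem_Ts (h : S.IsMx Ts) : (0 : VV d) ∈ Ts := by
  obtain ⟨⟨σ, hσ, rfl⟩, -⟩ := h
  exact S.zero_mem_T.2 hσ

lemma Ts_closed (h : S.IsMx Ts) : IsClosed Ts := by
  obtain ⟨⟨σ, hσ, rfl⟩, -⟩ := h
  exact S.T_closed σ

lemma Tn_OmS (h : S.IsMx Ts) {n : ℕ} {σ : S.St} (hσ : S.Tn Ts n σ) : S.OmS σ := by
  have := hσ 0 (S.zero_mem_Ts h)
  rw [smul_zero] at this
  exact S.zero_mem_T.1 this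

lemma Tn_app {n : ℕ} {σ : S.St} (i : Fin S.m) (hσ : S.Tn Ts (n + 1) σ) :
    S.Tn Ts n (S.app i σ) := by
  intro t ht
  rw [T_app, smul_smul, ← pow_succ']
  exact hσ t ht

lemma Tn_of_app {n : ℕ} {σ : S.St} (i : Fin S.m) (hσ : S.Tn Ts n (S.app i σ)) :
    S.Tn Ts (n + 1) σ := by
  intro t ht
  have := hσ t ht
  rw [T_app, smul_smul, ← pow_succ'] at this
  exact this

lemma Tn_eq (h : S.IsMx Ts) {n : ℕ} {σ : S.St} (hσ : S.Tn Ts n σ) (t : VV d) :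
    t ∈ Ts ↔ S.c ^ n • t ∈ S.T σ := by
  induction n generalizing σ with
  | zero =>
    rw [pow_zero, one_smul, h.2 σ (fun t ht => by simpa using hσ t ht)]
  | succ n ih =>
    rw [ih (S.Tn_app S.i0 hσ), T_app, smul_smul, ← pow_succ']

lemma Tn_rg {n : ℕ} {σ : S.St} {γ : WW d →L[ℝ] WW d} (hγ : γ ∈ Gam (bW d)) :
    S.Tn Ts n (S.rg σ γ) ↔ S.Tn Ts n σ := by
  unfold Tn; rw [S.T_rg hγ]

lemma Tn_closed (n : ℕ) : IsClosed {σ : S.St | S.Tn Ts n σ} := by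
  have : {σ : S.St | S.Tn Ts n σ} = ⋂ t ∈ Ts, {σ | S.c ^ n • t ∈ S.T σ} := by
    ext σ; simp [Tn]
  rw [this]
  exact isClosed_biInter fun t _ => S.T_closed_left _

/-- truncation -/
def trunc (σ : S.St) : S.St :=
  (Hm (S.f (σ.2.1 0)) * σ.1, fun n => σ.2.1 (n + 1), (S.f (σ.2.1 0)).O * σ.2.2)

lemma app_trunc (σ : S.St) : S.app (σ.2.1 0) (S.trunc σ) = σ := by
  unfold app trunc
  refine Prod.ext ?_ (Prod.ext ?_ ?_)
  · simp only; rw [← mul_assoc, Hm_inv_mul, one_mul]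
  · simp only; ext n; cases n <;> rfl
  · simp only; rw [inv_mul_cancel_left]

lemma Tn_trunc {n : ℕ} {σ : S.St} (hσ : S.Tn Ts n σ) : S.Tn Ts (n + 1) (S.trunc σ) := by
  apply S.Tn_of_app (σ.2.1 0)
  rwa [app_trunc]

lemma exists_Tn (h : S.IsMx Ts) (n : ℕ) : ∃ σ, S.Tn Ts n σ := by
  induction n with
  | zero =>
    obtain ⟨⟨σ, hσ, rfl⟩, -⟩ := h
    exact ⟨σ, fun t ht => by simpa using ht⟩
  | succ n ih => obtain ⟨σ, hσ⟩ := ih; exact ⟨_, S.Tn_trunc hσ⟩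

end Sys
end BA

namespace BA
set_option linter.unusedSectionVars false
set_option linter.unusedSimpArgs false

open Sim
variable {d : ℕ}
namespace Sys
variable (S : Sys d)
variable {Ts : Set (VV d)}

lemma subseq (C : ℝ) (σ : ℕ → S.St) (h : ∀ k, ‖(σ k).1‖ ≤ C) :
    ∃ s : S.St, ∃ φ : ℕ → ℕ, StrictMono φ ∧ Tendsto (σ ∘ φ) atTop (𝓝 s) := by
  obtain ⟨s, -, φ, hφ, hl⟩ := (S.compact_St C).tendsto_subseq h
  exact ⟨s, φ, hφ, hl⟩

/-- append a word -/
def appw (w : List (Fin S.m)) (σ : S.St) : S.St := w.foldl (fun σ i => S.app i σ) σ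

lemma appw_nil (σ : S.St) : S.appw [] σ = σ := rfl
lemma appw_cons (i : Fin S.m) (w : List (Fin S.m)) (σ : S.St) :
    S.appw (i :: w) σ = S.appw w (S.app i σ) := rfl
lemma appw_append (v w : List (Fin S.m)) (σ : S.St) :
    S.appw (v ++ w) σ = S.appw w (S.appw v σ) := by simp [appw]

lemma appw_z (w : List (Fin S.m)) (σ : S.St) : (S.appw w σ).1 = Hm (S.prodw w)⁻¹ * σ.1 := by
  induction w generalizing σ with
  | nil => simp [appw_nil, prodw_nil, Hm_one]
  | cons i w ih => rw [appw_cons, ih, prodw_cons, mul_inv_rev, Hm_mul, mul_assoc]; rfl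

lemma appw_O (w : List (Fin S.m)) (σ : S.St) :
    (S.appw w σ).2.2 = (S.prodw w).O⁻¹ * σ.2.2 := by
  induction w generalizing σ with
  | nil => simp [appw_nil, prodw_nil]
  | cons i w ih => rw [appw_cons, ih, prodw_cons, mul_O, mul_inv_rev, mul_assoc]; rfl

lemma appw_b (w : List (Fin S.m)) (σ σ' : S.St) : ∀ k < w.length,
    (S.appw w σ).2.1 k = (S.appw w σ').2.1 k := by
  induction w using List.reverseRecOn with
  | nil => intro k hk; simp at hk
  | append_singleton w i ih =>
    intro k hk
    rw [appw_append, appw_append, appw_cons, appw_cons, appw_nil, appw_nil]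
    cases k with
    | zero => rfl
    | succ k => exact ih k (by simpa using hk)

lemma Tn_appw (w : List (Fin S.m)) {n : ℕ} {σ : S.St} (h : S.Tn Ts (n + w.length) σ) :
    S.Tn Ts n (S.appw w σ) := by
  induction w generalizing σ with
  | nil => exact h
  | cons i w ih => exact ih (S.Tn_app i (by simpa [add_assoc] using h))

lemma prodw_c (w : List (Fin S.m)) : (S.prodw w).c = S.c ^ w.length := by
  induction w with
  | nil => simp [prodw_nil]
  | cons i w ih => rw [prodw_cons, mul_c, ih, S.hfc, List.length_cons, pow_succ']

lemma prodw_ball (w : List (Fin S.m)) (x : VV d) (hx : ‖x‖ ≤ S.R) : ‖(S.prodw w).act x‖ ≤ S.R := by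
  induction w with
  | nil => simpa [prodw_nil] using hx
  | cons i w ih => rw [prodw_cons, mul_act]; exact S.hball _ _ ih

lemma past_c (b : ℕ → Fin S.m) (j : ℕ) : (S.past b j).c = S.c ^ j := by
  induction j with
  | zero => rfl
  | succ j ih => rw [past, mul_c, ih, S.hfc, pow_succ']

theorem exists_OmS (z : WW d →L[ℝ] WW d) (hz : |z.det| = 1) (hK : S.Kset z) : ∃ σ, S.OmS σ := by
  obtain ⟨C, hC⟩ := mahler (bW d) S.δ S.hδ
  set g := S.f S.i0
  have hgw : ∀ k, S.prodw (List.replicate k S.i0) = g ^ k := by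
    intro k; simp [prodw, g]
  have hpast : ∀ j, S.past (fun _ => S.i0) j = g ^ j := by
    intro j
    induction j with
    | zero => rfl
    | succ j ih => rw [past, ih, pow_succ']
  have hgood : ∀ k w, Good S.δ (Hm (S.prodw w)⁻¹ * (Hm (g ^ k)⁻¹ * z)) := by
    intro k w
    have := hK (List.replicate k S.i0 ++ w)
    rw [prodw_append, mul_inv_rev, Hm_mul, hgw, mul_assoc] at this
    exact this
  have h1 : ∀ k : ℕ, ∃ γ ∈ Gam (bW d), ‖(Hm (g ^ k)⁻¹ * z) * γ‖ ≤ C := by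
    intro k
    apply hC
    · rw [det_mul', abs_mul, det_Hm, hz, one_mul]
    · have := hgood k []
      rw [prodw_nil, inv_one, Hm_one, one_mul] at this
      exact this
  choose γ hγ hn using h1
  obtain ⟨s, φ, hφ, hl⟩ := S.subseq C (fun k => ((Hm (g ^ k)⁻¹ * z) * γ k, fun _ => S.i0, 1)) hn
  have hl1 : Tendsto (fun k => (Hm (g ^ (φ k))⁻¹ * z) * γ (φ k)) atTop (𝓝 s.1) :=
    (continuous_fst.tendsto s).comp hl
  refine ⟨(s.1, fun _ => S.i0, 1), ?_, ?_⟩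
  · have h2 : Tendsto (fun k => |((Hm (g ^ (φ k))⁻¹ * z) * γ (φ k)).det|) atTop (𝓝 |s.1.det|) :=
      ((ContinuousLinearMap.continuous_det.abs).tendsto _).comp hl1
    have h3 : ∀ k, |((Hm (g ^ (φ k))⁻¹ * z) * γ (φ k)).det| = 1 := by
      intro k
      rw [det_mul', det_mul', abs_mul, abs_mul, det_Hm, hz, (hγ _).1]; norm_num
    simp only [h3] at h2
    exact tendsto_nhds_unique h2 tendsto_const_nhds |>.symm ▸ rfl
  · intro j w
    have h2 : Tendsto (fun k => Hm (S.prodw w)⁻¹ * (Hm (g ^ j) * ((Hm (g ^ (φ k))⁻¹ * z) * γ (φ k))))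
        atTop (𝓝 (Hm (S.prodw w)⁻¹ * (Hm (g ^ j) * s.1))) :=
      tendsto_const_nhds.mul (tendsto_const_nhds.mul hl1)
    rw [hpast]
    refine (Good_closed S.δ).mem_of_tendsto h2 ?_
    filter_upwards [eventually_ge_atTop j] with k hk
    have hk' : j ≤ φ k := hk.trans (hφ.id_le k)
    have h4 : Hm (g ^ j) * Hm (g ^ (φ k))⁻¹ = Hm (g ^ (φ k - j))⁻¹ := by
      rw [← Hm_mul]
      congr 1
      have : g ^ φ k = g ^ (φ k - j) * g ^ j := by rw [← pow_add]; congr 1; omega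
      rw [this, mul_inv_rev, mul_inv_cancel_left]
    have h5 := Good_mul_gam (hgood (φ k - j) w) (hγ (φ k))
    change Good S.δ _
    convert h5 using 1
    rw [← h4]; simp only [mul_assoc]

lemma bW_inl (i : Fin d) : bW d (Sum.inl i) = (EuclideanSpace.single i (1:ℝ), 0) := by
  simp [bW, Module.Basis.prod_apply]

lemma bW_inr (i : Unit) : bW d (Sum.inr i) = (0, 1) := by
  simp [bW, Module.Basis.prod_apply]

lemma exists_small_snd (hd : 0 < d) (z : WW d →L[ℝ] WW d) (δ : ℝ) (hδ : 0 < δ) :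
    ∃ ζ ∈ Lat (bW d), ζ ≠ 0 ∧ |(z ζ).2| < δ := by
  set i : Fin d := ⟨0, hd⟩
  set e1 := bW d (Sum.inl i)
  set e2 := bW d (Sum.inr ())
  have he1 : e1 ∈ Lat (bW d) := basis_mem_lat _ _
  have he2 : e2 ∈ Lat (bW d) := basis_mem_lat _ _
  set α := (z e1).2
  set β := (z e2).2
  by_cases hβ : β = 0
  · refine ⟨e2, he2, (bW d).ne_zero _, ?_⟩
    change |β| < δ
    rw [hβ]; simpa using hδ
  obtain ⟨n, hn⟩ := exists_nat_gt (|β| / δ)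
  obtain ⟨j, k, hk, -, hjk⟩ := Real.exists_int_int_abs_mul_sub_le (α / β) (n := n + 1) (by omega)
  refine ⟨k • e1 - j • e2, sub_mem ((Lat _).smul_mem _ he1) ((Lat _).smul_mem _ he2), ?_, ?_⟩
  · intro h
    have h1 := congrArg (fun w : WW d => w.1 i) h
    simp [e1, e2, bW_inl, bW_inr] at h1
    omega
  · have h1 : (z (k • e1 - j • e2)).2 = β * (k * (α / β) - j) := by
      rw [map_sub, map_zsmul, map_zsmul]
      simp only [Prod.snd_sub, Prod.smul_snd, zsmul_eq_mul]
      change k * α - j * β = _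
      field_simp
    rw [h1, abs_mul]
    calc _ ≤ |β| * (1 / (((n + 1 : ℕ) : ℝ) + 1)) := by gcongr
      _ < δ := by
        rw [div_lt_iff₀ hδ] at hn
        push_cast
        rw [mul_one_div, div_lt_iff₀ (by positivity)]
        nlinarith

lemma Ts_ne_univ (h : S.IsMx Ts) : Ts ≠ Set.univ := by
  rintro rfl
  obtain ⟨⟨σ, hσ, hT⟩, -⟩ := h
  have hall : ∀ s : VV d, S.Om (Hm (trans s) * σ.1) σ.2.1 := by
    intro s
    have : (σ.2.2⁻¹).1 s ∈ S.T σ := by rw [hT]; trivial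
    have h2 : S.Om (Hm (trans (σ.2.2.1 ((σ.2.2⁻¹).1 s))) * σ.1) σ.2.1 := this
    rwa [U_apply_inv] at h2
  obtain ⟨ζ, hζ, h0, hs⟩ := exists_small_snd S.hd σ.1 S.δ S.hδ
  set w := σ.1 ζ with hw
  by_cases hq : w.2 = 0
  · -- the past contracts
    have hn : ∀ j, S.δ ≤ (S.c ^ (1 / ((d:ℝ) + 1))) ^ j * ‖w.1‖ := by
      intro j
      have h1 := hσ.2 j [] ζ hζ h0
      rw [prodw_nil, inv_one, Hm_one, one_mul, mul_apply_eq_comp, ← hw, Hm_apply, hmat_apply, hq,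
        S.past_c] at h1
      simp only [zero_smul, add_zero, norm_smul, Prod.norm_mk, norm_zero] at h1
      have hcj : 0 < S.c ^ j := pow_pos S.hc0 j
      rw [U_norm, max_eq_left (by positivity), Real.norm_of_nonneg hcj.le,
        Real.norm_of_nonneg (Real.rpow_nonneg hcj.le _), ← mul_assoc] at h1
      refine h1.trans (le_of_eq ?_)
      congr 1
      rw [← Real.rpow_natCast, ← Real.rpow_natCast, ← Real.rpow_mul S.hc0.le, ← Real.rpow_mul S.hc0.le,
        ← Real.rpow_add S.hc0]
      congr 1
      field_simp; ring
    have hlt : S.c ^ (1 / ((d:ℝ) + 1)) < 1 := Real.rpow_lt_one S.hc0.le S.hc1 (by positivity)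
    have ht : Tendsto (fun j : ℕ => (S.c ^ (1 / ((d:ℝ) + 1))) ^ j * ‖w.1‖) atTop (𝓝 (0 * ‖w.1‖)) :=
      (tendsto_pow_atTop_nhds_zero_of_lt_one (Real.rpow_nonneg S.hc0.le _) hlt).mul_const _
    rw [zero_mul] at ht
    exact absurd (ge_of_tendsto' ht hn) (not_le.2 S.hδ)
  · have h1 := S.Om_good (hall (-(w.2⁻¹ • w.1))) ζ hζ h0
    rw [mul_apply_eq_comp, ← hw, Hm_trans, hmat_apply] at h1
    have h2 : (trans (-(w.2⁻¹ • w.1))).c • (trans (-(w.2⁻¹ • w.1))).O.1 w.1 +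
        w.2 • (trans (-(w.2⁻¹ • w.1))).a = 0 := by
      simp [smul_smul, hq, U_one]
    rw [h2] at h1
    simp only [Prod.norm_mk, norm_zero, Real.norm_eq_abs] at h1
    rw [max_eq_right (abs_nonneg _)] at h1
    exact absurd h1 (not_le.2 hs)

end Sys

/-- stabiliser of a set -/
def stab (X : Set (VV d)) : AddSubgroup (VV d) where
  carrier := {t | ∀ x ∈ X, x + t ∈ X ∧ x - t ∈ X}
  zero_mem' := by intro x hx; simpa using hx
  add_mem' := by
    intro s t hs ht x hx
    refine ⟨?_, ?_⟩
    · rw [← add_assoc]; exact (ht _ (hs x hx).1).1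
    · rw [← sub_sub]; exact (ht _ (hs x hx).2).2
  neg_mem' := by
    intro t ht x hx
    refine ⟨?_, ?_⟩
    · rw [← sub_eq_add_neg]; exact (ht x hx).2
    · rw [sub_neg_eq_add]; exact (ht x hx).1

lemma stab_closed {X : Set (VV d)} (hX : IsClosed X) : IsClosed (stab X : Set (VV d)) := by
  have : (stab X : Set (VV d)) = ⋂ x ∈ X, ({t | x + t ∈ X} ∩ {t | x - t ∈ X}) := by
    ext t; simp [stab]
  rw [this]
  refine isClosed_biInter fun x _ => IsClosed.inter (hX.preimage (by fun_prop)) (hX.preimage (by fun_prop))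

/-- largest subspace stabilising a set -/
def Ls (X : Set (VV d)) : Submodule ℝ (VV d) where
  carrier := {v | ∀ r : ℝ, r • v ∈ stab X}
  zero_mem' := by intro r; rw [smul_zero]; exact zero_mem _
  add_mem' := by intro a b ha hb r; rw [smul_add]; exact add_mem (ha r) (hb r)
  smul_mem' := by intro c x hx r; rw [smul_smul]; exact hx _

lemma Ls_stab {X : Set (VV d)} {v : VV d} (h : v ∈ Ls X) : v ∈ stab X := by
  simpa using h 1

lemma Ls_ne_top {X : Set (VV d)} (h0 : (0 : VV d) ∈ X) (hX : X ≠ Set.univ) : Ls X ≠ ⊤ := by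
  intro h
  apply hX
  rw [Set.eq_univ_iff_forall]
  intro t
  have : t ∈ Ls X := by rw [h]; trivial
  simpa using (Ls_stab this 0 h0).1

lemma no_small_stab {X : Set (VV d)} (hX : IsClosed X) (t : ℕ → VV d) (ht : ∀ k, t k ∈ stab X)
    (htL : ∀ k, t k ∈ (Ls X)ᗮ) (h0 : ∀ k, t k ≠ 0) (hlim : Tendsto (fun k => ‖t k‖) atTop (𝓝 0)) :
    False := by
  obtain ⟨e, he, φ, hφ, hl⟩ := (isCompact_sphere (0 : VV d) 1).tendsto_subseq
    (x := fun k => ‖t k‖⁻¹ • t k) (by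
      intro k
      rw [mem_sphere_zero_iff_norm, norm_smul, norm_inv, norm_norm,
        inv_mul_cancel₀ (norm_ne_zero_iff.2 (h0 k))])
  have he1 : ‖e‖ = 1 := by simpa using he
  have heL : e ∈ (Ls X)ᗮ := by
    have hcl : IsClosed ((Ls X)ᗮ : Set (VV d)) := Submodule.isClosed_orthogonal _
    exact hcl.mem_of_tendsto hl (Eventually.of_forall fun k => Submodule.smul_mem _ _ (htL _))
  have heL' : e ∈ Ls X := by
    intro r
    have h1 : Tendsto (fun k => (⌊r / ‖t (φ k)‖⌋ : ℤ) • t (φ k)) atTop (𝓝 (r • e)) := by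
      have h2 : Tendsto (fun k => r • (‖t (φ k)‖⁻¹ • t (φ k))) atTop (𝓝 (r • e)) :=
        hl.const_smul r
      refine h2.congr_dist ?_
      refine squeeze_zero (fun _ => dist_nonneg) (g := fun k => ‖t (φ k)‖) (fun k => ?_)
        (hlim.comp hφ.tendsto_atTop)
      rw [dist_eq_norm, smul_smul, ← Int.cast_smul_eq_zsmul ℝ, ← sub_smul, norm_smul, ← div_eq_mul_inv]
      have h3 : ‖r / ‖t (φ k)‖ - (⌊r / ‖t (φ k)‖⌋ : ℤ)‖ ≤ 1 := by
        rw [Real.norm_eq_abs, abs_le]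
        have := Int.floor_le (r / ‖t (φ k)‖)
        have := Int.lt_floor_add_one (r / ‖t (φ k)‖)
        constructor <;> linarith
      calc _ ≤ 1 * ‖t (φ k)‖ := by gcongr
        _ = _ := one_mul _
    exact (stab_closed hX).mem_of_tendsto h1 (Eventually.of_forall fun k => zsmul_mem (ht _) _)
  have : e = 0 := by
    have := Submodule.inner_right_of_mem_orthogonal heL' heL
    rwa [inner_self_eq_zero] at this
  rw [this] at he1
  simp at he1

end BA

namespace BA
set_option linter.unusedSectionVars false
set_option linter.unusedSimpArgs false

open Sim
variable {d : ℕ}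

/-- projection to the orthogonal complement -/
def Pr (L : Submodule ℝ (VV d)) : VV d →L[ℝ] VV d := (Lᗮ).starProjection

lemma Pr_norm (L : Submodule ℝ (VV d)) (x : VV d) : ‖Pr L x‖ ≤ ‖x‖ := by
  exact Submodule.norm_starProjection_apply_le _ x
lemma Pr_mem (L : Submodule ℝ (VV d)) (x : VV d) : Pr L x ∈ Lᗮ := Submodule.starProjection_apply_mem _ x
lemma Pr_eq_self {L : Submodule ℝ (VV d)} {x : VV d} (h : x ∈ Lᗮ) : Pr L x = x :=
  Submodule.starProjection_eq_self_iff.2 h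
lemma sub_Pr_mem (L : Submodule ℝ (VV d)) (x : VV d) : x - Pr L x ∈ L := by
  have := Submodule.sub_starProjection_mem_orthogonal (K := Lᗮ) x
  rwa [Submodule.orthogonal_orthogonal] at this
lemma Pr_eq_zero {L : Submodule ℝ (VV d)} {x : VV d} (h : x ∈ L) : Pr L x = 0 := by
  have h1 := sub_mem h (sub_Pr_mem L x)
  rw [sub_sub_cancel] at h1
  have := Submodule.inner_right_of_mem_orthogonal h1 (Pr_mem L x)
  rwa [inner_self_eq_zero] at this
lemma Pr_zero_mem {L : Submodule ℝ (VV d)} {x : VV d} (h : Pr L x = 0) : x ∈ L := by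
  have := sub_Pr_mem L x
  rwa [h, sub_zero] at this

/-- the associated quadratic vector field -/
def xi (X : WW d →L[ℝ] WW d) (x : VV d) : VV d := (X (x, 1)).1 - (X (x, 1)).2 • x

lemma X_split (X : WW d →L[ℝ] WW d) (x : VV d) (q : ℝ) : X (x, q) = X (x, 0) + q • X (0, 1) := by
  rw [← map_smul, ← map_add]; simp

lemma X_add (X : WW d →L[ℝ] WW d) (x y : VV d) : X (x + y, 0) = X (x, 0) + X (y, 0) := by
  rw [← map_add]; simp
lemma X_smul (X : WW d →L[ℝ] WW d) (x : VV d) (l : ℝ) : X (l • x, 0) = l • X (x, 0) := by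
  rw [← map_smul]; simp

lemma xi_eq (X : WW d →L[ℝ] WW d) (x : VV d) :
    xi X x = (X (0, 1)).1 + ((X (x, 0)).1 - (X (0,1)).2 • x) - (X (x, 0)).2 • x := by
  rw [xi, X_split X x 1]
  simp only [one_smul, Prod.fst_add, Prod.snd_add, add_smul]
  abel

lemma xi_zero (X : WW d →L[ℝ] WW d) : xi X 0 = (X (0, 1)).1 := by simp [xi]

lemma xi_scale (X : WW d →L[ℝ] WW d) (x : VV d) (l : ℝ) :
    xi X (l • x) = xi X 0 + (l / 2) • (xi X x - xi X (-x)) +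
      (l ^ 2) • ((1/2 : ℝ) • (xi X x + xi X (-x)) - xi X 0) := by
  have hneg : X (-x, 0) = - X (x, 0) := by rw [← map_neg]; simp
  simp only [xi_eq, xi_zero, X_smul, hneg, Prod.smul_fst, Prod.smul_snd, Prod.fst_neg, Prod.snd_neg]
  have h0 : X (0, 0) = 0 := map_zero X
  simp only [h0, Prod.fst_zero, Prod.snd_zero, smul_eq_mul]
  module

lemma xi_quad (X : WW d →L[ℝ] WW d) (x : VV d) :
    (X (x, 0)).2 • x = xi X 0 - (1/2 : ℝ) • (xi X x + xi X (-x)) := by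
  have hneg : X (-x, 0) = - X (x, 0) := by rw [← map_neg]; simp
  simp only [xi_eq, xi_zero, X_smul, hneg, Prod.smul_fst, Prod.smul_snd, Prod.fst_neg, Prod.snd_neg]
  have h0 : X (0, 0) = 0 := map_zero X
  simp only [h0, Prod.fst_zero, Prod.snd_zero, smul_eq_mul]
  module

lemma xi_polar (X : WW d →L[ℝ] WW d) (v w : VV d) :
    (X (v, 0)).2 • w = xi X v + xi X w - xi X (v + w) - xi X 0 - (X (w, 0)).2 • v := by
  simp only [xi_eq, xi_zero, X_add, Prod.fst_add, Prod.snd_add]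
  have h0 : X (0, 0) = 0 := map_zero X
  simp only [h0, Prod.fst_zero, Prod.snd_zero, smul_eq_mul]
  module

lemma xi_conj (X : WW d →L[ℝ] WW d) (g : Sim d) (x : VV d) :
    xi (hmat g⁻¹ * X * hmat g) x = g.c⁻¹ • (g.O⁻¹).1 (xi X (g.act x)) := by
  simp only [xi, mul_apply_eq_comp, hmat_apply, one_smul, inv_c, inv_O, inv_a]
  have : g.c • g.O.1 x + g.a = g.act x := rfl
  rw [this]
  set Y := X (g.act x, 1)
  simp only [act, map_sub, map_smul, map_add, U_inv_apply, smul_sub, smul_add, smul_neg, smul_smul]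
  have hc := g.hc.ne'
  match_scalars <;> field_simp

lemma xi_conj' (X : WW d →L[ℝ] WW d) (g : Sim d) (x : VV d) :
    xi (hmat g * X * hmat g⁻¹) x = g.c • g.O.1 (xi X (g⁻¹.act x)) := by
  have := xi_conj X g⁻¹ x
  simpa using this

/-- transversal discrepancy is at most `r` -/
def DLe (R : ℝ) (L : Submodule ℝ (VV d)) (X : WW d →L[ℝ] WW d) (O' O'' : UU d) (r : ℝ) : Prop :=
  (∀ x, ‖x‖ ≤ R → ‖Pr L ((O''⁻¹).1 (xi X x))‖ ≤ r) ∧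
    ∀ s ∈ L, ‖Pr L ((O''⁻¹).1 (O'.1 s))‖ ≤ r * ‖s‖

lemma DLe_mono {R : ℝ} {L : Submodule ℝ (VV d)} {X : WW d →L[ℝ] WW d} {O' O'' : UU d} {r r' : ℝ}
    (h : DLe R L X O' O'' r) (hr : r ≤ r') : DLe R L X O' O'' r' :=
  ⟨fun x hx => (h.1 x hx).trans hr, fun s hs => (h.2 s hs).trans (by gcongr)⟩

lemma quad_ext {R l r : ℝ} (A : VV d →L[ℝ] VV d) (X : WW d →L[ℝ] WW d) (hl : 1 ≤ l) (hR : 0 ≤ R)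
    (h : ∀ x, ‖x‖ ≤ R → ‖A (xi X x)‖ ≤ r) (y : VV d) (hy : ‖y‖ ≤ l * R) :
    ‖A (xi X y)‖ ≤ 4 * l ^ 2 * r := by
  have hl0 : 0 < l := by linarith
  set x := l⁻¹ • y with hx
  have hxy : y = l • x := by rw [hx, smul_smul, mul_inv_cancel₀ hl0.ne', one_smul]
  have hxR : ‖x‖ ≤ R := by
    rw [hx, norm_smul, norm_inv, Real.norm_of_nonneg hl0.le, inv_mul_le_iff₀ hl0]; exact hy
  have h1 := h x hxR
  have h2 := h (-x) (by rwa [norm_neg])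
  have h3 := h 0 (by simpa using hR)
  have hr : 0 ≤ r := (norm_nonneg _).trans h1
  rw [hxy, xi_scale]
  simp only [map_add, map_smul, map_sub]
  calc _ ≤ (‖A (xi X 0)‖ + ‖(l / 2) • (A (xi X x) - A (xi X (-x)))‖) +
        ‖l ^ 2 • ((1 / 2 : ℝ) • (A (xi X x) + A (xi X (-x))) - A (xi X 0))‖ :=
        (norm_add_le _ _).trans (by gcongr; exact norm_add_le _ _)
    _ ≤ (r + (l / 2) * (r + r)) + l ^ 2 * ((1/2) * (r + r) + r) := by
        rw [norm_smul, norm_smul, Real.norm_of_nonneg (by positivity : 0 ≤ l / 2),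
          Real.norm_of_nonneg (by positivity : 0 ≤ l ^ 2)]
        gcongr
        · exact (norm_sub_le _ _).trans (by gcongr)
        · refine (norm_sub_le _ _).trans ?_
          rw [norm_smul, Real.norm_of_nonneg (by norm_num : (0:ℝ) ≤ 1/2)]
          gcongr
          exact (norm_add_le _ _).trans (by gcongr)
    _ ≤ 4 * l ^ 2 * r := by
        have : l ≤ l ^ 2 := by nlinarith
        have : 1 ≤ l ^ 2 := by nlinarith
        nlinarith

lemma gamma_bound {R : ℝ} {L : Submodule ℝ (VV d)} {X : WW d →L[ℝ] WW d} {O' O'' : UU d} {r : ℝ}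
    (hR : 1 ≤ R) (hL : L ≠ ⊤) (h : DLe R L X O' O'' r) (v : VV d) :
    |(X (v, 0)).2| ≤ 21 * r * ‖v‖ := by
  set A : VV d →L[ℝ] VV d := Pr L * (O''⁻¹).1 with hA
  have hAn : ∀ x, ‖A x‖ ≤ ‖x‖ := fun x => by
    rw [hA, mul_apply_eq_comp]
    exact (Pr_norm _ _).trans (by rw [U_norm])
  have hF : ∀ x, ‖x‖ ≤ R → ‖A (xi X x)‖ ≤ r := h.1
  have hr : 0 ≤ r := (norm_nonneg _).trans (hF 0 (by simp; linarith))
  have hLb : Lᗮ ≠ ⊥ := by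
    intro hb; apply hL
    rwa [Submodule.orthogonal_eq_bot_iff] at hb
  obtain ⟨w0, hw0, hw00⟩ := Submodule.exists_mem_ne_zero_of_ne_bot hLb
  obtain ⟨w, hw1, hAw⟩ : ∃ w : VV d, ‖w‖ = 1 ∧ ‖A w‖ = 1 := by
    have hn : ‖‖w0‖⁻¹ • w0‖ = 1 := by
      rw [norm_smul, norm_inv, norm_norm, inv_mul_cancel₀ (norm_ne_zero_iff.2 hw00)]
    refine ⟨O''.1 (‖w0‖⁻¹ • w0), by rw [U_norm]; exact hn, ?_⟩
    rw [hA, mul_apply_eq_comp, U_inv_apply, Pr_eq_self (Submodule.smul_mem _ _ hw0), hn]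
  have hself : |(X (w, 0)).2| ≤ 2 * r := by
    have h1 := congrArg (fun y => ‖A y‖) (xi_quad X w)
    simp only [map_smul, norm_smul, hAw, mul_one, Real.norm_eq_abs] at h1
    rw [h1]
    simp only [map_sub, map_smul, map_add]
    refine (norm_sub_le _ _).trans ?_
    rw [norm_smul, Real.norm_of_nonneg (by norm_num : (0:ℝ) ≤ 1/2)]
    have a1 := hF 0 (by simp; linarith)
    have a2 := hF w (by linarith)
    have a3 := hF (-w) (by rw [norm_neg]; linarith)
    have a4 := norm_add_le (A (xi X w)) (A (xi X (-w)))
    linarith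
  have hunit : ∀ v : VV d, ‖v‖ ≤ 1 → |(X (v, 0)).2| ≤ 21 * r := by
    intro v hv
    have h1 := congrArg (fun y => ‖A y‖) (xi_polar X v w)
    simp only [map_smul, norm_smul, hAw, mul_one, Real.norm_eq_abs] at h1
    rw [h1]
    simp only [map_sub, map_smul, map_add]
    have a1 := hF 0 (by simp; linarith)
    have a2 := hF w (by linarith)
    have a3 := hF v (by linarith)
    have a4 := quad_ext A X (l := 2) (by norm_num) (by linarith) hF (v + w)
      (by have := norm_add_le v w; linarith)
    have a5 : ‖(X (w, 0)).2 • A v‖ ≤ 2 * r := by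
      rw [norm_smul, Real.norm_eq_abs]
      calc _ ≤ 2 * r * 1 := by gcongr; exact (hAn v).trans hv
        _ = _ := mul_one _
    have b1 := norm_sub_le (A (xi X v) + A (xi X w) - A (xi X (v + w)) - A (xi X 0)) ((X (w, 0)).2 • A v)
    have b2 := norm_sub_le (A (xi X v) + A (xi X w) - A (xi X (v + w))) (A (xi X 0))
    have b3 := norm_sub_le (A (xi X v) + A (xi X w)) (A (xi X (v + w)))
    have b4 := norm_add_le (A (xi X v)) (A (xi X w))
    linarith
  by_cases hv : v = 0
  · have h0 : X ((0 : VV d), (0:ℝ)) = 0 := map_zero X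
    simp [hv, h0]
  · have hvn : 0 < ‖v‖ := norm_pos_iff.2 hv
    have h1 := hunit (‖v‖⁻¹ • v) (by rw [norm_smul, norm_inv, norm_norm, inv_mul_cancel₀ hvn.ne'])
    rw [X_smul, Prod.smul_snd, smul_eq_mul, abs_mul, abs_of_pos (inv_pos.2 hvn),
      inv_mul_le_iff₀ hvn] at h1
    linarith

lemma DLe_conj {R : ℝ} {L : Submodule ℝ (VV d)} {X : WW d →L[ℝ] WW d} {O' O'' : UU d} {r : ℝ}
    (hR : 1 ≤ R) (hr : 0 ≤ r) (g : Sim d) (hc1 : g.c < 1) (ha : ‖g.a‖ ≤ R) (h : DLe R L X O' O'' r) :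
    DLe R L (hmat g * X * hmat g⁻¹) (g.O * O') (g.O * O'') (16 / g.c * r) := by
  have hc := g.hc
  have h1 : 1 ≤ 16 / g.c := by rw [le_div_iff₀ hc]; linarith
  constructor
  · intro x hx
    rw [xi_conj', mul_inv_rev, U_mul, map_smul, U_inv_apply]
    rw [map_smul, map_smul, norm_smul, Real.norm_of_nonneg hc.le]
    have h2 := quad_ext (Pr L * (O''⁻¹).1) X (l := 2 / g.c)
      (by rw [le_div_iff₀ hc]; linarith) (by linarith) h.1 (g⁻¹.act x) (by
        have : g⁻¹.act x = g.c⁻¹ • (g.O⁻¹).1 (x - g.a) := by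
          simp [act, inv_a, smul_sub, sub_eq_add_neg]
        rw [this, norm_smul, U_norm, norm_inv, Real.norm_of_nonneg hc.le, inv_mul_le_iff₀ hc]
        have := norm_sub_le x g.a
        field_simp
        linarith)
    rw [mul_apply_eq_comp] at h2
    calc _ ≤ g.c * (4 * (2 / g.c) ^ 2 * r) := by gcongr
      _ = _ := by field_simp; ring
  · intro s hs
    rw [mul_inv_rev, U_mul, U_mul, U_inv_apply]
    refine (h.2 s hs).trans ?_
    gcongr
    nlinarith

lemma conj_norm {R : ℝ} (hR : 1 ≤ R) (u : Sim d) (hu : u.c ≤ 1) (ha : ‖u.a‖ ≤ R)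
    (X : WW d →L[ℝ] WW d) (k : ℝ) (hk : 0 ≤ k)
    (hX : ∀ v, |((hmat u * X * hmat u⁻¹) (v, 0)).2| ≤ k * ‖v‖) :
    ‖hmat u * X * hmat u⁻¹‖ ≤ 2 * (R + 1) ^ 2 * (‖X‖ + k) := by
  set X' := hmat u * X * hmat u⁻¹ with hX'
  have hXn := norm_nonneg X
  have h1 : ∀ x, ‖X' (x, 0)‖ ≤ (‖X‖ + (R + 1) * k) * ‖x‖ := by
    intro x
    set y : VV d := u.c⁻¹ • (u.O⁻¹).1 x with hy
    have hyn : u.c * ‖y‖ = ‖x‖ := by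
      rw [hy, norm_smul, U_norm, norm_inv, Real.norm_of_nonneg u.hc.le, mul_inv_cancel_left₀ u.hc.ne']
    have h2 : X' (x, 0) = hmat u (X (y, 0)) := by
      rw [hX', mul_apply_eq_comp, mul_apply_eq_comp, hmat_apply u⁻¹]
      simp [hy]
    have h3 := hX x
    rw [h2] at h3
    rw [h2]
    simp only [hmat_apply] at h3 ⊢
    have h4 : ‖(X (y, 0)).1‖ ≤ ‖X‖ * ‖y‖ := by
      have := X.le_opNorm (y, 0)
      simp only [Prod.norm_mk, norm_zero, max_eq_left (norm_nonneg y)] at this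
      exact (norm_fst_le _).trans this
    rw [Prod.norm_mk, Real.norm_eq_abs, max_le_iff]
    have hxn := norm_nonneg x
    constructor
    · calc _ ≤ ‖u.c • u.O.1 (X (y, 0)).1‖ + ‖(X (y, 0)).2 • u.a‖ := norm_add_le _ _
        _ ≤ u.c * (‖X‖ * ‖y‖) + (k * ‖x‖) * R := by
          rw [norm_smul, norm_smul, U_norm, Real.norm_of_nonneg u.hc.le, Real.norm_eq_abs]
          have := u.hc.le
          gcongr
        _ ≤ _ := by
          have : u.c * (‖X‖ * ‖y‖) = ‖X‖ * ‖x‖ := by rw [← hyn]; ring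
          rw [this]
          nlinarith [mul_nonneg hk hxn]
    · nlinarith [mul_nonneg hk hxn, mul_nonneg hXn hxn, mul_nonneg (mul_nonneg hk hxn) (by linarith : 0 ≤ R)]
  have h2 : ‖X' (u.a, 1)‖ ≤ (R + 1) * ‖X‖ := by
    have h3 : X' (u.a, 1) = hmat u (X (0, 1)) := by
      rw [hX', mul_apply_eq_comp, mul_apply_eq_comp, hmat_apply u⁻¹]
      simp [inv_a]
    have h4 : ‖X (0, 1)‖ ≤ ‖X‖ := by
      have := X.le_opNorm ((0 : VV d), (1:ℝ))
      simpa using this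
    have h5 := (norm_fst_le (X (0,1))).trans h4
    have h6 := (norm_snd_le (X (0,1))).trans h4
    rw [h3, hmat_apply, Prod.norm_mk, max_le_iff]
    constructor
    · calc _ ≤ ‖u.c • u.O.1 (X (0, 1)).1‖ + ‖(X (0, 1)).2 • u.a‖ := norm_add_le _ _
        _ ≤ 1 * ‖X‖ + ‖X‖ * R := by
          rw [norm_smul, norm_smul, U_norm, Real.norm_of_nonneg u.hc.le]
          gcongr
        _ = _ := by ring
    · nlinarith
  have h3 : ‖X' (0, 1)‖ ≤ (R + 1) * ‖X‖ + (‖X‖ + (R + 1) * k) * R := by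
    have : X' (0, 1) = X' (u.a, 1) - X' (u.a, 0) := by rw [← map_sub]; simp
    rw [this]
    refine (norm_sub_le _ _).trans ?_
    have := h1 u.a
    gcongr
    exact this.trans (by gcongr)
  apply ContinuousLinearMap.opNorm_le_bound _ (by positivity)
  rintro ⟨x, q⟩
  rw [X_split]
  have hx : ‖x‖ ≤ ‖(x, q)‖ := norm_fst_le (x, q)
  have hq : ‖q‖ ≤ ‖(x, q)‖ := norm_snd_le (x, q)
  calc _ ≤ ‖X' (x, 0)‖ + ‖q‖ * ‖X' (0, 1)‖ := (norm_add_le _ _).trans (by rw [norm_smul])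
    _ ≤ (‖X‖ + (R + 1) * k) * ‖(x, q)‖ +
        ‖(x, q)‖ * ((R + 1) * ‖X‖ + (‖X‖ + (R + 1) * k) * R) := by
        gcongr
        exact (h1 x).trans (by gcongr)
    _ = ((‖X‖ + (R + 1) * k) + ((R + 1) * ‖X‖ + (‖X‖ + (R + 1) * k) * R)) * ‖(x, q)‖ := by ring
    _ ≤ _ := by
        gcongr
        nlinarith [mul_nonneg hXn (by linarith : 0 ≤ R), mul_nonneg hk (by linarith : 0 ≤ R),
          mul_nonneg (mul_nonneg hXn (by linarith : 0 ≤ R)) (by linarith : 0 ≤ R),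
          mul_nonneg (mul_nonneg hk (by linarith : 0 ≤ R)) (by linarith : 0 ≤ R)]

end BA

namespace BA
set_option linter.unusedSectionVars false
set_option linter.unusedSimpArgs false

open Sim
variable {d : ℕ}

lemma isUnit_of_det {y : WW d →L[ℝ] WW d} (h : |y.det| = 1) : IsUnit y := by
  have h0 : y.det ≠ 0 := by intro h0; rw [h0] at h; simp at h
  have h1 : IsUnit (LinearMap.det (y : WW d →ₗ[ℝ] WW d)) := isUnit_iff_ne_zero.2 h0
  let e := LinearEquiv.ofIsUnitDet (f := (y : WW d →ₗ[ℝ] WW d)) (v := bW d) (v' := bW d) (by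
    rw [LinearMap.det_toMatrix]; exact h1)
  refine ⟨⟨y, (e.symm : WW d →ₗ[ℝ] WW d).toContinuousLinearMap, ?_, ?_⟩, rfl⟩
  · refine ContinuousLinearMap.ext fun w => ?_
    exact e.apply_symm_apply w
  · refine ContinuousLinearMap.ext fun w => ?_
    exact e.symm_apply_apply w

lemma inv_bound (C : ℝ) : ∃ C' : ℝ, 0 < C' ∧ ∀ y : WW d →L[ℝ] WW d, |y.det| = 1 → ‖y‖ ≤ C →
    ∃ yi : WW d →L[ℝ] WW d, y * yi = 1 ∧ yi * y = 1 ∧ ‖yi‖ ≤ C' := by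
  have : ProperSpace (WW d →L[ℝ] WW d) := FiniteDimensional.proper ℝ _
  have : CompleteSpace (WW d →L[ℝ] WW d) := FiniteDimensional.complete ℝ _
  have hK : IsCompact (Metric.closedBall (0 : WW d →L[ℝ] WW d) C ∩ {y | |y.det| = 1}) := by
    refine (isCompact_closedBall _ _).inter_right ?_
    exact isClosed_eq (ContinuousLinearMap.continuous_det.abs) continuous_const
  obtain ⟨C', hC'⟩ := hK.exists_bound_of_continuousOn (f := Ring.inverse) (by
    intro y hy
    obtain ⟨u, hu⟩ := isUnit_of_det hy.2
    have := NormedRing.inverse_continuousAt u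
    rw [hu] at this
    exact this.continuousWithinAt)
  refine ⟨max C' 1, by positivity, fun y hy hn => ⟨Ring.inverse y, ?_, ?_, ?_⟩⟩
  · exact Ring.mul_inverse_cancel _ (isUnit_of_det hy)
  · exact Ring.inverse_mul_cancel _ (isUnit_of_det hy)
  · exact (hC' y ⟨by simpa using hn, hy⟩).trans (le_max_left _ _)

lemma gam_sep (C : ℝ) : ∃ ρ > 0, ∀ y Q γ' γ'' : WW d →L[ℝ] WW d, |y.det| = 1 → ‖y‖ ≤ C →
    γ' ∈ Gam (bW d) → γ'' ∈ Gam (bW d) → Q * (y * γ') = y * γ'' → ‖Q - 1‖ ≤ ρ → Q = 1 := by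
  obtain ⟨C', hC'0, hC'⟩ := inv_bound (d := d) C
  obtain ⟨e, he, hdisc⟩ := gam_discrete (bW d)
  refine ⟨e / (C' * (|C| + 1)), by positivity, ?_⟩
  intro y Q γ' γ'' hy hyC hγ' hγ'' hQ hn
  obtain ⟨yi, h1, h2, h3⟩ := hC' y hy hyC
  obtain ⟨gi, hgi, h4, h5⟩ := gam_inv hγ'
  have h6 : γ'' * gi = yi * Q * y := by
    have : Q * y = y * (γ'' * gi) := by
      rw [← mul_assoc, ← hQ, ← mul_assoc, mul_assoc (Q * y), h4, mul_one]
    rw [mul_assoc, this, ← mul_assoc, h2, one_mul]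
  have h7 : γ'' * gi = 1 := by
    apply hdisc _ (gam_mul hγ'' hgi)
    have : γ'' * gi - 1 = yi * (Q - 1) * y := by
      rw [h6, mul_sub, sub_mul, mul_one, h2]
    rw [this]
    calc _ ≤ ‖yi‖ * ‖Q - 1‖ * ‖y‖ := (norm_mul_le _ _).trans (by gcongr; exact norm_mul_le _ _)
      _ ≤ C' * (e / (C' * (|C| + 1))) * (|C| + 1) := by
        gcongr
        have := le_abs_self C
        linarith
      _ = e := by field_simp
  rw [h7] at h6
  have : y * (yi * Q * y) * yi = Q := by
    rw [← mul_assoc, ← mul_assoc, h1, one_mul, mul_assoc, h1, mul_one]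
  rw [← this, ← h6, mul_one, h1]

lemma pigeon {α : Type*} [PseudoMetricSpace α] {K : Set α} (hK : IsCompact K) {ρ : ℝ} (hρ : 0 < ρ) :
    ∃ N : ℕ, ∀ p : Fin (N + 1) → α, (∀ i, p i ∈ K) → ∃ i j, i ≠ j ∧ dist (p i) (p j) < ρ := by
  obtain ⟨t, -, ht, hcov⟩ := hK.finite_cover_balls (half_pos hρ)
  refine ⟨ht.toFinset.card, fun p hp => ?_⟩
  have h1 : ∀ i, ∃ x ∈ ht.toFinset, p i ∈ Metric.ball x (ρ / 2) := by
    intro i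
    have := hcov (hp i)
    simp only [Set.mem_iUnion] at this
    obtain ⟨x, hx, hb⟩ := this
    exact ⟨x, by simpa using hx, hb⟩
  choose f hf hfb using h1
  obtain ⟨i, -, j, -, hij, he⟩ := Finset.exists_ne_map_eq_of_card_lt_of_maps_to
    (s := Finset.univ) (t := ht.toFinset) (f := f) (by simp) (fun i _ => hf i)
  refine ⟨i, j, hij, ?_⟩
  have a := hfb i
  have b := hfb j
  rw [← he] at b
  rw [Metric.mem_ball] at a b
  have := dist_triangle_right (p i) (p j) (f i)
  linarith

lemma conj_unit_norm (A B : UU d) : ‖(A⁻¹ * B * A).1 - 1‖ = ‖B.1 - 1‖ := by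
  have key : ∀ A B : UU d, ‖(A⁻¹ * B * A).1 - 1‖ ≤ ‖B.1 - 1‖ := by
    intro A B
    apply ContinuousLinearMap.opNorm_le_bound _ (norm_nonneg _)
    intro x
    have : ((A⁻¹ * B * A).1 - 1) x = (A⁻¹).1 ((B.1 - 1) (A.1 x)) := by
      rw [sub_apply, sub_apply, U_mul, U_mul, map_sub]
      simp
    rw [this, U_norm]
    refine (ContinuousLinearMap.le_opNorm _ _).trans ?_
    rw [U_norm]
  refine le_antisymm (key A B) ?_
  have := key A⁻¹ (A⁻¹ * B * A)
  simpa [mul_assoc] using this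

lemma Q_bound {R : ℝ} (hR : 0 ≤ R) (g h : Sim d) (hc : g.c = h.c) (hc1 : h.c ≤ 1) (hga : ‖g.a‖ ≤ R)
    (hha : ‖h.a‖ ≤ R) (X : WW d →L[ℝ] WW d) (k : ℝ) (hk : 0 ≤ k)
    (hX : ∀ v, |(X (v, 0)).2| ≤ k * ‖v‖) :
    ‖hmat h * (1 + X) * hmat g⁻¹ - 1‖ ≤
      (1 + R) * (‖(h.O * g.O⁻¹).1 - 1‖ + ‖X‖ + k * h.c⁻¹ * (1 + R)) + ((1 + R) * ‖X‖ + ‖h.a - g.a‖) := by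
  set D := hmat h * (1 + X) * hmat g⁻¹ - 1 with hD
  set θ := ‖(h.O * g.O⁻¹).1 - 1‖
  have hXn := norm_nonneg X
  have hc0 := h.hc
  have hki : 0 ≤ k * h.c⁻¹ := by positivity
  have h1 : ∀ x, ‖D (x, 0)‖ ≤ (θ + ‖X‖ + k * h.c⁻¹ * (1 + R)) * ‖x‖ := by
    intro x
    set y : VV d := h.c⁻¹ • (g.O⁻¹).1 x with hy
    have hyn : ‖y‖ = h.c⁻¹ * ‖x‖ := by
      rw [hy, norm_smul, U_norm, norm_inv, Real.norm_of_nonneg h.hc.le]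
    have h2 : D (x, 0) = (((h.O * g.O⁻¹).1 - 1) x + h.c • h.O.1 (X (y, 0)).1 + (X (y,0)).2 • h.a, (X (y, 0)).2) := by
      rw [hD, sub_apply, mul_apply_eq_comp, mul_apply_eq_comp, hmat_apply g⁻¹]
      have : ((g⁻¹).c • (g⁻¹.O).1 ((x, (0:ℝ)) : WW d).1 + ((x, (0:ℝ)) : WW d).2 • g⁻¹.a) = y := by
        simp [hy, hc]
      rw [this, add_apply, hmat_apply, sub_apply, U_mul]
      simp only [one_apply_eq_self, Prod.fst_add, Prod.snd_add, map_add, smul_add, zero_add]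
      have : h.c • h.O.1 y = h.O.1 ((g.O⁻¹).1 x) := by
        rw [hy, map_smul, smul_smul, mul_inv_cancel₀ hc0.ne', one_smul]
      rw [this]
      ext1 <;> simp
      abel
    have h4 : ‖(X (y, 0)).1‖ ≤ ‖X‖ * ‖y‖ := by
      have := X.le_opNorm (y, 0)
      simp only [Prod.norm_mk, norm_zero, max_eq_left (norm_nonneg y)] at this
      exact (norm_fst_le _).trans this
    have h5 : |(X (y, 0)).2| ≤ k * h.c⁻¹ * ‖x‖ := by
      have := hX y
      rw [hyn] at this; linarith
    have hxn := norm_nonneg x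
    have hθ : 0 ≤ θ := norm_nonneg _
    rw [h2, Prod.norm_mk, Real.norm_eq_abs, max_le_iff]
    constructor
    · calc _ ≤ ‖((h.O * g.O⁻¹).1 - 1) x‖ + ‖h.c • h.O.1 (X (y, 0)).1‖ + ‖(X (y,0)).2 • h.a‖ := norm_add₃_le
        _ ≤ θ * ‖x‖ + h.c * (‖X‖ * ‖y‖) + (k * h.c⁻¹ * ‖x‖) * R := by
          rw [norm_smul, norm_smul, U_norm, Real.norm_of_nonneg h.hc.le, Real.norm_eq_abs]
          gcongr
          exact ContinuousLinearMap.le_opNorm _ _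
        _ ≤ _ := by
          have : h.c * (‖X‖ * ‖y‖) = ‖X‖ * ‖x‖ := by rw [hyn]; field_simp
          rw [this]
          nlinarith [mul_nonneg hki hxn]
    · nlinarith [mul_nonneg hki hxn, mul_nonneg hXn hxn, mul_nonneg hθ hxn, mul_nonneg (mul_nonneg hki hxn) hR]
  have h2 : ‖D (g.a, 1)‖ ≤ (1 + R) * ‖X‖ + ‖h.a - g.a‖ := by
    have h3 : D (g.a, 1) = (h.c • h.O.1 (X (0, 1)).1 + (X (0,1)).2 • h.a + (h.a - g.a), (X (0,1)).2) := by
      rw [hD, sub_apply, mul_apply_eq_comp, mul_apply_eq_comp, hmat_apply g⁻¹]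
      have : (g⁻¹.c • (g⁻¹.O).1 ((g.a, (1:ℝ)) : WW d).1 + ((g.a, (1:ℝ)) : WW d).2 • g⁻¹.a) = 0 := by
        simp [inv_a]
      rw [this, add_apply, hmat_apply]
      simp only [one_apply_eq_self, Prod.fst_add, Prod.snd_add, map_add, smul_add, zero_add, add_smul, one_smul]
      ext1 <;> simp
      abel
    have h4 : ‖X (0, 1)‖ ≤ ‖X‖ := by
      have := X.le_opNorm ((0 : VV d), (1:ℝ))
      simpa using this
    have h5 := (norm_fst_le (X (0,1))).trans h4
    have h6 := (norm_snd_le (X (0,1))).trans h4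
    rw [h3, Prod.norm_mk, max_le_iff]
    have hn := norm_nonneg (h.a - g.a)
    constructor
    · calc _ ≤ ‖h.c • h.O.1 (X (0, 1)).1‖ + ‖(X (0,1)).2 • h.a‖ + ‖h.a - g.a‖ := norm_add₃_le
        _ ≤ 1 * ‖X‖ + ‖X‖ * R + ‖h.a - g.a‖ := by
          rw [norm_smul, norm_smul, U_norm, Real.norm_of_nonneg h.hc.le]
          gcongr
        _ = _ := by ring
    · nlinarith
  set A := θ + ‖X‖ + k * h.c⁻¹ * (1 + R) with hA
  have hA0 : 0 ≤ A := by positivity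
  set B := (1 + R) * ‖X‖ + ‖h.a - g.a‖
  have h3 : ‖D (0, 1)‖ ≤ B + A * R := by
    have : D (0, 1) = D (g.a, 1) - D (g.a, 0) := by rw [← map_sub]; simp
    rw [this]
    refine (norm_sub_le _ _).trans ?_
    have := h1 g.a
    gcongr
    exact this.trans (by gcongr)
  apply ContinuousLinearMap.opNorm_le_bound _ (by positivity)
  rintro ⟨x, q⟩
  rw [X_split]
  have hx : ‖x‖ ≤ ‖(x, q)‖ := norm_fst_le (x, q)
  have hq : ‖q‖ ≤ ‖(x, q)‖ := norm_snd_le (x, q)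
  calc _ ≤ ‖D (x, 0)‖ + ‖q‖ * ‖D (0, 1)‖ := (norm_add_le _ _).trans (by rw [norm_smul])
    _ ≤ A * ‖(x, q)‖ + ‖(x, q)‖ * (B + A * R) := by
        gcongr
        exact (h1 x).trans (by gcongr)
    _ = _ := by ring

end BA

namespace BA
set_option linter.unusedSectionVars false
set_option linter.unusedSimpArgs false

open Sim
variable {d : ℕ}
namespace Sys
variable (S : Sys d)
variable {Ts : Set (VV d)}

lemma prodw_rep (k : ℕ) : S.prodw (List.replicate k S.i0) = S.f S.i0 ^ k := by
  simp [prodw]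

lemma rep_x0 (k : ℕ) : (S.f S.i0 ^ k).act S.x0 = S.x0 := by
  induction k with
  | zero => simp
  | succ k ih => rw [pow_succ, mul_act, S.hx0, ih]

lemma pow_c (k : ℕ) : (S.f S.i0 ^ k).c = S.c ^ k := by
  rw [← prodw_rep, prodw_c, List.length_replicate]

lemma pow_a (k : ℕ) : ‖(S.f S.i0 ^ k).a‖ ≤ S.R := by
  rw [← prodw_rep, ← act_zero]
  exact S.prodw_ball _ _ (by simpa using (zero_le_one.trans S.hR))

lemma prodw_a (w : List (Fin S.m)) : ‖(S.prodw w).a‖ ≤ S.R := by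
  rw [← act_zero]
  exact S.prodw_ball _ _ (by simpa using (zero_le_one.trans S.hR))

lemma pow_O (k : ℕ) : (S.f S.i0 ^ k).O = (S.f S.i0).O ^ k := by
  induction k with
  | zero => rfl
  | succ k ih => rw [pow_succ, mul_O, ih, pow_succ]

/-- some letter moves the fixed point transversally, infinitely often -/
lemma exists_letter {L : Submodule ℝ (VV d)} (hL : L ≠ ⊤) (A : UU d) :
    ∃ i, ∃ᶠ j in atTop, Pr L ((A⁻¹).1 ((S.f S.i0 ^ j).O.1 ((S.f i).act S.x0 - S.x0))) ≠ 0 := by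
  by_contra! hcon
  obtain ⟨j, hj⟩ := (eventually_all.2 hcon).exists
  have hLb : Lᗮ ≠ ⊥ := by
    intro hb; apply hL
    rwa [Submodule.orthogonal_eq_bot_iff] at hb
  obtain ⟨e0, he0, he00⟩ := Submodule.exists_mem_ne_zero_of_ne_bot hLb
  set B : VV d →L[ℝ] VV d := (A⁻¹).1 * (S.f S.i0 ^ j).O.1 with hB
  set l : VV d →L[ℝ] ℝ := (innerSL ℝ e0).comp B with hl
  have hlap : ∀ x, l x = inner ℝ e0 ((A⁻¹).1 ((S.f S.i0 ^ j).O.1 x)) := fun x => rfl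
  have hn := S.norming (-(l S.x0)) l 0 (fun _ => S.x0) (fun _ => S.hx0R) 0 (by
    intro i
    have h1 := Submodule.inner_right_of_mem_orthogonal (Pr_zero_mem (hj i)) he0
    rw [real_inner_comm, ← hlap, map_sub] at h1
    simp only [zero_apply, add_zero]
    rw [show -l S.x0 + l ((S.f i).act S.x0) = 0 by linarith, abs_zero])
  simp only [zero_apply, add_zero, mul_zero] at hn
  have hz : ∀ x, ‖x‖ ≤ 1 → l x = l S.x0 := by
    intro x hx
    have := abs_nonpos_iff.1 (hn x (hx.trans S.hR))
    linarith
  set e : VV d := ((S.f S.i0 ^ j).O⁻¹).1 (A.1 e0) with he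
  have h2 := hz (‖e0‖⁻¹ • e) (by
    rw [norm_smul, norm_inv, norm_norm, he, U_norm, U_norm, inv_mul_cancel₀ (norm_ne_zero_iff.2 he00)])
  have h3 := hz 0 (by simp)
  rw [← h3, map_zero, map_smul, hlap, he, U_apply_inv, U_inv_apply, smul_eq_mul,
    real_inner_self_eq_norm_sq] at h2
  have : 0 < ‖e0‖ := norm_pos_iff.2 he00
  have : 0 < ‖e0‖⁻¹ * ‖e0‖ ^ 2 := by positivity
  linarith

lemma exists_words {L : Submodule ℝ (VV d)} (hL : L ≠ ⊤) (A : UU d) (N : ℕ) {ρ : ℝ} (hρ : 0 < ρ) :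
    ∃ l : ℕ, ∃ v : Fin (N + 1) → List (Fin S.m), (∀ i, (v i).length = l) ∧
      (∀ i j, ‖(S.prodw (v i)).a - (S.prodw (v j)).a‖ ≤ ρ) ∧
      ∀ i j, i ≠ j → Pr L ((A⁻¹).1 ((S.prodw (v i)).act S.x0 - (S.prodw (v j)).act S.x0)) ≠ 0 := by
  obtain ⟨i, hi⟩ := S.exists_letter hL A
  set F : ℕ → VV d := fun j => Pr L ((A⁻¹).1 (S.c ^ j • (S.f S.i0 ^ j).O.1 ((S.f i).act S.x0 - S.x0))) with hF
  have hF0 : Tendsto F atTop (𝓝 0) := by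
    rw [tendsto_zero_iff_norm_tendsto_zero]
    have h1 : Tendsto (fun j : ℕ => S.c ^ j * ‖(S.f i).act S.x0 - S.x0‖) atTop (𝓝 (0 * ‖(S.f i).act S.x0 - S.x0‖)) :=
      (tendsto_pow_atTop_nhds_zero_of_lt_one S.hc0.le S.hc1).mul_const _
    rw [zero_mul] at h1
    refine squeeze_zero (fun _ => norm_nonneg _) (fun j => ?_) h1
    refine (Pr_norm _ _).trans ?_
    rw [U_norm, norm_smul, U_norm, Real.norm_of_nonneg (pow_nonneg S.hc0.le _)]
  obtain ⟨p, hp⟩ : ∃ p : ℕ, 4 * S.R * S.c ^ p ≤ ρ := by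
    have h1 : Tendsto (fun j : ℕ => 4 * S.R * S.c ^ j) atTop (𝓝 (4 * S.R * 0)) :=
      (tendsto_pow_atTop_nhds_zero_of_lt_one S.hc0.le S.hc1).const_mul _
    rw [mul_zero] at h1
    exact (h1.eventually (eventually_le_nhds hρ)).exists
  set J : Set ℕ := {j | p ≤ j ∧ F j ≠ 0} with hJ
  have hJf : ∃ᶠ j in atTop, j ∈ J := by
    refine (hi.and_eventually (eventually_ge_atTop p)).mono fun j hj => ⟨hj.2, ?_⟩
    simp only [hF, map_smul]
    exact smul_ne_zero (pow_pos S.hc0 j).ne' hj.1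
  have hinf : (F '' J).Infinite := by
    intro hfin
    have hc : IsClosed (F '' J) := hfin.isClosed
    have h0 : (0 : VV d) ∈ F '' J := hc.mem_of_frequently_of_tendsto
      (hJf.mono fun j hj => Set.mem_image_of_mem F hj) hF0
    obtain ⟨j, hj, hj0⟩ := h0
    exact hj.2 hj0
  obtain ⟨t, ht, htc⟩ := hinf.exists_subset_card_eq (N + 1)
  let en := t.equivFinOfCardEq htc
  have hpre : ∀ a : Fin (N + 1), ∃ j ∈ J, F j = (en.symm a).1 := fun a => ht (en.symm a).2
  choose j hjJ hjF using hpre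
  obtain ⟨M, hM⟩ : ∃ M, ∀ a, j a ≤ M := ⟨Finset.univ.sup j, fun a => Finset.le_sup (Finset.mem_univ a)⟩
  refine ⟨M + 1, fun a => List.replicate (j a) S.i0 ++ i :: List.replicate (M - j a) S.i0, ?_, ?_, ?_⟩
  · intro a
    have := hM a
    simp; omega
  · have key : ∀ a, ‖(S.prodw (List.replicate (j a) S.i0 ++ i :: List.replicate (M - j a) S.i0)).a - S.x0‖ ≤ 2 * S.R * S.c ^ p := by
      intro a
      rw [← act_zero, prodw_append, mul_act, prodw_rep]
      set y := (S.prodw (i :: List.replicate (M - j a) S.i0)).act 0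
      have hy : ‖y‖ ≤ S.R := S.prodw_ball _ _ (by simpa using (zero_le_one.trans S.hR))
      have h1 := norm_act_sub (S.f S.i0 ^ (j a)) y S.x0
      rw [rep_x0, pow_c] at h1
      rw [h1]
      have h2 : ‖y - S.x0‖ ≤ 2 * S.R := (norm_sub_le _ _).trans (by linarith [S.hx0R])
      have h3 : S.c ^ (j a) ≤ S.c ^ p := pow_le_pow_of_le_one S.hc0.le S.hc1.le (hjJ a).1
      calc _ ≤ S.c ^ p * (2 * S.R) := by
            have := (pow_pos S.hc0 p).le
            gcongr
        _ = _ := by ring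
    intro a b
    have h1 := key a
    have h2 := key b
    have h3 := norm_sub_le ((S.prodw (List.replicate (j a) S.i0 ++ i :: List.replicate (M - j a) S.i0)).a - S.x0)
      ((S.prodw (List.replicate (j b) S.i0 ++ i :: List.replicate (M - j b) S.i0)).a - S.x0)
    rw [sub_sub_sub_cancel_right] at h3
    linarith
  · have key : ∀ a, (S.prodw (List.replicate (j a) S.i0 ++ i :: List.replicate (M - j a) S.i0)).act S.x0 =
        S.x0 + S.c ^ (j a) • (S.f S.i0 ^ (j a)).O.1 ((S.f i).act S.x0 - S.x0) := by
      intro a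
      rw [prodw_append, prodw_cons, prodw_rep, prodw_rep, mul_act, mul_act, rep_x0]
      have := act_sub (S.f S.i0 ^ (j a)) ((S.f i).act S.x0) S.x0
      rw [rep_x0, pow_c] at this
      rw [← this]; abel
    intro a b hab
    rw [key, key, add_sub_add_left_eq_sub, map_sub, map_sub]
    change F (j a) - F (j b) ≠ 0
    rw [hjF, hjF, sub_ne_zero]
    intro h
    exact hab (en.symm.injective (Subtype.ext h))

def kap : ℝ := S.c ^ 2 / 16

lemma descend (hL : Ls Ts ≠ ⊤) {ε η : ℝ} {n1 : ℕ} (hε : 0 < ε)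
    (gap : ∀ n ≥ n1, ∀ (σ' σ'' : S.St) (X : WW d →L[ℝ] WW d), S.Tn Ts n σ' → S.Tn Ts n σ'' →
      σ''.1 = (1 + X) * σ'.1 → ‖X‖ ≤ η → ‖((σ''.2.2)⁻¹ * σ'.2.2).1 - 1‖ ≤ η →
      DLe S.R (Ls Ts) X σ'.2.2 σ''.2.2 (ε * S.c ^ n) →
      DLe S.R (Ls Ts) X σ'.2.2 σ''.2.2 (S.kap * ε * S.c ^ n))
    (X0 : WW d →L[ℝ] WW d) (hX0 : 2 * (S.R + 1) ^ 2 * (‖X0‖ + 21 * (ε * S.c ^ n1)) ≤ η) (k : ℕ) :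
    ∀ (τ' τ'' : S.St), S.Tn Ts (n1 + k) τ' → S.Tn Ts (n1 + k) τ'' →
    Hm (S.f S.i0 ^ k)⁻¹ * τ''.1 = (1 + X0) * (Hm (S.f S.i0 ^ k)⁻¹ * τ'.1) →
    ‖((τ''.2.2)⁻¹ * τ'.2.2).1 - 1‖ ≤ η →
    DLe S.R (Ls Ts) X0 ((S.f S.i0 ^ k).O⁻¹ * τ'.2.2) ((S.f S.i0 ^ k).O⁻¹ * τ''.2.2) (ε * S.c ^ n1) →
    τ''.1 = (1 + hmat (S.f S.i0 ^ k) * X0 * hmat (S.f S.i0 ^ k)⁻¹) * τ'.1 ∧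
    ‖hmat (S.f S.i0 ^ k) * X0 * hmat (S.f S.i0 ^ k)⁻¹‖ ≤ η ∧
    DLe S.R (Ls Ts) (hmat (S.f S.i0 ^ k) * X0 * hmat (S.f S.i0 ^ k)⁻¹) τ'.2.2 τ''.2.2
      (S.kap * ε * S.c ^ (n1 + k)) := by
  have hR := S.hR
  have hc0 := S.hc0
  have hpos : 0 < ε * S.c ^ n1 := by positivity
  induction k with
  | zero =>
    intro τ' τ'' h1 h2 h3 h4 h5
    simp only [pow_zero, inv_one, Hm_one, hmat_one, one_mul, mul_one, one_O, add_zero] at *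
    have h6 : ‖X0‖ ≤ η := by
      refine le_trans ?_ hX0
      have : 1 ≤ 2 * (S.R + 1) ^ 2 := by nlinarith
      nlinarith [norm_nonneg X0]
    exact ⟨h3, h6, gap n1 le_rfl τ' τ'' X0 h1 h2 h3 h6 h4 h5⟩
  | succ k ih =>
    intro τ' τ'' h1 h2 h3 h4 h5
    set g := S.f S.i0 with hg
    have hgk : (g ^ (k + 1))⁻¹ = (g ^ k)⁻¹ * g⁻¹ := by rw [pow_succ', mul_inv_rev]
    rw [hgk, Hm_mul, mul_assoc, mul_assoc] at h3
    rw [pow_succ', mul_O, mul_inv_rev, mul_assoc, mul_assoc] at h5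
    obtain ⟨h6, h7, h8⟩ := ih (S.app S.i0 τ') (S.app S.i0 τ'') (S.Tn_app _ h1) (S.Tn_app _ h2) h3
      (by
        change ‖((g.O⁻¹ * τ''.2.2)⁻¹ * (g.O⁻¹ * τ'.2.2)).1 - 1‖ ≤ η
        rw [mul_inv_rev, inv_inv, mul_assoc, mul_inv_cancel_left]
        exact h4) h5
    set Xk := hmat (g ^ k) * X0 * hmat (g ^ k)⁻¹ with hXk
    have hX' : hmat (g ^ (k+1)) * X0 * hmat (g ^ (k+1))⁻¹ = hmat g * Xk * hmat g⁻¹ := by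
      rw [hgk, pow_succ', hmat_mul, hmat_mul, hXk]; simp only [mul_assoc]
    have h9 := DLe_conj (g := g) hR (by have := S.hc0; unfold kap; positivity) (by rw [hg, S.hfc]; exact S.hc1)
      (by rw [← act_zero]; exact S.hball _ _ (by simp; linarith)) h8
    change DLe _ _ _ (g.O * (g.O⁻¹ * τ'.2.2)) (g.O * (g.O⁻¹ * τ''.2.2)) _ at h9
    rw [mul_inv_cancel_left, mul_inv_cancel_left, ← hX'] at h9
    have hr : 16 / g.c * (S.kap * ε * S.c ^ (n1 + k)) = ε * S.c ^ (n1 + (k + 1)) := by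
      rw [hg, S.hfc, kap]; field_simp; ring
    rw [hr] at h9
    have h10 : τ''.1 = (1 + hmat (g ^ (k+1)) * X0 * hmat (g ^ (k+1))⁻¹) * τ'.1 := by
      change Hm g⁻¹ * τ''.1 = (1 + Xk) * (Hm g⁻¹ * τ'.1) at h6
      have h11 : τ''.1 = Hm g * ((1 + Xk) * (Hm g⁻¹ * τ'.1)) := by
        rw [← h6, ← mul_assoc, Hm_mul_inv, one_mul]
      rw [h11, hX']
      have h12 : Hm g * Xk * Hm g⁻¹ = hmat g * Xk * hmat g⁻¹ := by
        refine ContinuousLinearMap.ext fun w => ?_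
        simp only [mul_apply_eq_comp, Hm_apply, map_smul, smul_smul, inv_c]
        rw [Real.inv_rpow g.hc.le, inv_mul_cancel₀ (Real.rpow_pos_of_pos g.hc _).ne', one_smul]
      rw [add_mul, add_mul, mul_add, one_mul, one_mul, ← h12, ← mul_assoc, Hm_mul_inv, one_mul]
      simp only [mul_assoc]
    have h13 : ‖hmat (g ^ (k+1)) * X0 * hmat (g ^ (k+1))⁻¹‖ ≤ η := by
      refine (conj_norm hR (g ^ (k+1)) (by rw [hg, pow_c]; exact pow_le_one₀ S.hc0.le S.hc1.le) (S.pow_a _) X0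
        (21 * (ε * S.c ^ n1)) (by positivity) ?_).trans hX0
      intro v
      refine (gamma_bound hR hL h9 v).trans ?_
      have hpw : S.c ^ (n1 + (k + 1)) ≤ S.c ^ n1 :=
        pow_le_pow_of_le_one S.hc0.le S.hc1.le (Nat.le_add_right _ _)
      have hpw2 := mul_le_mul_of_nonneg_right (mul_le_mul_of_nonneg_left hpw hε.le) (norm_nonneg v)
      linarith
    exact ⟨h10, h13, gap _ (by omega) τ' τ'' _ h1 h2 h10 h13 h4 h9⟩

end Sys
end BA

namespace BA
set_option linter.unusedSectionVars false
set_option linter.unusedSimpArgs false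

open Sim
variable {d : ℕ}

lemma continuous_Uinv : Continuous fun A : UU d => ((A⁻¹).1 : VV d →L[ℝ] VV d) :=
  (LinearIsometryEquiv.continuous (ContinuousLinearMap.adjoint (𝕜 := ℝ) (E := VV d) (F := VV d))).comp
    continuous_subtype_val

lemma unit_dist (A B : UU d) : ‖(B⁻¹ * A).1 - 1‖ ≤ ‖A.1 - B.1‖ := by
  apply ContinuousLinearMap.opNorm_le_bound _ (norm_nonneg _)
  intro x
  have : ((B⁻¹ * A).1 - 1) x = (B⁻¹).1 ((A.1 - B.1) x) := by
    rw [sub_apply, sub_apply, U_mul, map_sub]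
    simp
  rw [this, U_norm]
  exact ContinuousLinearMap.le_opNorm _ _

lemma xi_norm {R : ℝ} (hR : 1 ≤ R) (X : WW d →L[ℝ] WW d) (x : VV d) (hx : ‖x‖ ≤ R) :
    ‖xi X x‖ ≤ ‖X‖ * (R * (1 + R)) := by
  have h1 : ‖X (x, 1)‖ ≤ ‖X‖ * R := by
    refine (X.le_opNorm _).trans ?_
    gcongr
    rw [Prod.norm_mk]; simp [hx, hR]
  have h2 := (norm_fst_le (X (x, 1))).trans h1
  have h3 := (norm_snd_le (X (x, 1))).trans h1
  unfold xi
  calc _ ≤ ‖(X (x, 1)).1‖ + ‖(X (x, 1)).2 • x‖ := norm_sub_le _ _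
    _ ≤ ‖X‖ * R + (‖X‖ * R) * R := by rw [norm_smul]; gcongr
    _ = _ := by ring

lemma DLe_of_small {R : ℝ} (hR : 1 ≤ R) (L : Submodule ℝ (VV d)) (X : WW d →L[ℝ] WW d) (O' O'' : UU d)
    (r : ℝ) (h1 : ‖X‖ * (R * (1 + R)) ≤ r) (h2 : ‖(O''⁻¹ * O').1 - 1‖ ≤ r) : DLe R L X O' O'' r := by
  constructor
  · intro x hx
    refine (Pr_norm _ _).trans ?_
    rw [U_norm]
    exact (xi_norm hR X x hx).trans h1
  · intro s hs
    have : Pr L ((O''⁻¹).1 (O'.1 s)) = Pr L (((O''⁻¹ * O').1 - 1) s) := by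
      rw [sub_apply, one_apply_eq_self, map_sub, Pr_eq_zero hs, sub_zero, U_mul]
    rw [this]
    refine (Pr_norm _ _).trans ((ContinuousLinearMap.le_opNorm _ _).trans ?_)
    gcongr

lemma Hm_hmat (g h : Sim d) (hc : g.c = h.c) (Y : WW d →L[ℝ] WW d) :
    Hm h * Y * Hm g⁻¹ = hmat h * Y * hmat g⁻¹ := by
  refine ContinuousLinearMap.ext fun w => ?_
  simp only [mul_apply_eq_comp, Hm_apply, map_smul, smul_smul, inv_c, hc]
  rw [Real.inv_rpow h.hc.le, inv_mul_cancel₀ (Real.rpow_pos_of_pos h.hc _).ne', one_smul]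

lemma endgame {R : ℝ} {L : Submodule ℝ (VV d)} (g h : Sim d) (X : WW d →L[ℝ] WW d)
    (O : UU d) (r : ℝ) (hQ : hmat h * (1 + X) * hmat g⁻¹ = 1)
    (hD : DLe R L X (g.O⁻¹ * O) (h.O⁻¹ * O) r) (x0 : VV d) (hx0 : ‖x0‖ ≤ R) :
    ‖Pr L ((O⁻¹).1 (g.act x0 - h.act x0))‖ ≤ h.c * r := by
  have h1 : X = hmat (h⁻¹ * g) - 1 := by
    have : hmat h⁻¹ * (hmat h * (1 + X) * hmat g⁻¹) * hmat g = 1 + X := by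
      rw [mul_assoc, mul_assoc (hmat h * (1 + X)), hmat_inv_mul, mul_one, ← mul_assoc, hmat_inv_mul, one_mul]
    rw [hQ, mul_one, ← hmat_mul] at this
    rw [this]; abel
  have h2 : xi X x0 = h.c⁻¹ • (h.O⁻¹).1 (g.act x0 - h.act x0) := by
    have h3 := act_sub h⁻¹ (g.act x0) (h.act x0)
    rw [inv_act_act, ← mul_act] at h3
    rw [inv_c, inv_O] at h3
    rw [← h3, h1, xi, sub_apply, hmat_apply, one_apply_eq_self]
    simp [act]
  have h4 := hD.1 x0 hx0
  rw [h2, mul_inv_rev, inv_inv, U_mul, map_smul, U_apply_inv, map_smul, map_smul, norm_smul, norm_inv,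
    Real.norm_of_nonneg h.hc.le, inv_mul_le_iff₀ h.hc] at h4
  exact h4

namespace Sys
variable (S : Sys d)
variable {Ts : Set (VV d)}

lemma tendsto_cpow : Tendsto (fun n : ℕ => S.c ^ n) atTop (𝓝 0) :=
  tendsto_pow_atTop_nhds_zero_of_lt_one S.hc0.le S.hc1

set_option maxHeartbeats 1000000 in
theorem propW (hM : S.IsMx Ts) {ε η : ℝ} (n0 : ℕ) (hε : 0 < ε) (hη : 0 < η) :
    ∃ n ≥ n0, ∃ (σ' σ'' : S.St) (X : WW d →L[ℝ] WW d), S.Tn Ts n σ' ∧ S.Tn Ts n σ'' ∧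
      σ''.1 = (1 + X) * σ'.1 ∧ ‖X‖ ≤ η ∧ ‖((σ''.2.2)⁻¹ * σ'.2.2).1 - 1‖ ≤ η ∧
      DLe S.R (Ls Ts) X σ'.2.2 σ''.2.2 (ε * S.c ^ n) ∧
      ¬ DLe S.R (Ls Ts) X σ'.2.2 σ''.2.2 (S.kap * ε * S.c ^ n) := by
  by_contra hcon
  have hL : Ls Ts ≠ ⊤ := Ls_ne_top (S.zero_mem_Ts hM) (S.Ts_ne_univ hM)
  have hR := S.hR
  have hc0 := S.hc0
  have gap0 : ∀ n ≥ n0, ∀ (σ' σ'' : S.St) (X : WW d →L[ℝ] WW d), S.Tn Ts n σ' → S.Tn Ts n σ'' →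
      σ''.1 = (1 + X) * σ'.1 → ‖X‖ ≤ η → ‖((σ''.2.2)⁻¹ * σ'.2.2).1 - 1‖ ≤ η →
      DLe S.R (Ls Ts) X σ'.2.2 σ''.2.2 (ε * S.c ^ n) →
      DLe S.R (Ls Ts) X σ'.2.2 σ''.2.2 (S.kap * ε * S.c ^ n) := by
    intro n hn σ' σ'' X h1 h2 h3 h4 h5 h6
    by_contra h7
    exact hcon ⟨n, hn, σ', σ'', X, h1, h2, h3, h4, h5, h6, h7⟩
  clear hcon
  obtain ⟨C, hC⟩ := S.exists_Cm
  obtain ⟨C', hC'0, hC'⟩ := inv_bound (d := d) C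
  obtain ⟨ρ, hρ, hsep⟩ := gam_sep (d := d) C
  obtain ⟨η', hη'0, hη'η, hη'ρ⟩ : ∃ η' > 0, η' ≤ η ∧ 3 * (1 + S.R) * η' ≤ ρ / 2 := by
    refine ⟨min η (ρ / (6 * (1 + S.R))), by positivity, min_le_left _ _, ?_⟩
    calc _ ≤ 3 * (1 + S.R) * (ρ / (6 * (1 + S.R))) := by gcongr; exact min_le_right _ _
      _ = ρ / 2 := by field_simp; norm_num
  obtain ⟨n1, hn1, hn1η⟩ : ∃ n1 ≥ n0, 2 * (S.R + 1) ^ 2 * (21 * (ε * S.c ^ n1)) ≤ η' / 2 := by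
    have h1 : Tendsto (fun n : ℕ => 2 * (S.R + 1) ^ 2 * (21 * (ε * S.c ^ n))) atTop
        (𝓝 (2 * (S.R + 1) ^ 2 * (21 * (ε * 0)))) :=
      ((S.tendsto_cpow.const_mul _).const_mul _).const_mul _
    rw [mul_zero, mul_zero, mul_zero] at h1
    obtain ⟨n, hn, hn'⟩ := ((h1.eventually (eventually_le_nhds (half_pos hη'0))).and
      (eventually_ge_atTop n0)).exists
    exact ⟨n, hn', hn⟩
  have hεn : 0 < ε * S.c ^ n1 := by positivity
  obtain ⟨ρ0, hρ00, h01, h02, h03, h04⟩ : ∃ ρ0 > 0, 2 * (S.R + 1) ^ 2 * (ρ0 * C') ≤ η' / 2 ∧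
      ρ0 * C' * (S.R * (1 + S.R)) ≤ ε * S.c ^ n1 ∧ ρ0 ≤ η' ∧ ρ0 ≤ ε * S.c ^ n1 := by
    have t1 : Tendsto (fun x : ℝ => 2 * (S.R + 1) ^ 2 * (x * C')) (𝓝[>] 0) (𝓝 (2 * (S.R + 1) ^ 2 * (0 * C'))) :=
      tendsto_nhdsWithin_of_tendsto_nhds ((by fun_prop : Continuous _).tendsto 0)
    have t2 : Tendsto (fun x : ℝ => x * C' * (S.R * (1 + S.R))) (𝓝[>] 0) (𝓝 (0 * C' * (S.R * (1 + S.R)))) :=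
      tendsto_nhdsWithin_of_tendsto_nhds ((by fun_prop : Continuous _).tendsto 0)
    have t3 : Tendsto (fun x : ℝ => x) (𝓝[>] 0) (𝓝 0) :=
      tendsto_nhdsWithin_of_tendsto_nhds tendsto_id
    simp only [zero_mul, mul_zero] at t1 t2
    obtain ⟨x, hx⟩ := ((t1.eventually (eventually_le_nhds (half_pos hη'0))).and
      ((t2.eventually (eventually_le_nhds hεn)).and ((t3.eventually (eventually_le_nhds hη'0)).and
      ((t3.eventually (eventually_le_nhds hεn)).and eventually_mem_nhdsWithin)))).exists
    exact ⟨x, hx.2.2.2.2, hx.1, hx.2.1, hx.2.2.1, hx.2.2.2.1⟩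
  have hKc : IsCompact ((Metric.closedBall (0 : WW d →L[ℝ] WW d) C) ×ˢ (Set.univ : Set (UU d))) := by
    have : ProperSpace (WW d →L[ℝ] WW d) := FiniteDimensional.proper ℝ _
    have := U_compact (d := d)
    exact (isCompact_closedBall _ _).prod isCompact_univ
  obtain ⟨N, hN⟩ := pigeon hKc hρ00
  have hs : ∀ m, ∃ σ, S.Tn Ts m σ ∧ ‖σ.1‖ ≤ C := by
    intro m
    obtain ⟨σ, hσ⟩ := S.exists_Tn hM m
    obtain ⟨γ, hγ, hn⟩ := hC _ _ (S.Tn_OmS hM hσ)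
    exact ⟨S.rg σ γ, (S.Tn_rg hγ).2 hσ, hn⟩
  choose s hsT hsC using hs
  obtain ⟨sl, φ, hφ, hl⟩ := S.subseq C s hsC
  have hlO : Tendsto (fun j => (s (φ j)).2.2) atTop (𝓝 sl.2.2) :=
    ((continuous_snd.comp continuous_snd).tendsto sl).comp hl
  obtain ⟨l, v, hvl, hva, hvd⟩ := S.exists_words hL sl.2.2 N (ρ := ρ / 4) (by positivity)
  have ev1 : ∀ᶠ j in atTop, 21 * (ε * S.c ^ (φ j)) * ((S.c ^ l)⁻¹ * (S.c ^ l)⁻¹ * (1 + S.R) ^ 2) ≤ ρ / 4 := by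
    have h1 : Tendsto (fun j : ℕ => 21 * (ε * S.c ^ (φ j)) * ((S.c ^ l)⁻¹ * (S.c ^ l)⁻¹ * (1 + S.R) ^ 2)) atTop
        (𝓝 (21 * (ε * 0) * ((S.c ^ l)⁻¹ * (S.c ^ l)⁻¹ * (1 + S.R) ^ 2))) :=
      (((S.tendsto_cpow.comp hφ.tendsto_atTop).const_mul _).const_mul _).mul_const _
    rw [mul_zero, mul_zero, zero_mul] at h1
    exact h1.eventually (eventually_le_nhds (by positivity))
  have ev2 : ∀ a b, ∀ᶠ j in atTop, a ≠ b → S.kap * ε * S.c ^ (φ j) <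
      ‖Pr (Ls Ts) ((((s (φ j)).2.2)⁻¹).1 ((S.prodw (v a)).act S.x0 - (S.prodw (v b)).act S.x0))‖ := by
    intro a b
    by_cases hab : a = b
    · exact Eventually.of_forall fun j h => absurd hab h
    set D := (S.prodw (v a)).act S.x0 - (S.prodw (v b)).act S.x0
    have h1 : Tendsto (fun j => S.kap * ε * S.c ^ (φ j)) atTop (𝓝 (S.kap * ε * 0)) :=
      (S.tendsto_cpow.comp hφ.tendsto_atTop).const_mul _
    rw [mul_zero] at h1
    have hcont : Continuous fun A : UU d => ‖Pr (Ls Ts) ((A⁻¹).1 D)‖ := by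
      have h2 : Continuous fun A : UU d => ((A⁻¹).1 : VV d →L[ℝ] VV d) :=
        continuous_Uinv
      exact ((Pr (Ls Ts)).continuous.comp (h2.clm_apply continuous_const)).norm
    have h2 : Tendsto (fun j => ‖Pr (Ls Ts) ((((s (φ j)).2.2)⁻¹).1 D)‖) atTop
        (𝓝 ‖Pr (Ls Ts) (((sl.2.2)⁻¹).1 D)‖) := (hcont.tendsto _).comp hlO
    have h3 := h1.eventually_lt h2 (norm_pos_iff.2 (hvd a b hab))
    exact h3.mono fun j hj _ => hj
  obtain ⟨j, hj1, hj2, hj3⟩ := (ev1.and ((eventually_all.2 fun a => eventually_all.2 (ev2 a)).and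
    (eventually_ge_atTop (n1 + l)))).exists
  have hmge : n1 + l ≤ φ j := hj3.trans (hφ.id_le j)
  obtain ⟨k, hk⟩ : ∃ k, φ j = n1 + k + l := ⟨φ j - n1 - l, by omega⟩
  set σ := s (φ j) with hσ
  have hσT : S.Tn Ts (n1 + k + l) σ := by rw [← hk]; exact hsT _
  have hσC : ‖σ.1‖ ≤ C := hsC _
  have hτT : ∀ a, S.Tn Ts (n1 + k) (S.appw (v a) σ) := fun a => S.Tn_appw _ (by rw [hvl]; exact hσT)
  have hpT : ∀ a, S.Tn Ts n1 (S.appw (List.replicate k S.i0) (S.appw (v a) σ)) := fun a =>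
    S.Tn_appw _ (by rw [List.length_replicate]; exact hτT a)
  have hγ0 : ∀ a, ∃ γ ∈ Gam (bW d), ‖(S.appw (List.replicate k S.i0) (S.appw (v a) σ)).1 * γ‖ ≤ C :=
    fun a => hC _ _ (S.Tn_OmS hM (hpT a))
  choose γ hγ hγC using hγ0
  set P : Fin (N + 1) → S.St := fun a => S.rg (S.appw (List.replicate k S.i0) (S.appw (v a) σ)) (γ a) with hP
  obtain ⟨a, b, hab, hdist⟩ := hN (fun a => ((P a).1, (P a).2.2)) (fun a => ⟨by rw [mem_closedBall_zero_iff]; exact hγC a, trivial⟩)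
  rw [Prod.dist_eq, max_lt_iff] at hdist
  obtain ⟨hd1, hd2⟩ := hdist
  simp only at hd1 hd2
  rw [dist_comm, dist_eq_norm] at hd1
  have hd2' : ‖(P a).2.2.1 - (P b).2.2.1‖ < ρ0 := by
    rw [← dist_eq_norm]; exact hd2
  have hOm : S.OmS (P a) := (S.OmS_rg (hγ a)).2 (S.Tn_OmS hM (hpT a))
  obtain ⟨yi, hy1, hy2, hy3⟩ := hC' (P a).1 hOm.1 (hγC a)
  set X0 := ((P b).1 - (P a).1) * yi with hX0
  have hX0n : ‖X0‖ ≤ ρ0 * C' := (norm_mul_le _ _).trans (by gcongr)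
  have hX0e : (P b).1 = (1 + X0) * (P a).1 := by
    rw [hX0, add_mul, one_mul, mul_assoc, hy2, mul_one]; abel
  have hOO : ‖(((P b).2.2)⁻¹ * (P a).2.2).1 - 1‖ ≤ ρ0 := (unit_dist _ _).trans hd2'.le
  have hD0 : DLe S.R (Ls Ts) X0 (P a).2.2 (P b).2.2 (ε * S.c ^ n1) := by
    refine DLe_of_small hR _ _ _ _ _ ?_ (hOO.trans h04)
    refine le_trans ?_ h02
    gcongr
  have hPz : ∀ a, (P a).1 = Hm (S.f S.i0 ^ k)⁻¹ * (S.rg (S.appw (v a) σ) (γ a)).1 := by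
    intro a
    change (S.appw (List.replicate k S.i0) (S.appw (v a) σ)).1 * γ a = _ * ((S.appw (v a) σ).1 * γ a)
    rw [appw_z, prodw_rep, mul_assoc]
  have hPO : ∀ a, (P a).2.2 = (S.f S.i0 ^ k).O⁻¹ * (S.rg (S.appw (v a) σ) (γ a)).2.2 := by
    intro a
    change (S.appw (List.replicate k S.i0) (S.appw (v a) σ)).2.2 = _ * (S.appw (v a) σ).2.2
    rw [appw_O, prodw_rep]
  rw [hPz a, hPz b] at hX0e
  rw [hPO a, hPO b] at hOO hD0
  rw [mul_inv_rev, inv_inv, mul_assoc, mul_inv_cancel_left] at hOO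
  obtain ⟨e1, e2, e3⟩ := S.descend hL (η := η') (n1 := n1) hε
    (fun n hn σ' σ'' X h1 h2 h3 h4 h5 h6 => gap0 n (hn1.trans hn) σ' σ'' X h1 h2 h3 (h4.trans hη'η)
      (h5.trans hη'η) h6) X0 (by
        have : 2 * (S.R + 1) ^ 2 * ‖X0‖ ≤ 2 * (S.R + 1) ^ 2 * (ρ0 * C') := by gcongr
        linarith) k
    (S.rg (S.appw (v a) σ) (γ a)) (S.rg (S.appw (v b) σ) (γ b)) ((S.Tn_rg (hγ a)).2 (hτT a))
    ((S.Tn_rg (hγ b)).2 (hτT b)) hX0e (hOO.trans h03) hD0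
  set X := hmat (S.f S.i0 ^ k) * X0 * hmat (S.f S.i0 ^ k)⁻¹
  set g := S.prodw (v a) with hg
  set h := S.prodw (v b) with hh
  have hgc : g.c = S.c ^ l := by rw [hg, prodw_c, hvl]
  have hhc : h.c = S.c ^ l := by rw [hh, prodw_c, hvl]
  have hgh : g.c = h.c := by rw [hgc, hhc]
  change (S.appw (v b) σ).1 * γ b = (1 + X) * ((S.appw (v a) σ).1 * γ a) at e1
  change DLe S.R (Ls Ts) X (S.appw (v a) σ).2.2 (S.appw (v b) σ).2.2 _ at e3
  change ‖(((S.appw (v b) σ).2.2)⁻¹ * (S.appw (v a) σ).2.2).1 - 1‖ ≤ ρ0 at hOO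
  rw [appw_O, appw_O, ← hg, ← hh] at e3 hOO
  rw [appw_z, appw_z, ← hg, ← hh] at e1
  have hQy : hmat h * (1 + X) * hmat g⁻¹ * (σ.1 * γ a) = σ.1 * γ b := by
    rw [← Hm_hmat g h hgh]
    have h1 : Hm h * (Hm h⁻¹ * σ.1 * γ b) = σ.1 * γ b := by
      rw [mul_assoc, ← mul_assoc (Hm h), Hm_mul_inv, one_mul]
    rw [← h1, e1]; simp only [mul_assoc]
  have hOO' : ‖(h.O * g.O⁻¹).1 - 1‖ ≤ η' := by
    refine le_trans (le_of_eq ?_) (hOO.trans h03)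
    rw [mul_inv_rev, inv_inv, ← conj_unit_norm σ.2.2]
    simp only [mul_assoc]
  have hkap : S.kap ≤ 1 := by
    unfold kap
    have := S.hc1
    have : S.c ^ 2 ≤ 1 := pow_le_one₀ S.hc0.le S.hc1.le
    linarith
  have hgam : ∀ w, |(X (w, 0)).2| ≤ 21 * (ε * S.c ^ (n1 + k)) * ‖w‖ :=
    gamma_bound hR hL (DLe_mono e3 (by
      rw [mul_assoc]
      exact mul_le_of_le_one_left (by positivity) hkap))
  have hQn := Q_bound (R := S.R) (by linarith) g h hgh (by rw [hhc]; exact pow_le_one₀ S.hc0.le S.hc1.le)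
    (S.prodw_a _) (S.prodw_a _) X _ (by positivity) hgam
  have hQ1 := hsep σ.1 _ (γ a) (γ b) (S.Tn_OmS hM hσT).1 hσC (hγ a) (hγ b) hQy (by
    refine hQn.trans ?_
    have b1 : ‖h.a - g.a‖ ≤ ρ / 4 := hva b a
    have b2 : (1 + S.R) * (21 * (ε * S.c ^ (n1 + k)) * h.c⁻¹ * (1 + S.R)) ≤ ρ / 4 := by
      refine le_trans (le_of_eq ?_) hj1
      rw [hk, hhc, pow_add S.c (n1 + k) l]
      field_simp
    have b3 : (1 + S.R) * ‖(h.O * g.O⁻¹).1 - 1‖ ≤ (1 + S.R) * η' := by gcongr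
    have b4 : (1 + S.R) * ‖X‖ ≤ (1 + S.R) * η' := by gcongr
    rw [mul_add, mul_add]
    linarith)
  have hfin := endgame g h X σ.2.2 _ hQ1 e3 S.x0 S.hx0R
  have hlt := hj2 a b hab
  rw [hhc] at hfin
  rw [hk, pow_add S.c (n1 + k) l] at hlt
  linarith

end Sys
end BA

namespace BA
set_option linter.unusedSectionVars false
set_option linter.unusedSimpArgs false
open Sim
variable {d : ℕ}

lemma hmat_trans_norm (b : VV d) : ‖hmat (Sim.trans b)‖ ≤ 1 + ‖b‖ := by
  refine ContinuousLinearMap.opNorm_le_bound _ (by positivity) fun w => ?_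
  rw [hmat_apply]
  have h1 := norm_fst_le w
  have h2 := norm_snd_le w
  have hb := norm_nonneg b
  rw [Prod.norm_mk, max_le_iff]
  constructor
  · simp only [trans_c, trans_O, trans_a, one_smul, U_one]
    calc ‖w.1 + w.2 • b‖ ≤ ‖w.1‖ + ‖w.2‖ * ‖b‖ := (norm_add_le _ _).trans (by rw [norm_smul])
      _ ≤ ‖w‖ + ‖w‖ * ‖b‖ := by gcongr
      _ = _ := by ring
  · nlinarith [norm_nonneg w]

/-- the renormalised difference -/
lemma drift_formula (X : WW d →L[ℝ] WW d) (g : Sim d) (p p' : VV d) (x : VV d) (q : ℝ) :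
    ((hmat (Sim.trans (-p') * g)⁻¹ * (1 + X) * hmat (Sim.trans (-p) * g)) -
      hmat (Sim.trans (g.c⁻¹ • (g.O⁻¹).1 (xi X (g.a - p) + (1 + (X (g.a - p, 1)).2) • (p' - p))))) (x, q) =
    ((g.O⁻¹).1 ((X (g.O.1 x, 0)).1 - (X (g.O.1 x, 0)).2 • (g.a - p')),
      g.c * (X (g.O.1 x, 0)).2 + q * (X (g.a - p, 1)).2) := by
  have hc := g.hc.ne'
  have e1 : X (g.c • g.O.1 x + q • (g.a - p), q) = g.c • X (g.O.1 x, 0) + q • X (g.a - p, 1) := by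
    rw [← map_smul X, ← map_smul X, ← map_add X]; simp
  have e2 : hmat (Sim.trans (-p) * g) (x, q) = (g.c • g.O.1 x + q • (g.a - p), q) := by
    rw [hmat_apply, mul_a, mul_c, mul_O]
    simp [act, U_one, U_mul, sub_eq_add_neg, add_comm]
  have e3 : (1 + X) (g.c • g.O.1 x + q • (g.a - p), q) =
      (g.c • g.O.1 x + q • (g.a - p), q) + (g.c • X (g.O.1 x, 0) + q • X (g.a - p, 1)) := by
    rw [add_apply, one_apply_eq_self, e1]
  rw [sub_apply, mul_apply_eq_comp, mul_apply_eq_comp, e2, e3]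
  set Y1 := X (g.O.1 x, 0)
  set Y2 := X (g.a - p, 1) with hY2
  have e4 : ∀ w : WW d, hmat (Sim.trans (-p') * g)⁻¹ w = (g.c⁻¹ • (g.O⁻¹).1 (w.1 - w.2 • (g.a - p')), w.2) := by
    intro w
    rw [hmat_apply, inv_a, mul_a, inv_c, inv_O, mul_O, mul_c]
    refine Prod.ext ?_ rfl
    simp only [act, trans_c, trans_O, trans_a, one_mul, one_smul, U_one, map_add, map_sub, map_smul,
      smul_add, smul_sub, map_neg, smul_neg]
    module
  rw [e4, hmat_apply]
  refine Prod.ext ?_ ?_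
  · simp only [trans_c, trans_O, trans_a, one_smul, U_one, Prod.fst_sub, Prod.fst_add, Prod.snd_add,
      Prod.smul_fst, Prod.smul_snd, smul_eq_mul, xi, ← hY2, map_add, map_sub, map_smul, U_inv_apply,
      smul_add, smul_sub, smul_smul]
    match_scalars <;> field_simp <;> ring
  · simp

lemma drift_err {R D : ℝ} (hR : 1 ≤ R) (hD : 0 ≤ D) (X : WW d →L[ℝ] WW d) (g : Sim d) (p p' : VV d)
    (hg : g.c ≤ 1) (ha : ‖g.a‖ ≤ R) (hp : ‖p‖ ≤ 1) (hp' : ‖p'‖ ≤ D) :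
    ‖(hmat (Sim.trans (-p') * g)⁻¹ * (1 + X) * hmat (Sim.trans (-p) * g)) -
      hmat (Sim.trans (g.c⁻¹ • (g.O⁻¹).1 (xi X (g.a - p) + (1 + (X (g.a - p, 1)).2) • (p' - p))))‖
      ≤ (R + D + 4) * ‖X‖ := by
  refine ContinuousLinearMap.opNorm_le_bound _ (by positivity) fun w => ?_
  obtain ⟨x, q⟩ := w
  rw [drift_formula]
  have hx := norm_fst_le ((x, q) : WW d)
  have hq := norm_snd_le ((x, q) : WW d)
  simp only at hx hq
  set N := ‖((x, q) : WW d)‖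
  have hX := norm_nonneg X
  have hN : 0 ≤ N := norm_nonneg _
  have h1 : ‖X (g.O.1 x, 0)‖ ≤ ‖X‖ * N := by
    refine (X.le_opNorm _).trans ?_
    gcongr
    rw [Prod.norm_mk, U_norm]; simp; exact hx
  have h1a := (norm_fst_le _).trans h1
  have h1b := (norm_snd_le _).trans h1
  have h2 : ‖X (g.a - p, 1)‖ ≤ ‖X‖ * (R + 1) := by
    refine (X.le_opNorm _).trans ?_
    gcongr
    rw [Prod.norm_mk]
    apply max_le
    · exact (norm_sub_le _ _).trans (by linarith)
    · simp; linarith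
  have h2b := (norm_snd_le _).trans h2
  rw [Prod.norm_mk]
  apply max_le
  · rw [U_norm]
    calc _ ≤ ‖(X (g.O.1 x, 0)).1‖ + ‖(X (g.O.1 x, 0)).2‖ * ‖g.a - p'‖ :=
          (norm_sub_le _ _).trans (by rw [norm_smul])
      _ ≤ ‖X‖ * N + ‖X‖ * N * (R + D) := by
          gcongr
          exact (norm_sub_le _ _).trans (by linarith)
      _ ≤ _ := by nlinarith [mul_nonneg hX hN]
  · calc _ ≤ ‖g.c‖ * ‖(X (g.O.1 x, 0)).2‖ + ‖q‖ * ‖(X (g.a - p, 1)).2‖ :=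
          (norm_add_le _ _).trans (by rw [norm_mul, norm_mul])
      _ ≤ 1 * (‖X‖ * N) + N * (‖X‖ * (R + 1)) := by
          gcongr
          rw [Real.norm_of_nonneg g.hc.le]; exact hg
      _ ≤ _ := by nlinarith [mul_nonneg hX hN, mul_nonneg (mul_nonneg hX hN) hD]

namespace Sys
variable (S : Sys d)
variable {Ts : Set (VV d)}

lemma norming_xi (A : VV d →L[ℝ] VV d) (X : WW d →L[ℝ] WW d) (y : Fin S.m → VV d)
    (hy : ∀ i, ‖y i‖ ≤ S.R) (M : ℝ) (hM : ∀ i, ‖A (xi X ((S.f i).act (y i)))‖ ≤ M) (x : VV d)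
    (hx : ‖x‖ ≤ S.R) : ‖A (xi X x)‖ ≤ S.C0 * M := by
  set e := A (xi X x) with he
  set X0 : VV d →L[ℝ] WW d := X.comp (ContinuousLinearMap.inl ℝ (VV d) ℝ) with hX0
  set ea : VV d →L[ℝ] ℝ := (innerSL ℝ e).comp A with hea
  set l : VV d →L[ℝ] ℝ := ea.comp ((ContinuousLinearMap.fst ℝ (VV d) ℝ).comp X0 - (X (0,1)).2 • 1) with hl
  set B : VV d →L[ℝ] VV d →L[ℝ] ℝ := -(((ContinuousLinearMap.snd ℝ (VV d) ℝ).comp X0).smulRight ea) with hB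
  have key : ∀ y, ea (X (0,1)).1 + l y + B y y = inner ℝ e (A (xi X y)) := by
    intro y
    rw [xi_eq]
    simp [hl, hB, hea, hX0, inner_add_right, inner_sub_right, inner_smul_right]
    ring
  have hbd : ∀ i, |ea (X (0,1)).1 + l ((S.f i).act (y i)) + B ((S.f i).act (y i)) ((S.f i).act (y i))| ≤ ‖e‖ * M := by
    intro i
    rw [key]
    exact (abs_real_inner_le_norm _ _).trans (by gcongr; exact hM i)
  have := S.norming _ _ _ y hy _ hbd x hx
  rw [key, ← he, real_inner_self_eq_norm_sq, abs_of_nonneg (by positivity)] at this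
  by_cases h0 : ‖e‖ = 0
  · rw [h0]
    have hM0 : 0 ≤ M := (norm_nonneg _).trans (hM S.i0)
    have := S.hC0
    positivity
  · have h1 : 0 < ‖e‖ := lt_of_le_of_ne (norm_nonneg _) (Ne.symm h0)
    nlinarith

lemma Tn_shift {n : ℕ} {σ : S.St} (h : S.Tn Ts n σ) {s : VV d} (hs : s ∈ Ls Ts) :
    S.Tn Ts n (Hm (Sim.trans (σ.2.2.1 s)) * σ.1, σ.2.1, σ.2.2) := by
  intro t ht
  have hc : S.c ^ n ≠ 0 := pow_ne_zero _ S.hc0.ne'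
  have h1 : t + (S.c ^ n)⁻¹ • s ∈ Ts := (Ls_stab ((Ls Ts).smul_mem _ hs) t ht).1
  have h2 := h _ h1
  rw [smul_add, smul_smul, mul_inv_cancel₀ hc, one_smul] at h2
  change S.Om _ _ at h2 ⊢
  simp only
  rwa [map_add, trans_add, Hm_mul, mul_assoc] at h2

set_option maxHeartbeats 1000000 in
theorem drift1 (hM : S.IsMx Ts) : ∃ k C : ℝ, 0 < k ∧ 0 < C ∧ ∀ (ε η : ℝ) (n0 : ℕ), 0 < ε → 0 < η →
    η ≤ 1 / (4 * S.R) →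
    ∃ (σ' σ'' : S.St) (Y : WW d →L[ℝ] WW d) (b : VV d), S.Tn Ts 0 σ' ∧ S.Tn Ts 0 σ'' ∧
      σ''.1 = Y * σ'.1 ∧ ‖Y - hmat (Sim.trans b)‖ ≤ C * η ∧ (σ''.2.2⁻¹).1 b ∈ (Ls Ts)ᗮ ∧
      k * ε ≤ ‖b‖ ∧ ‖b‖ ≤ 18 * ε ∧ (∀ j < n0, σ'.2.1 j = σ''.2.1 j) ∧
      ‖((σ''.2.2)⁻¹ * σ'.2.2).1 - 1‖ ≤ η := by
  have hR := S.hR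
  have hR0 : 0 < S.R := by linarith
  have hC0 := S.hC0
  have hc0 := S.hc0
  have hkap : 0 < S.kap := by unfold kap; positivity
  set K := 64 * (S.C0 + 1) with hK
  have hK0 : 0 < K := by positivity
  have hK1 : 4 ≤ K := by linarith
  set D := 4 + 8 * S.R * (1 + 2 * S.R) with hD
  have hD0 : 0 < D := by positivity
  refine ⟨S.kap / K, S.R + D + 4, by positivity, by positivity, ?_⟩
  intro ε η n0 hε hη hη1
  obtain ⟨n, hn, σ', σ'', X, hT', hT'', hz, hXη, hOη, hDL, hnDL⟩ := S.propW hM (n0 + 1) hε hη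
  set L := Ls Ts with hL
  set ρ := S.c ^ n with hρ
  have hρ0 : 0 < ρ := by positivity
  have hρ1 : ρ ≤ 1 := pow_le_one₀ hc0.le S.hc1.le
  set O' := σ'.2.2
  set O'' := σ''.2.2
  set A : VV d →L[ℝ] VV d := Pr L * (O''⁻¹).1 with hA
  have hAa : ∀ x, A x = Pr L ((O''⁻¹).1 x) := fun x => rfl
  have hη2 : η * (4 * S.R) ≤ 1 := by rwa [le_div_iff₀ (by positivity)] at hη1
  have hη3 : η ≤ 1 := by nlinarith
  have hτ : ∀ x, ‖x‖ ≤ 2 * S.R → |(X (x, 1)).2| ≤ 1 / 2 := by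
    intro x hx
    have : ‖X (x, 1)‖ ≤ η * (2 * S.R) := by
      refine (X.le_opNorm _).trans ?_
      gcongr
      rw [Prod.norm_mk]; apply max_le hx; simp; linarith
    have := (norm_snd_le _).trans this
    rw [Real.norm_eq_abs] at this
    linarith
  set a : Fin S.m → VV d := fun i => (S.f i * S.f S.i0 ^ (n - 1)).a with ha
  -- the choice of letter and vector
  have hchoice : ∃ i, ∃ s ∈ L, ‖s‖ ≤ 1 ∧ S.kap / K * (ε * ρ) ≤
      ‖A (xi X (a i - O'.1 s)) - (1 + (X (a i - O'.1 s, 1)).2) • A (O'.1 s)‖ := by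
    by_cases h1 : ∃ i, S.kap / K * (ε * ρ) ≤ ‖A (xi X (a i))‖
    · obtain ⟨i, hi⟩ := h1
      exact ⟨i, 0, zero_mem _, by simp, by simpa using hi⟩
    · push Not at h1
      have h2 : ∀ x, ‖x‖ ≤ S.R → ‖A (xi X x)‖ ≤ S.C0 * (S.kap / K * (ε * ρ)) :=
        fun x hx => S.norming_xi A X (fun _ => (S.f S.i0 ^ (n - 1)).a) (fun _ => S.pow_a _) _
          (fun i => (h1 i).le) x hx
      have h3 : S.C0 * (S.kap / K * (ε * ρ)) ≤ (1 / 64) * (S.kap * ε * ρ) := by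
        have : S.C0 * (S.kap / K * (ε * ρ)) = (S.C0 / K) * (S.kap * ε * ρ) := by ring
        rw [this]
        refine mul_le_mul_of_nonneg_right ?_ (by positivity)
        rw [div_le_iff₀ hK0]; linarith
      have hr0 : 0 < S.kap * ε * ρ := by positivity
      have h4 : ∃ s ∈ L, S.kap * ε * ρ * ‖s‖ < ‖A (O'.1 s)‖ := by
        by_contra! hcon
        apply hnDL
        refine ⟨fun x hx => ?_, hcon⟩
        have := h2 x hx
        rw [hAa] at this
        linarith
      obtain ⟨s0, hs0, hs0'⟩ := h4
      have hs0n : ‖s0‖ ≠ 0 := by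
        intro h
        rw [norm_eq_zero] at h
        rw [h] at hs0'
        simp at hs0'
      refine ⟨S.i0, ‖s0‖⁻¹ • s0, L.smul_mem _ hs0, ?_, ?_⟩
      · rw [norm_smul, norm_inv, norm_norm, inv_mul_cancel₀ hs0n]
      set s := ‖s0‖⁻¹ • s0 with hs
      have hs1 : ‖s‖ = 1 := by rw [hs, norm_smul, norm_inv, norm_norm, inv_mul_cancel₀ hs0n]
      have hs2 : S.kap * ε * ρ ≤ ‖A (O'.1 s)‖ := by
        rw [hs, map_smul, map_smul, norm_smul, norm_inv, norm_norm, inv_mul_eq_div, le_div_iff₀ (by positivity)]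
        exact hs0'.le
      have hx2 : ‖a S.i0 - O'.1 s‖ ≤ 2 * S.R := by
        refine (norm_sub_le _ _).trans ?_
        rw [U_norm, hs1]
        have : ‖a S.i0‖ ≤ S.R := by
          simp only [ha]; rw [← pow_succ']; exact S.pow_a _
        linarith
      have h5 := quad_ext A X (by norm_num : (1:ℝ) ≤ 2) hR0.le h2 _ hx2
      have h6 := hτ _ hx2
      set τ := (X (a S.i0 - O'.1 s, 1)).2
      have h7 : (1 / 2) * ‖A (O'.1 s)‖ ≤ ‖(1 + τ) • A (O'.1 s)‖ := by
        rw [norm_smul]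
        gcongr
        rw [Real.norm_eq_abs]
        have := abs_le.1 h6
        exact le_trans (by linarith) (le_abs_self _)
      have h8 := norm_sub_norm_le ((1 + τ) • A (O'.1 s)) (A (xi X (a S.i0 - O'.1 s)))
      rw [norm_sub_rev] at h8
      have h9 : S.kap / K * (ε * ρ) ≤ (1/4) * (S.kap * ε * ρ) := by
        have : S.kap / K * (ε * ρ) = (1 / K) * (S.kap * ε * ρ) := by ring
        rw [this]
        gcongr
      linarith
  obtain ⟨i, s, hsL, hs1, hlow⟩ := hchoice
  set w : List (Fin S.m) := i :: List.replicate (n - 1) S.i0 with hw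
  have hwl : w.length = n := by simp [hw]; omega
  set g := S.prodw w with hg
  have hgi : g = S.f i * S.f S.i0 ^ (n - 1) := by rw [hg, hw, prodw_cons, prodw_rep]
  have hga : g.a = a i := by rw [hgi]
  have hgc : g.c = ρ := by rw [hg, prodw_c, hwl]
  have hgaR : ‖g.a‖ ≤ S.R := S.prodw_a w
  rw [← hga] at hlow
  set p := O'.1 s with hp
  have hpn : ‖p‖ ≤ 1 := by rw [hp, U_norm]; exact hs1
  have hx2 : ‖g.a - p‖ ≤ 2 * S.R := (norm_sub_le _ _).trans (by linarith)
  have hτ1 := hτ _ hx2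
  set τ := (X (g.a - p, 1)).2 with hτd
  have hτ2 := abs_le.1 hτ1
  have hτ0 : (1 + τ) ≠ 0 := by linarith
  set v := (O''⁻¹).1 p - (1 + τ)⁻¹ • (O''⁻¹).1 (xi X (g.a - p)) with hv
  set s' := v - Pr L v with hs'
  have hs'L : s' ∈ L := sub_Pr_mem L v
  have hxin : ‖xi X (g.a - p)‖ ≤ 2 * S.R * (1 + 2 * S.R) := by
    refine (xi_norm (R := 2 * S.R) (by linarith) X _ hx2).trans ?_
    have : ‖X‖ ≤ 1 := hXη.trans hη3
    have h0 : 0 ≤ 2 * S.R * (1 + 2 * S.R) := by positivity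
    nlinarith
  have hvn : ‖v‖ ≤ D / 2 := by
    refine (norm_sub_le _ _).trans ?_
    rw [U_norm, norm_smul, U_norm (O''⁻¹) (xi X (g.a - p))]
    have h1 : ‖(1 + τ)⁻¹‖ ≤ 2 := by
      rw [norm_inv, Real.norm_eq_abs, inv_le_comm₀ (abs_pos.2 hτ0) (by norm_num)]
      exact le_trans (by linarith) (le_abs_self _)
    have h2 : ‖(1 + τ)⁻¹‖ * ‖xi X (g.a - p)‖ ≤ 2 * (2 * S.R * (1 + 2 * S.R)) := by gcongr
    rw [hD]; linarith [hpn]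
  have hs'n : ‖s'‖ ≤ D := by
    refine (norm_sub_le _ _).trans ?_
    have := Pr_norm L v
    linarith
  set p' := O''.1 s' with hp'
  have hp'n : ‖p'‖ ≤ D := by rw [hp', U_norm]; exact hs'n
  set bh := xi X (g.a - p) + (1 + τ) • (p' - p) with hbh
  set b := g.c⁻¹ • (g.O⁻¹).1 bh with hb
  set τ' : S.St := S.appw w (Hm (Sim.trans p) * σ'.1, σ'.2.1, O') with hτ'
  set τ'' : S.St := S.appw w (Hm (Sim.trans p') * σ''.1, σ''.2.1, O'') with hτ''
  have hObh : (O''⁻¹).1 bh = A (xi X (g.a - p)) - (1 + τ) • A p := by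
    have e1 : (1 + τ) • v = (1 + τ) • (O''⁻¹).1 p - (O''⁻¹).1 (xi X (g.a - p)) := by
      rw [hv, smul_sub, smul_smul, mul_inv_cancel₀ hτ0, one_smul]
    have e2 : (1 + τ) • Pr L v = (1 + τ) • A p - A (xi X (g.a - p)) := by
      rw [← map_smul, e1, map_sub, map_smul]; rfl
    rw [hbh, map_add, map_smul, map_sub, hp', U_inv_apply, smul_sub, hs', smul_sub, e1, e2]
    abel
  have hO2 : τ''.2.2 = g.O⁻¹ * O'' := S.appw_O _ _
  have hO1 : τ'.2.2 = g.O⁻¹ * O' := S.appw_O _ _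
  have hOb : (τ''.2.2⁻¹).1 b = g.c⁻¹ • (O''⁻¹).1 bh := by
    rw [hO2, hb, map_smul, mul_inv_rev, inv_inv, U_mul, U_apply_inv]
  have hbn : ‖b‖ = ρ⁻¹ * ‖(O''⁻¹).1 bh‖ := by
    rw [hb, norm_smul, U_norm, U_norm, hgc, norm_inv, Real.norm_of_nonneg hρ0.le]
  have hz1 : τ'.1 = Hm (Sim.trans (-p) * g)⁻¹ * σ'.1 := by
    rw [hτ', appw_z, ← mul_assoc, ← Hm_mul, mul_inv_rev]
    congr 3
    rw [eq_inv_iff_mul_eq_one, ← trans_add, add_neg_cancel, trans_zero]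
  have hz2 : τ''.1 = Hm (Sim.trans (-p') * g)⁻¹ * σ''.1 := by
    rw [hτ'', appw_z, ← mul_assoc, ← Hm_mul, mul_inv_rev]
    congr 3
    rw [eq_inv_iff_mul_eq_one, ← trans_add, add_neg_cancel, trans_zero]
  refine ⟨τ', τ'', hmat (Sim.trans (-p') * g)⁻¹ * (1 + X) * hmat (Sim.trans (-p) * g), b, ?_, ?_, ?_, ?_, ?_, ?_,
    ?_, ?_, ?_⟩
  · exact S.Tn_appw w (by rw [hwl, zero_add]; exact S.Tn_shift hT' hsL)
  · exact S.Tn_appw w (by rw [hwl, zero_add]; exact S.Tn_shift hT'' hs'L)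
  · have := Hm_hmat (Sim.trans (-p) * g)⁻¹ (Sim.trans (-p') * g)⁻¹ (by simp) (1 + X)
    rw [inv_inv] at this
    rw [← this, hz1, hz2, hz, mul_assoc, ← mul_assoc (Hm (Sim.trans (-p) * g)), Hm_mul_inv, one_mul, mul_assoc]
  · refine (drift_err hR hD0.le X g p p' (by rw [hgc]; exact hρ1) hgaR hpn hp'n).trans ?_
    gcongr
  · rw [hOb, hObh]
    refine Submodule.smul_mem _ _ (Submodule.sub_mem _ (Pr_mem _ _) (Submodule.smul_mem _ _ (Pr_mem _ _)))
  · rw [hbn, hObh, inv_mul_eq_div, le_div_iff₀ hρ0]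
    linarith
  · rw [hbn, hObh, inv_mul_eq_div, div_le_iff₀ hρ0]
    have h5 := quad_ext A X (by norm_num : (1:ℝ) ≤ 2) hR0.le hDL.1 _ hx2
    have h6 := hDL.2 s hsL
    have h7 : ‖(1 + τ) • A p‖ ≤ 2 * (ε * ρ) := by
      rw [norm_smul]
      have h8 : ‖1 + τ‖ ≤ 2 := by rw [Real.norm_eq_abs, abs_le]; constructor <;> linarith
      have h9 : ‖A p‖ ≤ ε * ρ := by
        refine h6.trans ?_
        have : 0 < ε * ρ := by positivity
        nlinarith
      gcongr
    refine (norm_sub_le _ _).trans ?_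
    linarith
  · intro j hj
    exact S.appw_b w _ _ j (by omega)
  · rw [hO1, hO2, mul_inv_rev, inv_inv, mul_assoc, mul_inv_cancel_left]
    exact hOη

end Sys
end BA

namespace BA
set_option linter.unusedSectionVars false
set_option linter.unusedSimpArgs false
open Sim
variable {d : ℕ}

namespace Sys
variable (S : Sys d)
variable {Ts : Set (VV d)}

set_option maxHeartbeats 1000000 in
theorem drift2 (hM : S.IsMx Ts) : ∃ k : ℝ, 0 < k ∧ ∀ ε : ℝ, 0 < ε →
    ∃ t ∈ stab Ts, t ∈ (Ls Ts)ᗮ ∧ k * ε ≤ ‖t‖ ∧ ‖t‖ ≤ 18 * ε := by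
  obtain ⟨k, C, hk, hC, H⟩ := S.drift1 hM
  refine ⟨k, hk, fun ε hε => ?_⟩
  have hR0 : 0 < S.R := by linarith [S.hR]
  set η : ℕ → ℝ := fun j => 1 / (4 * S.R) * (1 / ((j:ℝ) + 1)) with hη
  have hη0 : ∀ j, 0 < η j := fun j => by simp only [hη]; positivity
  have hη1 : ∀ j, η j ≤ 1 / (4 * S.R) := by
    intro j
    simp only [hη]
    have : 1 / ((j:ℝ) + 1) ≤ 1 := by
      rw [div_le_one (by positivity)]
      have : (0:ℝ) ≤ j := Nat.cast_nonneg j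
      linarith
    exact mul_le_of_le_one_right (by positivity) this
  have hηl : Tendsto η atTop (𝓝 0) := by
    have := (tendsto_one_div_add_atTop_nhds_zero_nat (𝕜 := ℝ)).const_mul (1 / (4 * S.R))
    simpa [hη] using this
  choose σ' σ'' Y b h1 h2 h3 h4 h5 h6 h7 h8 h9 using fun j => H ε (η j) j hε (hη0 j) (hη1 j)
  obtain ⟨C1, hC1⟩ := S.exists_Cm
  choose γ hγ hγn using fun j => hC1 _ _ (S.Tn_OmS hM (h1 j))
  set s' : ℕ → S.St := fun j => S.rg (σ' j) (γ j) with hs'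
  set s'' : ℕ → S.St := fun j => S.rg (σ'' j) (γ j) with hs''
  have hC10 : 0 ≤ C1 := (norm_nonneg _).trans (hγn 0)
  have hs3 : ∀ j, (s'' j).1 = Y j * (s' j).1 := by
    intro j
    change (σ'' j).1 * γ j = Y j * ((σ' j).1 * γ j)
    rw [h3, mul_assoc]
  have hYn : ∀ j, ‖Y j‖ ≤ C * (1 / (4 * S.R)) + (1 + 18 * ε) := by
    intro j
    have e1 : Y j = (Y j - hmat (Sim.trans (b j))) + hmat (Sim.trans (b j)) := by abel
    rw [e1]
    refine (norm_add_le _ _).trans ?_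
    have := hmat_trans_norm (b j)
    have h10 := h4 j
    have h11 : C * η j ≤ C * (1 / (4 * S.R)) := by gcongr; exact hη1 j
    linarith [h7 j]
  obtain ⟨l', φ1, hφ1, hl'⟩ := S.subseq C1 s' hγn
  obtain ⟨l'', φ2, hφ2, hl''⟩ := S.subseq ((C * (1 / (4 * S.R)) + (1 + 18 * ε)) * C1) (s'' ∘ φ1) (by
    intro j
    change ‖(s'' (φ1 j)).1‖ ≤ _
    rw [hs3]
    refine (norm_mul_le _ _).trans ?_
    gcongr
    · exact hYn _
    · exact hγn _)
  obtain ⟨b0, hb0, φ3, hφ3, hb⟩ := (isCompact_closedBall (0 : VV d) (18 * ε)).tendsto_subseq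
    (x := b ∘ φ1 ∘ φ2) (by intro j; simpa using h7 _)
  set φ := φ1 ∘ φ2 ∘ φ3 with hφ
  have hφm : StrictMono φ := hφ1.comp (hφ2.comp hφ3)
  have hφt : Tendsto φ atTop atTop := hφm.tendsto_atTop
  have L' : Tendsto (fun j => s' (φ j)) atTop (𝓝 l') := hl'.comp (hφ2.comp hφ3).tendsto_atTop
  have L'' : Tendsto (fun j => s'' (φ j)) atTop (𝓝 l'') := hl''.comp hφ3.tendsto_atTop
  have Lb : Tendsto (fun j => b (φ j)) atTop (𝓝 b0) := hb
  have Lη : Tendsto (fun j => η (φ j)) atTop (𝓝 0) := hηl.comp hφt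
  -- limits are of level 0
  have T' : S.Tn Ts 0 l' := by
    refine (S.Tn_closed 0).mem_of_tendsto L' (Eventually.of_forall fun j => ?_)
    exact (S.Tn_rg (hγ _)).2 (h1 _)
  have T'' : S.Tn Ts 0 l'' := by
    refine (S.Tn_closed 0).mem_of_tendsto L'' (Eventually.of_forall fun j => ?_)
    exact (S.Tn_rg (hγ _)).2 (h2 _)
  -- matrices
  have Lt : Tendsto (fun j => hmat (Sim.trans (b (φ j)))) atTop (𝓝 (hmat (Sim.trans b0))) := by
    have := (continuous_trans.tendsto b0).comp Lb
    simpa only [Function.comp_def, Hm_trans] using this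
  have LY : Tendsto (fun j => Y (φ j)) atTop (𝓝 (hmat (Sim.trans b0))) := by
    have e : Tendsto (fun j => Y (φ j) - hmat (Sim.trans (b (φ j)))) atTop (𝓝 0) := by
      refine squeeze_zero_norm (fun j => h4 (φ j)) ?_
      simpa using Lη.const_mul C
    simpa using e.add Lt
  have L'1 : Tendsto (fun j => (s' (φ j)).1) atTop (𝓝 l'.1) := (continuous_fst.tendsto _).comp L'
  have L''1 : Tendsto (fun j => (s'' (φ j)).1) atTop (𝓝 l''.1) := (continuous_fst.tendsto _).comp L''
  have hz : l''.1 = hmat (Sim.trans b0) * l'.1 := by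
    refine tendsto_nhds_unique L''1 ?_
    simp only [hs3]
    exact LY.mul L'1
  -- letters
  have hbb : l''.2.1 = l'.2.1 := by
    funext i
    have q' : Tendsto (fun j => (s' (φ j)).2.1 i) atTop (𝓝 (l'.2.1 i)) :=
      (((continuous_apply i).comp (continuous_fst.comp continuous_snd)).tendsto l').comp L'
    have q'' : Tendsto (fun j => (s'' (φ j)).2.1 i) atTop (𝓝 (l''.2.1 i)) :=
      (((continuous_apply i).comp (continuous_fst.comp continuous_snd)).tendsto l'').comp L''
    refine tendsto_nhds_unique (q''.congr' ?_) q'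
    filter_upwards [hφt.eventually_gt_atTop i] with j hj
    exact (h8 (φ j) i hj).symm
  -- rotations
  have LO' : Tendsto (fun j => (s' (φ j)).2.2) atTop (𝓝 (l'.2.2)) :=
    ((continuous_snd.comp continuous_snd).tendsto l').comp L'
  have LO'' : Tendsto (fun j => (s'' (φ j)).2.2) atTop (𝓝 (l''.2.2)) :=
    ((continuous_snd.comp continuous_snd).tendsto l'').comp L''
  have LO''i : Tendsto (fun j => ((s'' (φ j)).2.2⁻¹).1) atTop (𝓝 ((l''.2.2⁻¹).1)) :=
    (continuous_Uinv.tendsto _).comp LO''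
  have LO'v : Tendsto (fun j => ((s' (φ j)).2.2).1) atTop (𝓝 ((l'.2.2).1)) :=
    (continuous_subtype_val.tendsto _).comp LO'
  have hO : l''.2.2 = l'.2.2 := by
    have e1 : Tendsto (fun j => ((s'' (φ j)).2.2⁻¹).1 * ((s' (φ j)).2.2).1) atTop
      (𝓝 ((l''.2.2⁻¹).1 * (l'.2.2).1)) := LO''i.mul LO'v
    have e2 : Tendsto (fun j => ((s'' (φ j)).2.2⁻¹).1 * ((s' (φ j)).2.2).1) atTop (𝓝 1) := by
      rw [tendsto_iff_norm_sub_tendsto_zero]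
      exact squeeze_zero (fun _ => norm_nonneg _) (fun j => h9 (φ j)) Lη
    have e3 := tendsto_nhds_unique e1 e2
    have e4 : l''.2.2⁻¹ * l'.2.2 = 1 := Subtype.ext e3
    rw [inv_mul_eq_one] at e4
    exact e4
  set t := (l'.2.2⁻¹).1 b0 with ht
  have Lt2 : Tendsto (fun j => ((s'' (φ j)).2.2⁻¹).1 (b (φ j))) atTop (𝓝 t) := by
    rw [ht, ← hO]
    exact ((continuous_fst.clm_apply continuous_snd).tendsto
      (((l''.2.2⁻¹).1, b0) : (VV d →L[ℝ] VV d) × VV d)).comp (LO''i.prodMk_nhds Lb)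
  have Ln : Tendsto (fun j => ‖b (φ j)‖) atTop (𝓝 ‖t‖) := by
    rw [ht, U_norm]; exact Lb.norm
  have key : ∀ x, x ∈ Ts ↔ x + t ∈ Ts := by
    intro x
    rw [S.Tn_eq hM T'' x, S.Tn_eq hM T' (x + t), pow_zero, one_smul, one_smul]
    change S.Om _ _ ↔ S.Om _ _
    rw [hz, hbb, hO, map_add, ht, U_apply_inv, trans_add, Hm_mul, mul_assoc, Hm_trans b0]
  refine ⟨t, ?_, ?_, ?_, ?_⟩
  · intro x hx
    refine ⟨(key x).1 hx, (key _).2 ?_⟩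
    rwa [sub_add_cancel]
  · exact (Submodule.closed_of_finiteDimensional _).mem_of_tendsto Lt2 (Eventually.of_forall fun j => h5 (φ j))
  · exact ge_of_tendsto Ln (Eventually.of_forall fun j => h6 (φ j))
  · exact le_of_tendsto Ln (Eventually.of_forall fun j => h7 (φ j))

/-- **Core theorem** -/
theorem core (z : WW d →L[ℝ] WW d) (hz : |z.det| = 1) : ¬ S.Kset z := by
  intro hK
  obtain ⟨Ts, hM⟩ := S.exists_max (S.exists_OmS z hz hK)
  obtain ⟨k, hk, H⟩ := S.drift2 hM
  choose t h1 h2 h3 h4 using fun j : ℕ => H (1 / ((j:ℝ) + 1)) (by positivity)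
  refine no_small_stab (S.Ts_closed hM) t h1 h2 (fun j h0 => ?_) ?_
  · have := h3 j
    rw [h0, norm_zero] at this
    have : 0 < k * (1 / ((j:ℝ) + 1)) := by positivity
    linarith
  · refine squeeze_zero (fun _ => norm_nonneg _) h4 ?_
    simpa using (tendsto_one_div_add_atTop_nhds_zero_nat (𝕜 := ℝ)).const_mul 18

end Sys
end BA

namespace BA
set_option linter.unusedSectionVars false
set_option linter.unusedSimpArgs false
open Sim
variable {d : ℕ}

/-- composition along a word -/
def pw {E : Type*} (g : E → Sim d) (w : List E) : Sim d := (w.map g).prod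

section
variable {E : Type*} (g : E → Sim d)

lemma pw_nil : pw g [] = 1 := rfl
lemma pw_cons (e : E) (w : List E) : pw g (e :: w) = g e * pw g w := by simp [pw]
lemma pw_append (v w : List E) : pw g (v ++ w) = pw g v * pw g w := by simp [pw]
lemma pw_flatten (l : List (List E)) : pw g l.flatten = (l.map (pw g)).prod := by
  induction l with
  | nil => rfl
  | cons v l ih => rw [List.flatten_cons, pw_append, ih]; simp
lemma pw_rep (k : ℕ) (e : E) : pw g (List.replicate k e) = g e ^ k := by simp [pw]

lemma pw_c_le (hg : ∀ e, (g e).c < 1) (w : List E) : (pw g w).c ≤ 1 := by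
  induction w with
  | nil => rw [pw_nil, one_c]
  | cons e w ih => rw [pw_cons, mul_c]; exact mul_le_one₀ (hg e).le (pw g w).hc.le ih

/-- maps the ball of radius `R` into itself, quantitatively -/
def Bd (R : ℝ) (g : Sim d) : Prop := ‖g.a‖ ≤ (1 - g.c) * R

lemma Bd_mul {R : ℝ} {g h : Sim d} (hg : Bd R g) (hh : Bd R h) : Bd R (g * h) := by
  unfold Bd at *
  rw [mul_a, mul_c, act]
  refine (norm_add_le _ _).trans ?_
  rw [norm_smul, U_norm, Real.norm_of_nonneg g.hc.le]
  have := mul_le_mul_of_nonneg_left hh g.hc.le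
  linarith

lemma Bd_one {R : ℝ} : Bd R (1 : Sim d) := by simp [Bd]

lemma Bd_pw {R : ℝ} (h : ∀ e, Bd R (g e)) (w : List E) : Bd R (pw g w) := by
  induction w with
  | nil => exact Bd_one
  | cons e w ih => rw [pw_cons]; exact Bd_mul (h e) ih

lemma Bd_ball {R : ℝ} {g : Sim d} (hg : Bd R g) (x : VV d) (hx : ‖x‖ ≤ R) : ‖g.act x‖ ≤ R := by
  refine (norm_add_le _ _).trans ?_
  rw [norm_smul, U_norm, Real.norm_of_nonneg g.hc.le]
  have := mul_le_mul_of_nonneg_left hx g.hc.le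
  unfold Bd at hg
  linarith

lemma Bd_fix {R : ℝ} {g : Sim d} (hg : Bd R g) (h1 : g.c < 1) (x : VV d) (hx : g.act x = x) : ‖x‖ ≤ R := by
  have h2 : ‖x‖ ≤ g.c * ‖x‖ + ‖g.a‖ := by
    conv_lhs => rw [← hx]
    refine (norm_add_le _ _).trans ?_
    rw [norm_smul, U_norm, Real.norm_of_nonneg g.hc.le]
  unfold Bd at hg
  have h3 : (1 - g.c) * ‖x‖ ≤ (1 - g.c) * R := by linarith
  exact le_of_mul_le_mul_left h3 (by linarith)

lemma exists_fix (g : Sim d) (h1 : g.c < 1) : ∃ x, g.act x = x := by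
  have : ContractingWith ⟨g.c, g.hc.le⟩ g.act := by
    refine ⟨by exact_mod_cast h1, LipschitzWith.of_dist_le_mul fun x y => ?_⟩
    rw [dist_eq_norm, dist_eq_norm, norm_act_sub]; rfl
  exact ⟨_, this.fixedPoint_isFixedPt⟩

lemma exists_R [Finite E] (hg : ∀ e, (g e).c < 1) : ∃ R : ℝ, 1 ≤ R ∧ ∀ e, Bd R (g e) := by
  obtain ⟨R, hR⟩ := (Set.finite_range fun e => ‖(g e).a‖ / (1 - (g e).c)).bddAbove
  refine ⟨max 1 R, le_max_left _ _, fun e => ?_⟩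
  have h1 : ‖(g e).a‖ / (1 - (g e).c) ≤ R := hR ⟨e, rfl⟩
  have h2 : 0 < 1 - (g e).c := by linarith [hg e]
  rw [div_le_iff₀ h2] at h1
  unfold Bd
  calc _ ≤ R * (1 - (g e).c) := h1
    _ ≤ max 1 R * (1 - (g e).c) := by gcongr; exact le_max_right _ _
    _ = _ := mul_comm _ _

/-- irreducibility for families of similarities -/
def Irr : Prop := ∀ L : AffineSubspace ℝ (VV d), (L : Set (VV d)).Nonempty →
  (∀ e, (g e).act '' (L : Set (VV d)) = L) → L = ⊤

/-- orbit -/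
def orb (x0 : VV d) : Set (VV d) := {y | ∃ w, y = (pw g w).act x0}

lemma x0_mem_orb (x0 : VV d) : x0 ∈ orb g x0 := ⟨[], by simp [pw_nil]⟩

lemma act_mem_orb {x0 y : VV d} (h : y ∈ orb g x0) (w : List E) : (pw g w).act y ∈ orb g x0 := by
  obtain ⟨v, rfl⟩ := h
  exact ⟨w ++ v, by rw [pw_append, mul_act]⟩

lemma image_eq_of_subset (h : Sim d) (L : AffineSubspace ℝ (VV d)) (hL : (L : Set (VV d)).Nonempty)
    (hs : ∀ x ∈ L, h.act x ∈ L) : h.act '' (L : Set (VV d)) = L := by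
  obtain ⟨p, hp⟩ := hL
  apply Set.Subset.antisymm
  · rintro _ ⟨x, hx, rfl⟩; exact hs x hx
  · intro y hy
    set T : VV d →ₗ[ℝ] VV d := h.c • (h.O.1 : VV d →ₗ[ℝ] VV d) with hT
    have hTL : ∀ v ∈ L.direction, T v ∈ L.direction := by
      intro v hv
      have h1 : v +ᵥ p ∈ L := AffineSubspace.vadd_mem_of_mem_direction hv hp
      have h2 := AffineSubspace.vsub_mem_direction (hs _ h1) (hs _ hp)
      rw [vsub_eq_sub, act_sub, vadd_eq_add, add_sub_cancel_right] at h2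
      exact h2
    have hinj : Function.Injective (T.restrict hTL) := by
      rw [injective_iff_map_eq_zero]
      rintro ⟨v, hv⟩ h0
      have h3 : T v = 0 := congrArg Subtype.val h0
      have h4 : ‖T v‖ = h.c * ‖v‖ := by
        simp [hT, norm_smul, abs_of_pos h.hc]
      rw [h3, norm_zero] at h4
      have : ‖v‖ = 0 := by
        rcases mul_eq_zero.1 h4.symm with h | h
        · exact absurd h (Sim.hc _).ne'
        · exact h
      exact Subtype.ext (norm_eq_zero.1 this)
    have hsurj := LinearMap.injective_iff_surjective.1 hinj
    have hy2 : y - h.act p ∈ L.direction := AffineSubspace.vsub_mem_direction hy (hs _ hp)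
    obtain ⟨⟨v, hv⟩, hv2⟩ := hsurj ⟨_, hy2⟩
    have hv3 : T v = y - h.act p := congrArg Subtype.val hv2
    refine ⟨v + p, AffineSubspace.vadd_mem_of_mem_direction hv hp, ?_⟩
    have h5 := act_sub h (v + p) p
    rw [add_sub_cancel_right] at h5
    have h6 : h.c • h.O.1 v = y - h.act p := hv3
    rw [h6] at h5
    exact sub_left_injective h5

lemma affine_orb (hirr : Irr g) (x0 : VV d) (l : VV d →L[ℝ] ℝ) (h : ∀ y ∈ orb g x0, l (y - x0) = 0) :
    l = 0 := by
  have hx := x0_mem_orb g x0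
  have htop : affineSpan ℝ (orb g x0) = ⊤ := by
    refine hirr _ ⟨x0, subset_affineSpan ℝ _ hx⟩ fun e => ?_
    refine image_eq_of_subset _ _ ⟨x0, subset_affineSpan ℝ _ hx⟩ ?_
    intro x hx'
    -- the preimage of the span is affine
    set T : VV d →ᵃ[ℝ] VV d := ((g e).c • ((g e).O.1 : VV d →ₗ[ℝ] VV d)).toAffineMap +
      AffineMap.const ℝ (VV d) (g e).a with hT
    have hTa : ∀ y, T y = (g e).act y := fun y => by simp [hT, act]
    have h1 : affineSpan ℝ (orb g x0) ≤ (affineSpan ℝ (orb g x0)).comap T := by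
      rw [affineSpan_le]
      intro y hy
      change T y ∈ affineSpan ℝ (orb g x0)
      rw [hTa]
      apply subset_affineSpan
      simpa [pw] using act_mem_orb g hy [e]
    have h2 := h1 hx'
    rw [AffineSubspace.mem_comap, hTa] at h2
    exact h2
  have h3 : affineSpan ℝ (orb g x0) ≤ AffineSubspace.mk' x0 (LinearMap.ker (l : VV d →ₗ[ℝ] ℝ)) := by
    rw [affineSpan_le]
    intro y hy
    change y ∈ AffineSubspace.mk' x0 _
    rw [AffineSubspace.mem_mk']
    simpa using h y hy
  rw [htop] at h3
  ext v
  have h4 : v + x0 ∈ AffineSubspace.mk' x0 (LinearMap.ker (l : VV d →ₗ[ℝ] ℝ)) := h3 (AffineSubspace.mem_top _ _ _)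
  rw [AffineSubspace.mem_mk'] at h4
  simpa using h4

/-- a quadratic polynomial vanishing on an orbit is zero -/
lemma quad_orb (hirr : Irr g) (e0 : E) (he0 : (g e0).c < 1) (x0 : VV d) (hx0 : (g e0).act x0 = x0)
    (α : ℝ) (l : VV d →L[ℝ] ℝ) (B : VV d →L[ℝ] VV d →L[ℝ] ℝ)
    (h : ∀ y ∈ orb g x0, α + l y + B y y = 0) (x : VV d) : α + l x + B x x = 0 := by
  have hfix : ∀ k : ℕ, (g e0 ^ k).act x0 = x0 := by
    intro k
    induction k with
    | zero => simp
    | succ k ih => rw [pow_succ, mul_act, hx0, ih]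
  have hpc : ∀ k : ℕ, (g e0 ^ k).c = (g e0).c ^ k := by
    intro k
    induction k with
    | zero => simp
    | succ k ih => rw [pow_succ, mul_c, ih, pow_succ]
  have := U_compact (d := d)
  -- derivative vanishes on the orbit
  have hder : ∀ x ∈ orb g x0, l + B x + B.flip x = 0 := by
    intro x hx
    have hqx := h x hx
    obtain ⟨w, rfl⟩ := hx
    set x := (pw g w).act x0
    set D := l + B x + B.flip x with hD
    obtain ⟨A, -, φ, hφ, hA⟩ := isCompact_univ.tendsto_subseq (x := fun k : ℕ => (g e0 ^ k).O)
      (fun _ => Set.mem_univ _)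
    have hA1 : Tendsto (fun k => (g e0 ^ (φ k)).O.1) atTop (𝓝 A.1) :=
      (continuous_subtype_val.tendsto _).comp hA
    have key : (D.comp (pw g w).O.1).comp A.1 = 0 := by
      refine affine_orb g hirr x0 _ fun y hy => ?_
      set c := (pw g w).c with hc
      have hc0 : 0 < c := (pw g w).hc
      set v : ℕ → VV d := fun k => (pw g w).O.1 ((g e0 ^ (φ k)).O.1 (y - x0)) with hv
      have hvl : Tendsto v atTop (𝓝 ((pw g w).O.1 (A.1 (y - x0)))) := by
        have h1 : Tendsto (fun k => (g e0 ^ (φ k)).O.1 (y - x0)) atTop (𝓝 (A.1 (y - x0))) :=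
          ((ContinuousLinearMap.apply ℝ (VV d) (y - x0)).continuous.tendsto _).comp hA1
        exact ((pw g w).O.1.continuous.tendsto _).comp h1
      have hpt : ∀ k, x + (c * (g e0).c ^ (φ k)) • v k ∈ orb g x0 := by
        intro k
        have h1 := act_mem_orb g hy (w ++ List.replicate (φ k) e0)
        rw [pw_append, pw_rep, mul_act] at h1
        have h2 : (g e0 ^ φ k).act y = x0 + (g e0).c ^ φ k • (g e0 ^ φ k).O.1 (y - x0) := by
          have := act_sub (g e0 ^ φ k) y x0
          rw [hfix, hpc] at this
          rw [← this]; abel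
        have h3 := act_sub (pw g w) ((g e0 ^ φ k).act y) x0
        have h4 : (pw g w).act ((g e0 ^ φ k).act y) = x + (c * (g e0).c ^ (φ k)) • v k := by
          rw [sub_eq_iff_eq_add] at h3
          rw [h3, h2, add_sub_cancel_left, map_smul, smul_smul, add_comm]
        rwa [h4] at h1
      have heq : ∀ k, D (v k) = -((c * (g e0).c ^ (φ k)) * B (v k) (v k)) := by
        intro k
        have h1 := h _ (hpt k)
        set r := c * (g e0).c ^ (φ k)
        have hr : 0 < r := mul_pos hc0 (pow_pos (g e0).hc _)
        have h2 : r * (D (v k) + r * B (v k) (v k)) = 0 := by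
          simp only [map_add, map_smul, add_apply, smul_apply, smul_eq_mul, hD,
            ContinuousLinearMap.flip_apply] at h1 ⊢
          linear_combination h1 - hqx
        have h3 := (mul_eq_zero.1 h2).resolve_left hr.ne'
        linarith
      have hlim1 : Tendsto (fun k => D (v k)) atTop (𝓝 (D ((pw g w).O.1 (A.1 (y - x0))))) :=
        (D.continuous.tendsto _).comp hvl
      have hlim2 : Tendsto (fun k => D (v k)) atTop (𝓝 0) := by
        simp only [heq]
        have h1 : Tendsto (fun k => c * (g e0).c ^ (φ k)) atTop (𝓝 (c * 0)) :=
          ((tendsto_pow_atTop_nhds_zero_of_lt_one (g e0).hc.le he0).comp hφ.tendsto_atTop).const_mul c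
        have h2 : Continuous fun u : VV d => B u u := B.continuous.clm_apply continuous_id
        have h3 := h1.mul ((h2.tendsto _).comp hvl)
        simpa using h3.neg
      exact tendsto_nhds_unique hlim1 hlim2
    ext u
    have := congrArg (fun T : VV d →L[ℝ] ℝ => T ((A⁻¹).1 (((pw g w).O⁻¹).1 u))) key
    simpa using this
  -- hence everywhere
  have hder2 : ∀ x u, (l + B x + B.flip x) u = 0 := by
    intro x u
    have h0 := hder x0 (x0_mem_orb g x0)
    have h1 : (B.flip u + B u) = 0 := by
      refine affine_orb g hirr x0 _ fun y hy => ?_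
      have h2 := congrArg (fun T : VV d →L[ℝ] ℝ => T u) (hder y hy)
      have h3 := congrArg (fun T : VV d →L[ℝ] ℝ => T u) h0
      simp only [add_apply, ContinuousLinearMap.flip_apply, zero_apply, map_sub, sub_apply] at h2 h3 ⊢
      linarith
    have h2 := congrArg (fun T : VV d →L[ℝ] ℝ => T x) h1
    have h3 := congrArg (fun T : VV d →L[ℝ] ℝ => T x0) h1
    have h4 := congrArg (fun T : VV d →L[ℝ] ℝ => T u) h0
    simp only [add_apply, ContinuousLinearMap.flip_apply, zero_apply, map_sub, sub_apply] at h2 h3 h4 ⊢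
    linarith
  have hl : l = 0 := by
    ext u
    have := hder2 0 u
    simpa using this
  have hB : ∀ x, B x x = 0 := by
    intro x
    have := hder2 x x
    simp [hl] at this
    linarith
  have h0 := h x0 (x0_mem_orb g x0)
  rw [hB, hl] at h0 ⊢
  simpa using h0

end
end BA

namespace BA
set_option linter.unusedSectionVars false
set_option linter.unusedSimpArgs false
open Sim
variable {d : ℕ}

/-- quadratic polynomials -/
abbrev QQ (d : ℕ) := ℝ × (VV d →L[ℝ] ℝ) × (VV d →L[ℝ] VV d →L[ℝ] ℝ)

def ev (x : VV d) : QQ d →ₗ[ℝ] ℝ where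
  toFun p := p.1 + p.2.1 x + p.2.2 x x
  map_add' p q := by simp; ring
  map_smul' r p := by simp; ring

lemma ev_apply (x : VV d) (p : QQ d) : ev x p = p.1 + p.2.1 x + p.2.2 x x := rfl

lemma ev_bound {R : ℝ} (hR : 1 ≤ R) (x : VV d) (hx : ‖x‖ ≤ R) (p : QQ d) : |ev x p| ≤ 3 * R ^ 2 * ‖p‖ := by
  have h1 : ‖p.1‖ ≤ ‖p‖ := norm_fst_le p
  have h2 : ‖p.2.1‖ ≤ ‖p‖ := (norm_fst_le p.2).trans (norm_snd_le p)
  have h3 : ‖p.2.2‖ ≤ ‖p‖ := (norm_snd_le p.2).trans (norm_snd_le p)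
  have h4 : ‖p.2.1 x‖ ≤ ‖p‖ * R := (p.2.1.le_opNorm x).trans (by gcongr)
  have h5 : ‖p.2.2 x x‖ ≤ ‖p‖ * R * R := (p.2.2.le_opNorm₂ x x).trans (by gcongr)
  rw [ev_apply, ← Real.norm_eq_abs]
  have h6 : ‖p.1 + p.2.1 x + p.2.2 x x‖ ≤ ‖p.1‖ + ‖p.2.1 x‖ + ‖p.2.2 x x‖ := norm_add₃_le
  have hp := norm_nonneg p
  have h7 : ‖p‖ ≤ ‖p‖ * R := le_mul_of_one_le_right hp hR
  have h8 : ‖p‖ * R ≤ ‖p‖ * R * R := le_mul_of_one_le_right (by positivity) hR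
  nlinarith

lemma ev_lip {R : ℝ} (hR : 1 ≤ R) (x y : VV d) (hx : ‖x‖ ≤ R) (hy : ‖y‖ ≤ R) (p : QQ d) :
    |ev x p - ev y p| ≤ 3 * R * ‖p‖ * ‖x - y‖ := by
  have h2 : ‖p.2.1‖ ≤ ‖p‖ := (norm_fst_le p.2).trans (norm_snd_le p)
  have h3 : ‖p.2.2‖ ≤ ‖p‖ := (norm_snd_le p.2).trans (norm_snd_le p)
  have hp := norm_nonneg p
  have e : ev x p - ev y p = p.2.1 (x - y) + p.2.2 x (x - y) + p.2.2 (x - y) y := by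
    rw [ev_apply, ev_apply]; simp; ring
  have h4 : ‖p.2.1 (x - y)‖ ≤ ‖p‖ * ‖x - y‖ := (p.2.1.le_opNorm _).trans (by gcongr)
  have h5 : ‖p.2.2 x (x - y)‖ ≤ ‖p‖ * R * ‖x - y‖ := (p.2.2.le_opNorm₂ _ _).trans (by gcongr)
  have h6 : ‖p.2.2 (x - y) y‖ ≤ ‖p‖ * ‖x - y‖ * R := (p.2.2.le_opNorm₂ _ _).trans (by gcongr)
  rw [e, ← Real.norm_eq_abs]
  refine norm_add₃_le.trans ?_
  have : ‖p‖ * ‖x - y‖ ≤ ‖p‖ * ‖x - y‖ * R := le_mul_of_one_le_right (by positivity) hR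
  linarith

/-- abstract norming lemma in finite dimensions -/
lemma norming_abs {P X : Type*} [NormedAddCommGroup P] [NormedSpace ℝ P] [FiniteDimensional ℝ P]
    (ev : X → P →ₗ[ℝ] ℝ) (O : Set X) (hO : ∀ p, (∀ x ∈ O, ev x p = 0) → ∀ x, ev x p = 0) :
    ∃ (m : ℕ) (y : Fin m → X) (C : ℝ), 0 < C ∧ (∀ i, y i ∈ O) ∧ ∀ p : P, ∃ p' : P,
      (∀ x, ev x p = ev x p') ∧ ∀ M, 0 ≤ M → (∀ i, |ev (y i) p| ≤ M) → ‖p'‖ ≤ C * M := by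
  have hfg : (Submodule.span ℝ ((fun x => ev x) '' O)).FG := IsNoetherian.noetherian _
  rw [Submodule.fg_span_iff_fg_span_finset_subset] at hfg
  obtain ⟨s', hs', hspan⟩ := hfg
  set en := s'.equivFin
  have hy : ∀ i, ∃ y, y ∈ O ∧ ev y = ((en.symm i : s') : P →ₗ[ℝ] ℝ) := by
    intro i
    obtain ⟨y, hy, h⟩ := hs' (en.symm i).2
    exact ⟨y, hy, h⟩
  choose y hy hyev using hy
  have hker : ∀ p : P, (∀ i, ev (y i) p = 0) → ∀ x, ev x p = 0 := by
    intro p hp x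
    refine hO p ?_ x
    intro u hu
    have h1 : ev u ∈ Submodule.span ℝ (s' : Set (P →ₗ[ℝ] ℝ)) := by
      rw [← hspan]; exact Submodule.subset_span ⟨u, hu, rfl⟩
    have h2 : Submodule.span ℝ (s' : Set (P →ₗ[ℝ] ℝ)) ≤ LinearMap.ker (LinearMap.applyₗ (R := ℝ) (M₂ := ℝ) p) := by
      rw [Submodule.span_le]
      intro f hf
      have := hp (en ⟨f, hf⟩)
      rw [hyev] at this
      simpa using this
    exact h2 h1
  set T : P →ₗ[ℝ] (Fin s'.card → ℝ) := LinearMap.pi fun i => ev (y i) with hT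
  obtain ⟨G, hG⟩ := LinearMap.exists_rightInverse_of_surjective T.rangeRestrict (LinearMap.range_rangeRestrict T)
  set Gc := LinearMap.toContinuousLinearMap G with hGc
  refine ⟨_, y, ‖Gc‖ + 1, by positivity, hy, fun p => ⟨G (T.rangeRestrict p), ?_, ?_⟩⟩
  · intro x
    rw [← sub_eq_zero, ← map_sub]
    refine hker _ (fun i => ?_) x
    have h1 : T.rangeRestrict (G (T.rangeRestrict p)) = T.rangeRestrict p :=
      LinearMap.congr_fun hG (T.rangeRestrict p)
    have h2 : T (G (T.rangeRestrict p)) = T p := congrArg Subtype.val h1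
    have h3 := congrFun h2 i
    rw [map_sub, sub_eq_zero]
    exact h3.symm
  · intro M hM0 hM
    have h1 : ‖T.rangeRestrict p‖ ≤ M := by
      change ‖T p‖ ≤ M
      rw [pi_norm_le_iff_of_nonneg hM0]
      exact hM
    have h2 : ‖Gc (T.rangeRestrict p)‖ ≤ ‖Gc‖ * ‖T.rangeRestrict p‖ := Gc.le_opNorm _
    have h3 : ‖Gc‖ * ‖T.rangeRestrict p‖ ≤ (‖Gc‖ + 1) * M := by gcongr; linarith
    exact h2.trans h3
lemma norming_prod {A B X : Type*} [NormedAddCommGroup A] [NormedSpace ℝ A] [FiniteDimensional ℝ A]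
    [NormedAddCommGroup B] [NormedSpace ℝ B] [FiniteDimensional ℝ B]
    (e1 : X → A →ₗ[ℝ] ℝ) (e2 : X → B →ₗ[ℝ] ℝ) (O : Set X)
    (hO : ∀ p : ℝ × A × B, (∀ x ∈ O, p.1 + e1 x p.2.1 + e2 x p.2.2 = 0) → ∀ x, p.1 + e1 x p.2.1 + e2 x p.2.2 = 0) :
    ∃ (m : ℕ) (y : Fin m → X) (C : ℝ), 0 < C ∧ (∀ i, y i ∈ O) ∧ ∀ p : ℝ × A × B, ∃ p' : ℝ × A × B,
      (∀ x, p.1 + e1 x p.2.1 + e2 x p.2.2 = p'.1 + e1 x p'.2.1 + e2 x p'.2.2) ∧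
      ∀ M, 0 ≤ M → (∀ i, |p.1 + e1 (y i) p.2.1 + e2 (y i) p.2.2| ≤ M) → ‖p'‖ ≤ C * M :=
  norming_abs (fun x => ⟨⟨fun p : ℝ × A × B => p.1 + e1 x p.2.1 + e2 x p.2.2,
    fun p q => by simp; ring⟩, fun r p => by simp; ring⟩) O hO

section
variable {E : Type*} (g : E → Sim d)


lemma exists_norming (hirr : Irr g) (e0 : E) (he0 : (g e0).c < 1) (x0 : VV d) (hx0 : (g e0).act x0 = x0) :
    ∃ (m : ℕ) (y : Fin m → VV d) (C : ℝ), 0 < C ∧ (∀ i, y i ∈ orb g x0) ∧ ∀ p : QQ d, ∃ p' : QQ d,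
      (∀ x, ev x p = ev x p') ∧ ∀ M, 0 ≤ M → (∀ i, |ev (y i) p| ≤ M) → ‖p'‖ ≤ C * M := by
  exact norming_prod (fun x => ⟨⟨fun l : VV d →L[ℝ] ℝ => l x, fun _ _ => rfl⟩, fun _ _ => rfl⟩)
    (fun x => ⟨⟨fun B : VV d →L[ℝ] VV d →L[ℝ] ℝ => B x x, fun _ _ => rfl⟩, fun _ _ => rfl⟩) (orb g x0)
    (fun p hp => quad_orb g hirr e0 he0 x0 hx0 _ _ _ hp)

theorem exists_sys (hd : 0 < d) [Finite E] [Nonempty E] (hg : ∀ e, (g e).c < 1) (hirr : Irr g) (δ : ℝ) (hδ : 0 < δ) :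
    ∃ S : Sys d, S.δ = δ ∧ ∀ i, ∃ w, S.f i = pw g w := by
  classical
  obtain ⟨e0⟩ := ‹Nonempty E›
  obtain ⟨x0, hx0⟩ := exists_fix (g e0) (hg e0)
  obtain ⟨R, hR, hBd⟩ := exists_R g hg
  obtain ⟨m, y, C, hC, hy, hnorm⟩ := exists_norming g hirr e0 (hg e0) x0 hx0
  have hx0R : ‖x0‖ ≤ R := Bd_fix (hBd e0) (hg e0) x0 hx0
  have hm : 0 < m := by
    by_contra hm
    have hm0 : m = 0 := by omega
    subst hm0
    obtain ⟨p', h1, h2⟩ := hnorm (1, 0, 0)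
    have h3 := h2 0 le_rfl (fun i => i.elim0)
    rw [mul_zero] at h3
    have h4 := h1 0
    have h5 := ev_bound le_rfl (0 : VV d) (by simp) p'
    have h6 : |ev (0 : VV d) p'| ≤ 0 := h5.trans (by linarith)
    rw [← h4, ev_apply] at h6
    simp at h6
    exact absurd h6 (by norm_num)
  choose v hv using hy
  have hfix : ∀ k : ℕ, (g e0 ^ k).act x0 = x0 := by
    intro k
    induction k with
    | zero => simp
    | succ k ih => rw [pow_succ, mul_act, hx0, ih]
  have hpc : ∀ k : ℕ, (g e0 ^ k).c = (g e0).c ^ k := by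
    intro k
    induction k with
    | zero => simp
    | succ k ih => rw [pow_succ, mul_c, ih, pow_succ]
  obtain ⟨ρ, hρ0, hρ⟩ : ∃ ρ > 0, 3 * R * C * ρ ≤ 1 / 2 :=
    ⟨1 / (2 * (3 * R * C)), by positivity, by field_simp; rfl⟩
  obtain ⟨N, hN⟩ := exists_pow_lt_of_lt_one (show 0 < ρ / (2 * R) by positivity) (hg e0)
  set A : Fin m → List E := fun i => v i ++ List.replicate (N + 1) e0 with hA
  set u : Fin m → List E := fun i => A i ++ (((List.finRange m).erase i).map A).flatten with hu
  have hAc : ∀ i, (pw g (A i)).c < 1 := by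
    intro i
    simp only [hA]
    rw [pw_append, pw_rep, mul_c, hpc]
    have h1 := pw_c_le g hg (v i)
    have h2 : (g e0).c ^ (N + 1) < 1 := pow_lt_one₀ (g e0).hc.le (hg e0) (by omega)
    exact lt_of_le_of_lt (mul_le_of_le_one_left (pow_pos (g e0).hc _).le h1) h2
  have hcprod : ∀ l : List (Sim d), l.prod.c = (l.map fun h => h.c).prod := by
    intro l
    induction l with
    | nil => rfl
    | cons h l ih => rw [List.prod_cons, mul_c, ih]; simp
  have huc : ∀ i, (pw g (u i)).c = ((List.finRange m).map fun j => (pw g (A j)).c).prod := by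
    intro i
    simp only [hu]
    rw [pw_append, mul_c, pw_flatten, hcprod, List.map_map, List.map_map]
    exact List.prod_map_erase (fun j => (pw g (A j)).c) (List.mem_finRange i)
  set i0 : Fin m := ⟨0, hm⟩
  have huc1 : ∀ i, (pw g (u i)).c < 1 := by
    intro i
    simp only [hu]
    rw [pw_append, mul_c]
    exact lt_of_le_of_lt (mul_le_of_le_one_right (Sim.hc _).le (pw_c_le g hg _)) (hAc i)
  obtain ⟨x1, hx1⟩ := exists_fix (pw g (u i0)) (huc1 i0)
  have hyR : ∀ i, ‖y i‖ ≤ R := fun i => by rw [hv i]; exact Bd_ball (Bd_pw g hBd _) _ hx0R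
  have hclose : ∀ i x, ‖x‖ ≤ R → ‖(pw g (u i)).act x - y i‖ ≤ ρ := by
    intro i x hx
    simp only [hu]
    rw [pw_append, mul_act]
    set z := (pw g (((List.finRange m).erase i).map A).flatten).act x with hz
    have hzR : ‖z‖ ≤ R := Bd_ball (Bd_pw g hBd _) _ hx
    simp only [hA]
    rw [pw_append, pw_rep, mul_act, hv i]
    rw [norm_act_sub]
    have h1 := norm_act_sub (g e0 ^ (N + 1)) z x0
    rw [hfix, hpc] at h1
    rw [h1]
    have h2 : ‖z - x0‖ ≤ 2 * R := (norm_sub_le _ _).trans (by linarith)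
    have h3 : (g e0).c ^ (N + 1) ≤ ρ / (2 * R) := by
      refine le_trans ?_ hN.le
      exact pow_le_pow_of_le_one (g e0).hc.le (hg e0).le (by omega)
    have h4 : (g e0).c ^ (N + 1) * ‖z - x0‖ ≤ ρ / (2 * R) * (2 * R) := by gcongr
    rw [div_mul_cancel₀ _ (by positivity)] at h4
    have h5 : 0 ≤ (g e0).c ^ (N + 1) * ‖z - x0‖ := mul_nonneg (pow_pos (g e0).hc _).le (norm_nonneg _)
    exact (mul_le_of_le_one_left h5 (pw_c_le g hg _)).trans h4
  have hne : (Finset.univ : Finset (Fin m)).Nonempty := ⟨i0, Finset.mem_univ _⟩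
  refine ⟨{
    m := m
    f := fun i => pw g (u i)
    c := ((List.finRange m).map fun j => (pw g (A j)).c).prod
    hc0 := by rw [← huc i0]; exact Sim.hc _
    hc1 := by rw [← huc i0]; exact huc1 i0
    hfc := huc
    R := R
    hR := hR
    hball := fun i x hx => Bd_ball (Bd_pw g hBd _) x hx
    C0 := 3 * R ^ 2 * (C * 2)
    hC0 := by positivity
    norming := ?_
    i0 := i0
    x0 := x1
    hx0 := hx1
    hx0R := Bd_fix (Bd_pw g hBd _) (huc1 i0) x1 hx1
    δ := δ
    hδ := hδ
    hd := hd }, rfl, fun i => ⟨u i, rfl⟩⟩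
  intro α l B z hz M hM x hx
  set p : QQ d := (α, l, B) with hp
  have hM' : ∀ i, |ev ((pw g (u i)).act (z i)) p| ≤ M := hM
  change |ev x p| ≤ _
  obtain ⟨p', hp1, hp2⟩ := hnorm p
  -- the maximum on the finite set
  obtain ⟨j, -, hj⟩ := Finset.exists_max_image Finset.univ (fun i => |ev (y i) p|) hne
  set K := |ev (y j) p| with hK
  have hK0 : 0 ≤ K := abs_nonneg _
  have h1 := hp2 K hK0 (fun i => hj i (Finset.mem_univ _))
  have hact : ‖(pw g (u j)).act (z j)‖ ≤ R := Bd_ball (Bd_pw g hBd _) _ (hz j)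
  have h2 := ev_lip hR _ _ (hyR j) hact p'
  rw [← hp1, ← hp1] at h2
  have h3 : ‖y j - (pw g (u j)).act (z j)‖ ≤ ρ := by rw [norm_sub_rev]; exact hclose j _ (hz j)
  have h4 : 3 * R * ‖p'‖ * ‖y j - (pw g (u j)).act (z j)‖ ≤ 3 * R * (C * K) * ρ := by gcongr
  have h5 : 3 * R * (C * K) * ρ ≤ 1 / 2 * K := by
    have := mul_le_mul_of_nonneg_right hρ hK0
    linarith
  have h6 : K ≤ |ev (y j) p - ev ((pw g (u j)).act (z j)) p| + |ev ((pw g (u j)).act (z j)) p| := by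
    have := abs_add_le (ev (y j) p - ev ((pw g (u j)).act (z j)) p) (ev ((pw g (u j)).act (z j)) p)
    rwa [sub_add_cancel] at this
  have h7 : K ≤ 2 * M := by linarith [hM' j]
  rw [hp1]
  refine (ev_bound hR x hx p').trans ?_
  have h8 : ‖p'‖ ≤ C * (2 * M) := h1.trans (by gcongr)
  calc 3 * R ^ 2 * ‖p'‖ ≤ 3 * R ^ 2 * (C * (2 * M)) := by gcongr
    _ = _ := by ring

end
end BA

namespace BA
set_option linter.unusedSectionVars false
set_option linter.unusedSimpArgs false
open Sim
variable {d : ℕ}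

lemma exists_sim (φ : VV d → VV d) (c : ℝ) (hc : 0 < c)
    (h : ∀ x y, dist (φ x) (φ y) = c * dist x y) : ∃ g : Sim d, g.c = c ∧ ∀ x, g.act x = φ x := by
  have hi : Isometry (fun x => c⁻¹ • (φ x - φ 0)) := by
    refine Isometry.of_dist_eq fun x y => ?_
    rw [dist_eq_norm, ← smul_sub, sub_sub_sub_cancel_right, norm_smul, ← dist_eq_norm, h,
      Real.norm_of_nonneg (inv_pos.2 hc).le, ← mul_assoc, inv_mul_cancel₀ hc.ne', one_mul]
  set T := hi.affineIsometryOfStrictConvexSpace with hT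
  have hTa : ∀ x, T x = c⁻¹ • (φ x - φ 0) := fun x => rfl
  have hT0 : T 0 = 0 := by rw [hTa]; simp
  have hlin : ∀ x, T.linearIsometry x = T x := by
    intro x
    have := T.map_vadd 0 x
    rw [hT0] at this
    simpa using this.symm
  refine ⟨⟨c, hc, Unitary.linearIsometryEquiv.symm (T.linearIsometry.toLinearIsometryEquiv rfl), φ 0⟩, rfl, ?_⟩
  intro x
  have : (Unitary.linearIsometryEquiv.symm (T.linearIsometry.toLinearIsometryEquiv rfl)).1 x = T x :=
    hlin x
  unfold act
  simp only
  rw [this, hTa, smul_smul, mul_inv_cancel₀ hc.ne', one_smul, sub_add_cancel]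

lemma lat_form (ζ : WW d) (hζ : ζ ∈ Lat (bW d)) :
    ∃ (p : Fin d → ℤ) (q : ℤ), ζ = ((EuclideanSpace.equiv (Fin d) ℝ).symm (fun i => (p i : ℝ)), (q : ℝ)) := by
  unfold Lat at hζ
  induction hζ using Submodule.span_induction with
  | mem x hx =>
    obtain ⟨i | i, rfl⟩ := hx
    · refine ⟨Pi.single i 1, 0, ?_⟩
      rw [Sys.bW_inl]
      refine Prod.ext ?_ (by simp)
      ext j
      by_cases hij : j = i
      · subst hij; simp
      · simp [hij]
    · refine ⟨0, 1, ?_⟩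
      rw [Sys.bW_inr]
      refine Prod.ext ?_ (by simp)
      ext j
      simp
  | zero =>
    refine ⟨0, 0, ?_⟩
    refine Prod.ext ?_ (by simp)
    ext j
    simp
  | add x y _ _ hx hy =>
    obtain ⟨p, q, rfl⟩ := hx
    obtain ⟨p', q', rfl⟩ := hy
    refine ⟨p + p', q + q', ?_⟩
    refine Prod.ext ?_ (by simp)
    ext j
    simp
  | smul a x _ hx =>
    obtain ⟨p, q, rfl⟩ := hx
    refine ⟨a • p, a * q, ?_⟩
    refine Prod.ext ?_ (by simp)
    ext j
    simp

lemma norm_int_vec (p : Fin d → ℤ) (hp : p ≠ 0) :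
    1 ≤ ‖(EuclideanSpace.equiv (Fin d) ℝ).symm (fun i => (p i : ℝ))‖ := by
  obtain ⟨i, hi⟩ := Function.ne_iff.1 hp
  have h1 := PiLp.norm_apply_le ((EuclideanSpace.equiv (Fin d) ℝ).symm (fun i => (p i : ℝ))) i
  refine le_trans ?_ h1
  have : (1:ℤ) ≤ |p i| := Int.one_le_abs hi
  simp
  exact_mod_cast this

lemma Hm_inv_fst (g : Sim d) (ζ : WW d) : ‖(Hm g⁻¹ ζ).1‖ = g.c ^ (-(1:ℝ) / (d + 1)) * ‖ζ.1 - ζ.2 • g.a‖ := by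
  rw [Hm_apply, hmat_apply, inv_a, inv_c, inv_O]
  have h1 : g.c⁻¹ • (g.O⁻¹).1 ζ.1 + ζ.2 • -(g.c⁻¹ • (g.O⁻¹).1 g.a) = g.c⁻¹ • (g.O⁻¹).1 (ζ.1 - ζ.2 • g.a) := by
    rw [map_sub, map_smul, smul_sub, smul_neg, smul_comm ζ.2, sub_eq_add_neg]
  rw [Prod.smul_fst, h1, norm_smul, norm_smul, U_norm, ← mul_assoc]
  congr 1
  rw [Real.norm_of_nonneg (Real.rpow_nonneg (inv_pos.2 g.hc).le _), Real.norm_of_nonneg (inv_pos.2 g.hc).le,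
    Real.inv_rpow g.hc.le, ← Real.rpow_neg g.hc.le, ← Real.rpow_neg_one, ← Real.rpow_add g.hc]
  congr 1
  field_simp
  ring

lemma Hm_inv_snd (g : Sim d) (ζ : WW d) : ‖(Hm g⁻¹ ζ).2‖ = g.c ^ ((d:ℝ) / (d + 1)) * |ζ.2| := by
  rw [Hm_apply, hmat_apply, Prod.smul_snd, inv_c]
  rw [norm_smul, Real.norm_of_nonneg (Real.rpow_nonneg (inv_pos.2 g.hc).le _), Real.inv_rpow g.hc.le,
    ← Real.rpow_neg g.hc.le, neg_div, neg_neg, Real.norm_eq_abs]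

lemma good_of_ba (hd : 0 < d) {κ R δ : ℝ} (g : Sim d) (hg1 : g.c ≤ 1) (x : VV d) (hx : ‖x‖ ≤ R) (hR : 1 ≤ R)
    (hδ : 0 < δ) (hδ1 : δ ≤ 1) (hδκ : (R + 1) * δ ≤ κ)
    (h : ∀ q : ℕ, 0 < q → ∀ p : Fin d → ℤ, κ * (q : ℝ) ^ (-(1 : ℝ) / d) ≤
      ‖(q : ℝ) • g.act x - (EuclideanSpace.equiv (Fin d) ℝ).symm (fun i => (p i : ℝ))‖) :
    Good δ (Hm g⁻¹) := by
  have hκ : 0 < κ := lt_of_lt_of_le (by positivity) hδκ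
  have hdR : (0:ℝ) < d := by exact_mod_cast hd
  -- the case of nonnegative last coordinate
  have key : ∀ (p : Fin d → ℤ) (q : ℕ), (p ≠ 0 ∨ q ≠ 0) →
      δ ≤ ‖Hm g⁻¹ ((EuclideanSpace.equiv (Fin d) ℝ).symm (fun i => (p i : ℝ)), (q : ℝ))‖ := by
    intro p q hpq
    set P := (EuclideanSpace.equiv (Fin d) ℝ).symm (fun i => (p i : ℝ)) with hP
    set ζ : WW d := (P, (q:ℝ)) with hζ
    have hs1 : 1 ≤ g.c ^ (-(1:ℝ) / (d + 1)) :=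
      Real.one_le_rpow_of_pos_of_le_one_of_nonpos g.hc hg1 (by rw [neg_div]; simp; positivity)
    rcases Nat.eq_zero_or_pos q with hq | hq
    · have hp : p ≠ 0 := by
        rcases hpq with h | h
        · exact h
        · exact absurd hq h
      refine le_trans ?_ (norm_fst_le _)
      rw [Hm_inv_fst]
      have h2 : ζ.1 - ζ.2 • g.a = P := by simp [hζ, hq]
      rw [h2]
      have := norm_int_vec p hp
      calc δ ≤ 1 * 1 := by linarith
        _ ≤ _ := by gcongr
    · by_contra! hlt
      have h1 := lt_of_le_of_lt (norm_fst_le _) hlt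
      have h2 := lt_of_le_of_lt (norm_snd_le _) hlt
      rw [Hm_inv_fst] at h1
      rw [Hm_inv_snd] at h2
      have hq0 : (0:ℝ) < q := by exact_mod_cast hq
      simp only [hζ, abs_of_pos hq0] at h1 h2
      set s := g.c ^ (-(1:ℝ) / (d + 1)) with hs
      set t := g.c ^ ((d:ℝ) / (d + 1)) with ht
      have hsc : s * g.c = t := by
        rw [hs, ht]
        conv_lhs => rw [← Real.rpow_one g.c, ← Real.rpow_mul g.hc.le, ← Real.rpow_add g.hc]
        congr 1; field_simp; ring
      have hst : s = t ^ (-(1:ℝ) / d) := by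
        rw [hs, ht, ← Real.rpow_mul g.hc.le]; congr 1; field_simp
      have ht0 : 0 < t := Real.rpow_pos_of_pos g.hc _
      have h3 := h q hq p
      have h4 : ‖(q:ℝ) • g.act x - P‖ ≤ ‖P - (q:ℝ) • g.a‖ + q * (g.c * R) := by
        have e : (q:ℝ) • g.act x - P = -(P - (q:ℝ) • g.a) + (q:ℝ) • (g.c • g.O.1 x) := by
          unfold act; rw [smul_add]; abel
        rw [e]
        refine (norm_add_le _ _).trans ?_
        rw [norm_neg, norm_smul, norm_smul, U_norm, Real.norm_of_nonneg hq0.le, Real.norm_of_nonneg g.hc.le]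
        have := g.hc
        gcongr
      have h5 : s * (κ * (q : ℝ) ^ (-(1 : ℝ) / d)) ≤ s * ‖P - (q:ℝ) • g.a‖ + (t * q) * R := by
        have := mul_le_mul_of_nonneg_left (h3.trans h4) (zero_le_one.trans hs1)
        rw [← hsc]; linarith
      have h6 : s * (κ * (q : ℝ) ^ (-(1 : ℝ) / d)) = κ * (t * q) ^ (-(1 : ℝ) / d) := by
        rw [Real.mul_rpow ht0.le hq0.le, ← hst]; ring
      have h7 : 1 ≤ (t * q) ^ (-(1 : ℝ) / d) :=
        Real.one_le_rpow_of_pos_of_le_one_of_nonpos (by positivity) (by linarith) (by rw [neg_div]; simp)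
      have h8 : κ ≤ κ * (t * q) ^ (-(1 : ℝ) / d) := le_mul_of_one_le_right hκ.le h7
      have h9 : (t * q) * R ≤ δ * R := by gcongr
      linarith
  intro ζ hζ h0
  obtain ⟨p, q, rfl⟩ := lat_form ζ hζ
  have hpq : p ≠ 0 ∨ q ≠ 0 := by
    by_contra! hc
    apply h0
    rw [hc.1, hc.2]
    refine Prod.ext ?_ (by simp)
    ext j; simp
  rcases le_total 0 q with hq | hq
  · obtain ⟨n, rfl⟩ := Int.eq_ofNat_of_zero_le hq
    have := key p n (by simpa using hpq)
    simpa using this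
  · obtain ⟨n, hn⟩ := Int.eq_ofNat_of_zero_le (neg_nonneg.2 hq)
    have hqn : q = -(n : ℤ) := by omega
    subst hqn
    have := key (-p) n (by simpa using hpq)
    refine this.trans (le_of_eq ?_)
    rw [← norm_neg, ← map_neg]
    congr 2
    refine Prod.ext ?_ (by simp)
    ext j; simp

theorem no_ba {E : Type*} (g : E → Sim d) (hd : 0 < d) [Finite E] [Nonempty E] (hg : ∀ e, (g e).c < 1) (hirr : Irr g)
    (δ : ℝ) (hδ : 0 < δ)
    (H : ∀ l : ℕ, ∃ w : List E, ∀ u : List E, u.length ≤ l → Good δ (Hm (pw g (w ++ u))⁻¹)) : False := by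
  choose w hw using H
  obtain ⟨C, hC⟩ := mahler (bW d) δ hδ
  have hy : ∀ l, ∃ γ ∈ Gam (bW d), ‖Hm (pw g (w l))⁻¹ * γ‖ ≤ C := fun l =>
    hC _ (det_Hm _) (by have := hw l [] (by simp); rwa [List.append_nil] at this)
  choose γ hγ hγC using hy
  have : ProperSpace (WW d →L[ℝ] WW d) := FiniteDimensional.proper ℝ _
  obtain ⟨z, -, ψ, hψ, hz⟩ := (isCompact_closedBall (0 : WW d →L[ℝ] WW d) C).tendsto_subseq
    (x := fun l => Hm (pw g (w l))⁻¹ * γ l) (fun l => by simpa using hγC l)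
  have hdet : |z.det| = 1 := by
    have h1 := (continuous_abs.comp (ContinuousLinearMap.continuous_det (𝕜 := ℝ) (E := WW d))).tendsto z
    have h2 := h1.comp hz
    refine tendsto_nhds_unique h2 ?_
    refine tendsto_const_nhds.congr fun l => ?_
    have h3 : |(Hm (pw g (w (ψ l)))⁻¹ * γ (ψ l)).det| = 1 := by
      rw [det_mul', abs_mul, det_Hm, (hγ _).1, one_mul]
    exact h3.symm
  have hgood : ∀ u, Good δ (Hm (pw g u)⁻¹ * z) := by
    intro u
    refine (Good_closed δ).mem_of_tendsto (tendsto_const_nhds.mul hz) ?_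
    filter_upwards [eventually_ge_atTop u.length] with l hl
    have h1 := hw (ψ l) u (hl.trans (hψ.id_le l))
    rw [pw_append, mul_inv_rev, Hm_mul] at h1
    have h2 := Good_mul_gam h1 (hγ (ψ l))
    rw [mul_assoc] at h2
    exact h2
  obtain ⟨S, hS, hSf⟩ := exists_sys g hd hg hirr δ hδ
  refine S.core z hdet fun v => ?_
  choose f hf using hSf
  have : S.prodw v = pw g (v.map f).flatten := by
    rw [pw_flatten, Sys.prodw, List.map_map]
    congr 1
    exact List.map_congr_left fun i _ => hf i
  rw [hS, this]
  exact hgood _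

end BA

namespace BA
open Sim
section measure
variable {E : Type*}

/-- cylinder of a word -/
def cyl (w : List E) : Set (ℕ → E) := {b | (List.range w.length).map b = w}

lemma cyl_append_left {v u : List E} {b : ℕ → E} (h : b ∈ cyl (v ++ u)) : b ∈ cyl v := by
  unfold cyl at *
  simp only [Set.mem_ofPred_eq, List.length_append, List.range_add, List.map_append] at *
  exact (List.append_inj h (by simp)).1

lemma cyl_cover (w : List E) (l : ℕ) {b : ℕ → E} (h : b ∈ cyl w) :
    b ∈ cyl (w ++ List.ofFn (fun i : Fin l => b (w.length + i))) := by
  unfold cyl at *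
  simp only [Set.mem_ofPred_eq, List.length_append, List.range_add, List.map_append, List.length_ofFn] at *
  rw [h]
  congr 1
  refine List.ext_getElem (by simp) ?_
  intro i h1 h2
  simp

variable [Fintype E] [MeasurableSpace E] [MeasurableSingletonClass E] (μ : Measure E)

/-- weight of a word -/
def wt (w : List E) : ENNReal := (w.map fun e => μ {e}).prod

lemma cyl_measure {β : Measure (ℕ → E)} (hβ : IsBernoulli μ β) (w : List E) : β (cyl w) = wt μ w := by
  have h1 := hβ.2 (Finset.range w.length) (fun i => {e | w[i]? = some e})
    (fun i _ => (Set.toFinite _).measurableSet)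
  have h2 : cyl w = {b : ℕ → E | ∀ i ∈ Finset.range w.length, b i ∈ {e | w[i]? = some e}} := by
    ext b
    simp only [cyl, Set.mem_ofPred_eq, Finset.mem_range]
    constructor
    · intro h i hi
      rw [← h]; simp [hi]
    · intro h
      refine List.ext_getElem (by simp) ?_
      intro i h1 h2
      have := h i h2
      rw [List.getElem?_eq_getElem h2] at this
      simp only [List.getElem_map, List.getElem_range]
      exact (Option.some.inj this).symm
  rw [h2, h1]
  clear h1 h2
  induction w with
  | nil => simp [wt]
  | cons e w ih =>
    rw [List.length_cons, Finset.prod_range_succ']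
    simp only [List.getElem?_cons_succ, List.getElem?_cons_zero]
    rw [ih]
    have : {e' | some e = some e'} = {e} := by ext; simp [eq_comm]
    rw [this]
    simp [wt, mul_comm]

lemma wt_append (v w : List E) : wt μ (v ++ w) = wt μ v * wt μ w := by simp [wt]

lemma wt_ofFn (l : ℕ) (u : Fin l → E) : wt μ (List.ofFn u) = ∏ i, μ {u i} := by
  simp [wt, List.map_ofFn, List.prod_ofFn]

lemma sum_wt [IsProbabilityMeasure μ] (l : ℕ) : ∑ u : Fin l → E, wt μ (List.ofFn u) = 1 := by
  classical
  simp only [wt_ofFn]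
  rw [← Fintype.prod_sum (fun (_ : Fin l) (e : E) => μ {e})]
  have : ∑ e : E, μ {e} = 1 := by
    rw [MeasureTheory.sum_measure_singleton]
    simp
  simp [this]

/-- a positive measure set meets all extensions of some word -/
lemma exists_word [Nonempty E] [IsProbabilityMeasure μ] (hμ : ∀ e : E, 0 < μ {e}) {β : Measure (ℕ → E)} (hβ : IsBernoulli μ β)
    (A : Set (ℕ → E)) (hA : β A ≠ 0) (l : ℕ) :
    ∃ w : List E, ∀ u : Fin l → E, ∃ b ∈ A, b ∈ cyl (w ++ List.ofFn u) := by
  classical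
  by_contra! H
  obtain ⟨u₀, hu₀⟩ := Finite.exists_min (fun u : Fin l → E => wt μ (List.ofFn u))
  set p := wt μ (List.ofFn u₀) with hp
  have hp0 : 0 < p := by
    rw [hp, wt_ofFn]
    exact CanonicallyOrderedAdd.prod_pos.2 fun i _ => hμ _
  have hle1 : ∀ u : Fin l → E, wt μ (List.ofFn u) ≤ 1 := by
    intro u
    rw [← sum_wt μ l]
    exact Finset.single_le_sum (f := fun u : Fin l → E => wt μ (List.ofFn u)) (fun _ _ => zero_le) (Finset.mem_univ u)
  have step : ∀ n : ℕ, ∀ w : List E, β (cyl w ∩ A) ≤ (1 - p) ^ n * wt μ w := by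
    intro n
    induction n with
    | zero =>
      intro w
      rw [pow_zero, one_mul, ← cyl_measure μ hβ]
      exact measure_mono Set.inter_subset_left
    | succ n ih =>
      intro w
      obtain ⟨u, hu⟩ := H w
      have h1 : cyl w ∩ A ⊆ ⋃ v ∈ Finset.univ.erase u, (cyl (w ++ List.ofFn v) ∩ A) := by
        rintro b ⟨hb, hbA⟩
        have h2 := cyl_cover w l hb
        simp only [Set.mem_iUnion]
        refine ⟨_, ?_, h2, hbA⟩
        rw [Finset.mem_erase]
        refine ⟨?_, Finset.mem_univ _⟩
        intro h3
        rw [h3] at h2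
        exact hu b hbA h2
      have h4 : ∑ v ∈ Finset.univ.erase u, wt μ (List.ofFn v) ≤ 1 - p := by
        have h5 := Finset.add_sum_erase Finset.univ (fun v : Fin l → E => wt μ (List.ofFn v)) (Finset.mem_univ u)
        rw [sum_wt] at h5
        refine le_trans ?_ (tsub_le_tsub_left (hu₀ u) 1)
        refine ENNReal.le_sub_of_add_le_left (ne_top_of_le_ne_top ENNReal.one_ne_top (hle1 u)) h5.le
      calc β (cyl w ∩ A) ≤ ∑ v ∈ Finset.univ.erase u, β (cyl (w ++ List.ofFn v) ∩ A) :=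
            (measure_mono h1).trans (measure_biUnion_finset_le _ _)
        _ ≤ ∑ v ∈ Finset.univ.erase u, (1 - p) ^ n * wt μ w * wt μ (List.ofFn v) := by
            refine Finset.sum_le_sum fun v _ => (ih _).trans ?_
            rw [wt_append, mul_assoc]
        _ = (1 - p) ^ n * wt μ w * ∑ v ∈ Finset.univ.erase u, wt μ (List.ofFn v) := by rw [Finset.mul_sum]
        _ ≤ (1 - p) ^ n * wt μ w * (1 - p) := by gcongr
        _ = _ := by ring
  have h6 : ∀ n : ℕ, β A ≤ (1 - p) ^ n := by
    intro n
    have := step n []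
    simpa [cyl, wt] using this
  have h7 : Tendsto (fun n : ℕ => (1 - p) ^ n) atTop (𝓝 0) :=
    ENNReal.tendsto_pow_atTop_nhds_zero_of_lt_one (ENNReal.sub_lt_self ENNReal.one_ne_top one_ne_zero hp0.ne')
  exact hA (le_antisymm (ge_of_tendsto' h7 h6) zero_le)

end measure

variable {d : ℕ}

lemma seqApply_eq {E : Type*} (φ : E → VV d → VV d) (g : E → Sim d) (h : ∀ e x, (g e).act x = φ e x)
    (b : ℕ → E) (n : ℕ) (x : VV d) : seqApply φ b n x = (pw g ((List.range n).map b)).act x := by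
  induction n generalizing x with
  | zero => simp [seqApply, pw_nil]
  | succ n ih =>
    rw [List.range_succ, List.map_append, pw_append, mul_act]
    change seqApply φ b n (φ (b n) x) = _
    rw [ih, ← h]
    simp [pw]

lemma continuous_act (g : Sim d) : Continuous g.act := by
  unfold act
  fun_prop

end BA

/-- **Theorem.** Let `Φ = (φ_e)_{e ∈ E}` be an irreducible finite similarity IFS on `ℝ^d`
and let `μ` be a probability measure on `E` with `μ({e}) > 0` for all `e`.  Then
`π_*β(BA) = 0`, where `β = μ^{⊗ℕ}` and `π` is the coding map. -/
theorem bernoulli_finite_IFS_badlyApproximable_eq_zero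
    (d : ℕ) (hd : 1 ≤ d) {E : Type*} [Fintype E] [Nonempty E] [MeasurableSpace E]
    [MeasurableSingletonClass E]
    (φ : E → EuclideanSpace ℝ (Fin d) → EuclideanSpace ℝ (Fin d))
    (hsim : ∀ e, ContractingSimilarity (φ e))
    (hirr : IrreducibleIFS φ)
    (μ : Measure E) [IsProbabilityMeasure μ] (hμpos : ∀ e : E, 0 < μ {e})
    (β : Measure (ℕ → E)) (hβ : IsBernoulli μ β)
    (π : (ℕ → E) → EuclideanSpace ℝ (Fin d))
    (hπ : ∀ (b : ℕ → E) (x₀ : EuclideanSpace ℝ (Fin d)),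
      Tendsto (fun n => seqApply φ b n x₀) atTop (𝓝 (π b))) :
    β (π ⁻¹' badlyApproximable d) = 0 := by
  have hex : ∀ e, ∃ g : BA.Sim d, g.c < 1 ∧ ∀ x, g.act x = φ e x := by
    intro e
    obtain ⟨c, hc0, hc1, h⟩ := hsim e
    obtain ⟨g, hg, hg2⟩ := BA.exists_sim (φ e) c hc0 h
    exact ⟨g, hg ▸ hc1, hg2⟩
  choose g hg hact using hex
  have hirr' : BA.Irr g := by
    intro L hL h
    by_contra hne
    refine hirr ⟨L, hL, hne, fun e => ?_⟩
    rw [← h e]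
    have : φ e = (g e).act := funext fun x => (hact e x).symm
    rw [this, h e, h e]
  obtain ⟨R, hR, hBd⟩ := BA.exists_R g hg
  have hπR : ∀ b, ‖π b‖ ≤ R := by
    intro b
    refine le_of_tendsto' (hπ b 0).norm fun n => ?_
    rw [BA.seqApply_eq φ g hact]
    exact BA.Bd_ball (BA.Bd_pw g hBd _) _ (by simp; linarith)
  have hπw : ∀ (w : List E) (b : ℕ → E), b ∈ BA.cyl w → π b = (BA.pw g w).act (π fun n => b (w.length + n)) := by
    intro w b hb
    have h1 := (hπ b 0).comp (tendsto_add_atTop_nat w.length)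
    have h2 := ((BA.continuous_act (BA.pw g w)).tendsto _).comp (hπ (fun n => b (w.length + n)) 0)
    refine tendsto_nhds_unique h1 (h2.congr fun n => ?_)
    simp only [Function.comp_apply]
    rw [BA.seqApply_eq φ g hact, BA.seqApply_eq φ g hact, ← BA.Sim.mul_act, ← BA.pw_append, add_comm n,
      List.range_add, List.map_append, List.map_map]
    have hb' : (List.range w.length).map b = w := hb
    rw [hb']
    rfl
  set A : ℕ → Set (ℕ → E) := fun k => {b | ∀ q : ℕ, 0 < q → ∀ p : Fin d → ℤ,
    (1 / ((k : ℝ) + 1)) * (q : ℝ) ^ (-(1 : ℝ) / d) ≤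
      ‖(q : ℝ) • π b - (EuclideanSpace.equiv (Fin d) ℝ).symm (fun i => (p i : ℝ))‖} with hA
  have hcov : π ⁻¹' badlyApproximable d ⊆ ⋃ k, A k := by
    rintro b ⟨c, hc, h⟩
    obtain ⟨k, hk⟩ := exists_nat_one_div_lt hc
    refine Set.mem_iUnion.2 ⟨k, fun q hq p => le_trans ?_ (h q hq p)⟩
    gcongr
  refine measure_mono_null hcov (measure_iUnion_null fun k => ?_)
  by_contra hne
  have hκ : (0:ℝ) < 1 / ((k : ℝ) + 1) := by positivity
  set κ : ℝ := 1 / ((k : ℝ) + 1) with hκd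
  have hδ0 : 0 < min 1 (κ / (R + 1)) := lt_min one_pos (by positivity)
  refine BA.no_ba g hd hg hirr' (min 1 (κ / (R + 1))) hδ0 fun l => ?_
  obtain ⟨w, hw⟩ := BA.exists_word μ hμpos hβ (A k) hne l
  refine ⟨w, fun u hu => ?_⟩
  obtain ⟨e0⟩ := ‹Nonempty E›
  have hlen : (u ++ List.replicate (l - u.length) e0).length = l := by simp; omega
  obtain ⟨U, hU⟩ : ∃ U : Fin l → E, List.ofFn U = u ++ List.replicate (l - u.length) e0 := by
    refine ⟨fun i => (u ++ List.replicate (l - u.length) e0).get (i.cast hlen.symm), ?_⟩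
    refine List.ext_getElem ((List.length_ofFn).trans hlen.symm) ?_
    intro i h1 h2
    simp
  obtain ⟨b, hbA, hb⟩ := hw U
  rw [hU, ← List.append_assoc] at hb
  have hb2 := BA.cyl_append_left hb
  refine BA.good_of_ba hd (κ := κ) (BA.pw g (w ++ u)) (BA.pw_c_le g hg _) _
    (hπR fun n => b ((w ++ u).length + n)) hR hδ0 (min_le_left _ _) ?_ ?_
  · have := min_le_right 1 (κ / (R + 1))
    rw [le_div_iff₀ (by linarith)] at this
    linarith
  · rw [← hπw _ b hb2]
    exact hbA
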